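/- Let g satisfy (H) and be strictly increasing, and let c be a speed with c > c_* (encoded as: χ₀(·;c) has two distinct positive real zeros λ₁(c) < λ₂(c), and equation (*) admits wavefronts both with speed c and with some speed c' < c). Let φ be the wavefront with speed c normalized by lim_{z→−∞} e^{−λ₁(c)z} φ(z) = 1. Suppose the initial datum w₀ satisfies (IC1), (IC2) and, for some A > 0, lim_{x→−∞} w₀(s,x) e^{−λ₁(c)(x+cs)} = A uniformly in s ∈ [−h,0]. Then every classical solution u of (*) with initial datum w₀ satisfies lim_{t→∞} sup_{x∈ℝ} |φ(x+ct+a) − u(t,x)| / η_{λ₁(c)}(x+ct) = 0, where a = λ₁(c)^{−1} ln A. -/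

import Mathlib

open Set Filter

noncomputable section

/-- The weight function `η_λ(t) = min{e^{λt}, 1}`. -/
def eta (lam t : ℝ) : ℝ := min (Real.exp (lam * t)) 1

/-- The characteristic function `χ₀(λ) = λ² − cλ − 1 + g0·e^{−λch}` (with `g0 = g'(0)`). -/
def chi (g0 c h lam : ℝ) : ℝ := lam ^ 2 - c * lam - 1 + g0 * Real.exp (-(lam * c * h))

/-- Hypothesis (H) on the birth function `g` (extended linearly and C¹-smoothly to `(−∞,0]`). -/
structure HypH (g : ℝ → ℝ) (kap del0 Lg : ℝ) : Prop where
  cont : Continuous g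
  nonneg : ∀ x : ℝ, 0 ≤ x → 0 ≤ g x
  kap_pos : 0 < kap
  del0_pos : 0 < del0
  fixed_points : ∀ x : ℝ, 0 ≤ x → (g x = x ↔ x = 0 ∨ x = kap)
  smooth0 : ContDiffOn ℝ 1 g (Set.Ioo (-del0) del0)
  smooth_kap : ContDiffOn ℝ 1 g (Set.Ioo (kap - del0) (kap + del0))
  deriv0_gt : 1 < deriv g 0
  deriv_kap_lt : deriv g kap < 1
  lipschitz : ∀ u v : ℝ, 0 ≤ u → 0 ≤ v → |g u - g v| ≤ Lg * |u - v|
  holder : ∃ C > (0:ℝ), ∃ θ ∈ Set.Ioc (0:ℝ) 1,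
      ∀ u ∈ Set.Ioc (0:ℝ) del0, |deriv g u - deriv g 0| ≤ C * u ^ θ
  ext_linear : ∀ x : ℝ, x ≤ 0 → g x = deriv g 0 * x

/-- (IC1): `0 ≤ w₀ ≤ sup w₀ < ∞` on `Π₀ = [−h,0]×ℝ`. -/
def IC1 (h : ℝ) (w0 : ℝ → ℝ → ℝ) : Prop :=
  ∃ M : ℝ, ∀ s ∈ Set.Icc (-h) 0, ∀ x : ℝ, 0 ≤ w0 s x ∧ w0 s x ≤ M

/-- (IC2): `liminf_{x→+∞} min_{s∈[−h,0]} w₀(s,x) > 0`. -/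
def IC2 (h : ℝ) (w0 : ℝ → ℝ → ℝ) : Prop :=
  ∃ m > (0:ℝ), ∃ X : ℝ, ∀ x ≥ X, ∀ s ∈ Set.Icc (-h) 0, m ≤ w0 s x

/-- `w₀` is locally Hölder continuous in `x`, uniformly in `s ∈ [−h,0]`. -/
def LocHolder (h : ℝ) (w0 : ℝ → ℝ → ℝ) : Prop :=
  ∀ R > (0:ℝ), ∃ K > (0:ℝ), ∃ β ∈ Set.Ioc (0:ℝ) 1,
    ∀ s ∈ Set.Icc (-h) 0, ∀ x ∈ Set.Icc (-R) R, ∀ y ∈ Set.Icc (-R) R,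
      |w0 s x - w0 s y| ≤ K * |x - y| ^ β

/-- A classical solution of the equation (*):
`u_t(t,x) = u_{xx}(t,x) − u(t,x) + g(u(t−h,x))` for `t > 0`, `x ∈ ℝ`. -/
def SolvesStar (g : ℝ → ℝ) (h : ℝ) (u : ℝ → ℝ → ℝ) : Prop :=
  ContinuousOn (fun p : ℝ × ℝ => u p.1 p.2) {p : ℝ × ℝ | -h ≤ p.1} ∧
  (∀ T : ℝ, ∃ M : ℝ, ∀ t ∈ Set.Icc (-h) T, ∀ x : ℝ, |u t x| ≤ M) ∧
  (∀ t : ℝ, 0 < t → ∀ x : ℝ,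
      DifferentiableAt ℝ (fun τ => u τ x) t ∧
      DifferentiableAt ℝ (fun y => u t y) x ∧
      DifferentiableAt ℝ (deriv (fun y => u t y)) x ∧
      deriv (fun τ => u τ x) t =
        deriv (deriv (fun y => u t y)) x - u t x + g (u (t - h) x)) ∧
  ContinuousOn (fun p : ℝ × ℝ => deriv (fun τ => u τ p.2) p.1) {p : ℝ × ℝ | 0 < p.1} ∧
  ContinuousOn (fun p : ℝ × ℝ => deriv (fun y => u p.1 y) p.2) {p : ℝ × ℝ | 0 < p.1} ∧
  ContinuousOn (fun p : ℝ × ℝ => deriv (deriv (fun y => u p.1 y)) p.2) {p : ℝ × ℝ | 0 < p.1}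

/-- A classical solution of equation (E1):
`w_t = w_{zz} − c w_z − w + g(w(t−h, z−ch))` for `t > 0`, `z ∈ ℝ`. -/
def SolvesE1 (g : ℝ → ℝ) (h c : ℝ) (w : ℝ → ℝ → ℝ) : Prop :=
  ContinuousOn (fun p : ℝ × ℝ => w p.1 p.2) {p : ℝ × ℝ | -h ≤ p.1} ∧
  (∀ T : ℝ, ∃ M : ℝ, ∀ t ∈ Set.Icc (-h) T, ∀ z : ℝ, |w t z| ≤ M) ∧
  (∀ t : ℝ, 0 < t → ∀ z : ℝ,
      DifferentiableAt ℝ (fun τ => w τ z) t ∧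
      DifferentiableAt ℝ (fun y => w t y) z ∧
      DifferentiableAt ℝ (deriv (fun y => w t y)) z ∧
      deriv (fun τ => w τ z) t =
        deriv (deriv (fun y => w t y)) z - c * deriv (fun y => w t y) z
          - w t z + g (w (t - h) (z - c * h))) ∧
  ContinuousOn (fun p : ℝ × ℝ => deriv (fun τ => w τ p.2) p.1) {p : ℝ × ℝ | 0 < p.1} ∧
  ContinuousOn (fun p : ℝ × ℝ => deriv (fun y => w p.1 y) p.2) {p : ℝ × ℝ | 0 < p.1} ∧
  ContinuousOn (fun p : ℝ × ℝ => deriv (deriv (fun y => w p.1 y)) p.2) {p : ℝ × ℝ | 0 < p.1}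

/-- A wavefront with speed `c`: a positive bounded C² solution of the profile equation
with `φ(−∞) = 0`, `φ(+∞) = κ`. -/
def IsWavefront (g : ℝ → ℝ) (h c kap : ℝ) (φ : ℝ → ℝ) : Prop :=
  (∀ z : ℝ, 0 < φ z) ∧ (∃ M : ℝ, ∀ z : ℝ, φ z ≤ M) ∧ ContDiff ℝ 2 φ ∧
  (∀ z : ℝ, deriv (deriv φ) z - c * deriv φ z - φ z + g (φ (z - c * h)) = 0) ∧
  Filter.Tendsto φ Filter.atBot (nhds 0) ∧ Filter.Tendsto φ Filter.atTop (nhds kap)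

/-- A semi-wavefront with speed `c`: as a wavefront, but at `+∞` only
`liminf_{z→+∞} φ(z) > 0` is required. -/
def IsSemiWavefront (g : ℝ → ℝ) (h c : ℝ) (φ : ℝ → ℝ) : Prop :=
  (∀ z : ℝ, 0 < φ z) ∧ (∃ M : ℝ, ∀ z : ℝ, φ z ≤ M) ∧ ContDiff ℝ 2 φ ∧
  (∀ z : ℝ, deriv (deriv φ) z - c * deriv φ z - φ z + g (φ (z - c * h)) = 0) ∧
  Filter.Tendsto φ Filter.atBot (nhds 0) ∧
  (∃ m > (0:ℝ), ∀ᶠ z in Filter.atTop, m ≤ φ z)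

/-- The nonlinear operator `𝒩` associated with (E1). -/
def Nop (g : ℝ → ℝ) (h c : ℝ) (w : ℝ → ℝ → ℝ) (t z : ℝ) : ℝ :=
  deriv (fun τ => w τ z) t - deriv (deriv (fun y => w t y)) z
    + c * deriv (fun y => w t y) z + w t z - g (w (t - h) (z - c * h))

/-- A super-solution of (E1) with break point `zs`. -/
def IsSuperSolution (g : ℝ → ℝ) (h c : ℝ) (w : ℝ → ℝ → ℝ) (zs : ℝ) : Prop :=
  ContinuousOn (fun p : ℝ × ℝ => w p.1 p.2) {p : ℝ × ℝ | -h ≤ p.1} ∧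
  (∀ t : ℝ, -h < t → ∀ z : ℝ, DifferentiableAt ℝ (fun τ => w τ z) t) ∧
  (∀ t : ℝ, -h ≤ t → ∀ z : ℝ, z ≠ zs →
      DifferentiableAt ℝ (fun y => w t y) z ∧
      DifferentiableAt ℝ (deriv (fun y => w t y)) z) ∧
  (∀ t : ℝ, 0 < t → ∀ z : ℝ, z ≠ zs → 0 ≤ Nop g h c w t z) ∧
  (∀ t : ℝ, 0 < t →
      derivWithin (fun y => w t y) (Set.Iic zs) zs
        > derivWithin (fun y => w t y) (Set.Ici zs) zs)

/-- A sub-solution of (E1) with break point `zs` (all inequalities reversed). -/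
def IsSubSolution (g : ℝ → ℝ) (h c : ℝ) (w : ℝ → ℝ → ℝ) (zs : ℝ) : Prop :=
  ContinuousOn (fun p : ℝ × ℝ => w p.1 p.2) {p : ℝ × ℝ | -h ≤ p.1} ∧
  (∀ t : ℝ, -h < t → ∀ z : ℝ, DifferentiableAt ℝ (fun τ => w τ z) t) ∧
  (∀ t : ℝ, -h ≤ t → ∀ z : ℝ, z ≠ zs →
      DifferentiableAt ℝ (fun y => w t y) z ∧
      DifferentiableAt ℝ (deriv (fun y => w t y)) z) ∧
  (∀ t : ℝ, 0 < t → ∀ z : ℝ, z ≠ zs → Nop g h c w t z ≤ 0) ∧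
  (∀ t : ℝ, 0 < t →
      derivWithin (fun y => w t y) (Set.Iic zs) zs
        < derivWithin (fun y => w t y) (Set.Ici zs) zs)

open Topology

/-- A function whose values to the left of `a` stay below `f a` has nonnegative derivative. -/
theorem HasDerivAt.nonneg_of_eventually_left_le {f : ℝ → ℝ} {f' a : ℝ} (hf : HasDerivAt f f' a)
    (hle : ∀ᶠ y in 𝓝[<] a, f y ≤ f a) : 0 ≤ f' := by
  have h1 : Tendsto (slope f a) (𝓝[<] a) (𝓝 f') :=
    (hasDerivAt_iff_tendsto_slope.1 hf).mono_left
      (nhdsWithin_mono _ fun y hy => ne_of_lt hy)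
  refine ge_of_tendsto h1 ?_
  filter_upwards [hle, self_mem_nhdsWithin] with y hy hya
  rw [slope_def_field]
  exact div_nonneg_of_nonpos (by linarith) (by have : y < a := hya; linarith)

/-- Second derivative test: necessary condition at a local maximum. -/
theorem IsLocalMax.second_deriv_nonpos {f f1 : ℝ → ℝ} {f2 a : ℝ} (hmax : IsLocalMax f a)
    (h1 : ∀ᶠ y in 𝓝 a, HasDerivAt f (f1 y) y) (h2 : HasDerivAt f1 f2 a) : f2 ≤ 0 := by
  by_contra hpos
  push Not at hpos
  have hd : deriv f =ᶠ[𝓝 a] f1 := h1.mono fun y hy => hy.deriv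
  have hd0 : deriv f a = 0 := hmax.deriv_eq_zero
  have hdd : deriv (deriv f) a = f2 := by rw [hd.deriv_eq]; exact h2.deriv
  have hmin : IsLocalMin f a :=
    isLocalMin_of_deriv_deriv_pos (by rw [hdd]; exact hpos) hd0
      h1.self_of_nhds.continuousAt
  have hconst : f =ᶠ[𝓝 a] fun _ => f a := by
    filter_upwards [hmax, hmin] with y hy1 hy2
    exact le_antisymm hy1 hy2
  have hd' : deriv f =ᶠ[𝓝 a] fun _ => 0 := by
    have := hconst.deriv
    simpa using this
  have : deriv (deriv f) a = 0 := by rw [hd'.deriv_eq]; simp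
  linarith

/-- Parabolic maximum principle with delay, on a closed space-time domain. -/
theorem delayed_maximum_principle {h t0 : ℝ} (hh : 0 < h) {D : Set (ℝ × ℝ)} (hD : IsClosed D)
    {d : ℝ → ℝ → ℝ}
    (hcont : ContinuousOn (fun q : ℝ × ℝ => d q.1 q.2) (D ∩ {q | t0 ≤ q.1}))
    (hbdd : ∀ T : ℝ, ∃ M : ℝ, ∀ t ∈ Icc t0 T, ∀ x, (t, x) ∈ D → d t x ≤ M)
    (hinit : ∀ t ∈ Icc (t0 - h) t0, ∀ x, (t, x) ∈ D → d t x ≤ 0)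
    (hstep : ∀ t, t0 < t → ∀ x, (t, x) ∈ D → 0 < d t x →
      (∀ y, (t - h, y) ∈ D → d (t - h) y ≤ 0) →
      D ∈ 𝓝 (t, x) ∧ ∃ (dt : ℝ) (d1 : ℝ → ℝ) (dxx : ℝ),
        HasDerivAt (fun τ => d τ x) dt t ∧ (∀ᶠ y in 𝓝 x, HasDerivAt (d t) (d1 y) y) ∧
        HasDerivAt d1 dxx x ∧ dt ≤ dxx) :
    ∀ t, t0 - h ≤ t → ∀ x, (t, x) ∈ D → d t x ≤ 0 := by
  have step : ∀ n : ℕ, ∀ t ∈ Icc (t0 - h) (t0 + n * h), ∀ x, (t, x) ∈ D → d t x ≤ 0 := by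
    intro n
    induction n with
    | zero => simpa using hinit
    | succ n ih =>
      intro ts hts xs hxs
      by_contra hpos
      push Not at hpos
      set T := t0 + ((n + 1 : ℕ) : ℝ) * h with hT
      have hts0 : t0 < ts := by
        by_contra hcon
        push Not at hcon
        exact absurd (hinit ts ⟨hts.1, hcon⟩ xs hxs) (not_le.2 hpos)
      obtain ⟨M, hM⟩ := hbdd T
      set P : ℝ := xs ^ 2 + 3 * (ts - t0) + 1 with hP
      have hPpos : 0 < P := by have := sq_nonneg xs; have : 0 < ts - t0 := by linarith
                               positivity
      set ε : ℝ := d ts xs / (2 * P) with hε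
      have hεpos : 0 < ε := by positivity
      have hεP : ε * P < d ts xs := by
        rw [hε]; field_simp; linarith
      set R : ℝ := |xs| + |M| / ε + 1 with hR
      have hR1 : 1 ≤ R := by
        have := abs_nonneg xs
        have : 0 ≤ |M| / ε := by positivity
        linarith
      have hRM : M ≤ ε * R ^ 2 := by
        have h1 : |M| / ε ≤ R := by have := abs_nonneg xs; linarith
        have h2 : |M| ≤ ε * R := by
          rw [div_le_iff₀ hεpos] at h1; linarith
        have h3 : R ≤ R ^ 2 := by nlinarith
        have := le_abs_self M
        nlinarith
      have hK : IsCompact (D ∩ Icc t0 T ×ˢ Icc (-R) R) :=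
        (isCompact_Icc.prod isCompact_Icc).inter_left hD
      have hFc : ContinuousOn
          (fun q : ℝ × ℝ => d q.1 q.2 - ε * (q.2 ^ 2 + 3 * (q.1 - t0) + 1))
          (D ∩ Icc t0 T ×ˢ Icc (-R) R) := by
        refine ContinuousOn.sub (hcont.mono fun q hq => ⟨hq.1, hq.2.1.1⟩) ?_
        fun_prop
      have hsmem : (ts, xs) ∈ D ∩ Icc t0 T ×ˢ Icc (-R) R := by
        refine ⟨hxs, ⟨hts0.le, hts.2⟩, ?_⟩
        have : |xs| ≤ R := by
          have : 0 ≤ |M| / ε := by positivity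
          linarith
        exact abs_le.1 this
      obtain ⟨⟨t1, x1⟩, hq, hmax⟩ := hK.exists_isMaxOn ⟨_, hsmem⟩ hFc
      have hmax' : ∀ t x, (t, x) ∈ D → t ∈ Icc t0 T → x ∈ Icc (-R) R →
          d t x - ε * (x ^ 2 + 3 * (t - t0) + 1) ≤ d t1 x1 - ε * (x1 ^ 2 + 3 * (t1 - t0) + 1) :=
        fun t x hD ht hx => hmax (a := (t, x)) ⟨hD, ht, hx⟩
      obtain ⟨hqD, ht1, hx1⟩ := hq
      simp only at ht1 hx1
      have hFpos : 0 < d t1 x1 - ε * (x1 ^ 2 + 3 * (t1 - t0) + 1) := by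
        have := hmax' ts xs hxs ⟨hts0.le, hts.2⟩ hsmem.2.2
        linarith
      have hpen : 0 ≤ ε * (3 * (t1 - t0) + 1) := by
        have := ht1.1
        have : 0 ≤ 3 * (t1 - t0) + 1 := by linarith
        positivity
      have hd1 : 0 < d t1 x1 := by nlinarith [sq_nonneg x1]
      have ht1' : t0 < t1 := by
        rcases eq_or_lt_of_le ht1.1 with heq | hlt
        · have := hinit t1 ⟨by linarith, by linarith⟩ x1 hqD
          linarith
        · exact hlt
      have hxsq : x1 ^ 2 < R ^ 2 := by
        have := hM t1 ht1 x1 hqD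
        by_contra hcon
        push Not at hcon
        nlinarith
      have hxR : |x1| < R := abs_lt_of_sq_lt_sq hxsq (by linarith)
      rw [abs_lt] at hxR
      have hhist : ∀ y, (t1 - h, y) ∈ D → d (t1 - h) y ≤ 0 := by
        intro y hy
        refine ih (t1 - h) ⟨by linarith, ?_⟩ y hy
        have := ht1.2
        rw [hT] at this
        push_cast at this
        linarith
      obtain ⟨hDn, dt, d1, dxx, hdt, hdx, hdxx, hle⟩ := hstep t1 ht1' x1 hqD hd1 hhist
      have htime : 0 ≤ dt - ε * 3 := by
        have hder : HasDerivAt (fun τ => d τ x1 - ε * (x1 ^ 2 + 3 * (τ - t0) + 1))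
            (dt - ε * 3) t1 := by
          have h3 : HasDerivAt (fun τ : ℝ => ε * (x1 ^ 2 + 3 * (τ - t0) + 1)) (ε * 3) t1 := by
            have := ((((hasDerivAt_id t1).sub_const t0).const_mul 3).const_add (x1 ^ 2)).add_const 1
            simpa using this.const_mul ε
          exact hdt.sub h3
        refine hder.nonneg_of_eventually_left_le ?_
        have hDt : ∀ᶠ τ in 𝓝 t1, (τ, x1) ∈ D :=
          (Continuous.prodMk_left x1).continuousAt.preimage_mem_nhds hDn
        filter_upwards [hDt.filter_mono nhdsWithin_le_nhds, self_mem_nhdsWithin,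
          (lt_mem_nhds ht1').filter_mono nhdsWithin_le_nhds] with τ h1 h2 h3
        have h2' : τ < t1 := h2
        exact hmax' τ x1 h1 ⟨h3.le, h2'.le.trans ht1.2⟩ hx1
      have hspace : dxx - ε * 2 ≤ 0 := by
        have hloc : IsLocalMax (fun y => d t1 y - ε * (y ^ 2 + 3 * (t1 - t0) + 1)) x1 := by
          have hDx : ∀ᶠ y in 𝓝 x1, (t1, y) ∈ D :=
            (Continuous.prodMk_right t1).continuousAt.preimage_mem_nhds hDn
          filter_upwards [hDx, Icc_mem_nhds hxR.1 hxR.2] with y h1 h2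
          exact hmax' t1 y h1 ht1 h2
        refine hloc.second_deriv_nonpos (f1 := fun y => d1 y - ε * (2 * y)) ?_ ?_
        · filter_upwards [hdx] with y hy
          have h3 : HasDerivAt (fun y : ℝ => ε * (y ^ 2 + 3 * (t1 - t0) + 1)) (ε * (2 * y)) y := by
            have := (((hasDerivAt_pow 2 y).add_const (3 * (t1 - t0))).add_const 1).const_mul ε
            simpa using this
          exact hy.sub h3
        · have h3 : HasDerivAt (fun y : ℝ => ε * (2 * y)) (ε * 2) x1 := by
            simpa using ((hasDerivAt_id x1).const_mul 2).const_mul ε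
          exact hdxx.sub h3
      linarith
  intro t ht x hx
  obtain ⟨n, hn⟩ := exists_nat_ge ((t - t0) / h)
  refine step n t ⟨ht, ?_⟩ x hx
  rw [div_le_iff₀ hh] at hn
  linarith

/-- Comparison of a solution with a smooth barrier, from above (`σ = 1`) or from below
(`σ = -1`). -/
theorem SolvesStar.le_barrier {g : ℝ → ℝ} {h t0 σ : ℝ} {u : ℝ → ℝ → ℝ} (hu : SolvesStar g h u)
    (hh : 0 < h) (ht0 : 0 ≤ t0) {D : Set (ℝ × ℝ)} (hD : IsClosed D)
    {y yt y1 yxx : ℝ → ℝ → ℝ}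
    (hyc : Continuous fun q : ℝ × ℝ => y q.1 q.2)
    (hyt : ∀ t x, HasDerivAt (fun τ => y τ x) (yt t x) t)
    (hy1 : ∀ t x, HasDerivAt (y t) (y1 t x) x)
    (hyxx : ∀ t x, HasDerivAt (y1 t) (yxx t x) x)
    (hbdd : ∀ T : ℝ, ∃ M : ℝ, ∀ t ∈ Icc t0 T, ∀ x, (t, x) ∈ D → -(σ * y t x) ≤ M)
    (hinit : ∀ t ∈ Icc (t0 - h) t0, ∀ x, (t, x) ∈ D → σ * (u t x - y t x) ≤ 0)
    (hstep : ∀ t, t0 < t → ∀ x, (t, x) ∈ D → 0 < σ * (u t x - y t x) →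
      (∀ x', (t - h, x') ∈ D → σ * (u (t - h) x' - y (t - h) x') ≤ 0) →
      D ∈ 𝓝 (t, x) ∧ σ * (-u t x + g (u (t - h) x)) ≤ σ * (yt t x - yxx t x)) :
    ∀ t, t0 - h ≤ t → ∀ x, (t, x) ∈ D → σ * (u t x - y t x) ≤ 0 := by
  obtain ⟨huc, hub, hueq, -⟩ := hu
  refine delayed_maximum_principle hh hD ?_ ?_ hinit ?_
  · refine ContinuousOn.mul continuousOn_const (ContinuousOn.sub ?_ hyc.continuousOn)
    refine huc.mono fun q hq => ?_
    have : t0 ≤ q.1 := hq.2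
    change -h ≤ q.1
    linarith
  · intro T
    obtain ⟨M1, hM1⟩ := hbdd T
    obtain ⟨M2, hM2⟩ := hub T
    refine ⟨M1 + |σ| * M2, fun t ht x hx => ?_⟩
    have h1 := hM1 t ht x hx
    have h2 := hM2 t ⟨by linarith [ht.1], ht.2⟩ x
    have h3 : σ * u t x ≤ |σ| * M2 := by
      calc σ * u t x ≤ |σ * u t x| := le_abs_self _
        _ = |σ| * |u t x| := abs_mul _ _
        _ ≤ |σ| * M2 := by gcongr
    linarith
  · intro t ht x hx hpos hhist
    obtain ⟨hn, hle⟩ := hstep t ht x hx hpos hhist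
    refine ⟨hn, ?_⟩
    obtain ⟨h1, h2, h3, h4⟩ := hueq t (by linarith) x
    refine ⟨σ * (deriv (fun τ => u τ x) t - yt t x),
      fun x' => σ * (deriv (fun y => u t y) x' - y1 t x'),
      σ * (deriv (deriv fun y => u t y) x - yxx t x), ?_, ?_, ?_, ?_⟩
    · exact (h1.hasDerivAt.sub (hyt t x)).const_mul σ
    · refine Eventually.of_forall fun x' => ?_
      exact (((hueq t (by linarith) x').2.1).hasDerivAt.sub (hy1 t x')).const_mul σ
    · exact (h3.hasDerivAt.sub (hyxx t x)).const_mul σ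
    · rw [h4]; nlinarith

/-- Monostable monotone reaction term: the global facts used in the barrier arguments. -/
structure Monostable (g : ℝ → ℝ) (kap L s del : ℝ) : Prop where
  strictMono : StrictMono g
  cont : Continuous g
  zero : g 0 = 0
  kap_pos : 0 < kap
  fixed : g kap = kap
  self_lt : ∀ x, 0 < x → x < kap → x < g x
  lt_self : ∀ x, kap < x → g x < x
  L_pos : 0 < L
  lip : ∀ u v : ℝ, |g u - g v| ≤ L * |u - v|
  s_pos : 0 < s
  s_lt : s < 1
  del_pos : 0 < del
  near : ∀ u ∈ Icc (kap - del) (kap + del), ∀ v ∈ Icc (kap - del) (kap + del),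
    |g u - g v| ≤ (1 - s) * |u - v|

theorem HypH.map_zero {g : ℝ → ℝ} {kap del0 Lg : ℝ} (hH : HypH g kap del0 Lg) : g 0 = 0 :=
  (hH.fixed_points 0 le_rfl).2 (Or.inl rfl)

theorem HypH.map_kap {g : ℝ → ℝ} {kap del0 Lg : ℝ} (hH : HypH g kap del0 Lg) : g kap = kap :=
  (hH.fixed_points kap hH.kap_pos.le).2 (Or.inr rfl)

theorem HypH.hasDerivAt_of_mem {g : ℝ → ℝ} {kap del0 Lg : ℝ} (hH : HypH g kap del0 Lg) {x : ℝ}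
    (hx : x ∈ Ioo (-del0) del0) : HasDerivAt g (deriv g x) x :=
  ((hH.smooth0.contDiffAt (isOpen_Ioo.mem_nhds hx)).differentiableAt (by simp)).hasDerivAt

theorem HypH.hasDerivAt_zero {g : ℝ → ℝ} {kap del0 Lg : ℝ} (hH : HypH g kap del0 Lg) :
    HasDerivAt g (deriv g 0) 0 :=
  hH.hasDerivAt_of_mem ⟨by linarith [hH.del0_pos], hH.del0_pos⟩

theorem HypH.global_lipschitz {g : ℝ → ℝ} {kap del0 Lg : ℝ} (hH : HypH g kap del0 Lg) :
    ∃ L > 0, ∀ u v : ℝ, |g u - g v| ≤ L * |u - v| := by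
  have hg1 := hH.deriv0_gt
  have key : ∀ u v : ℝ, u ≤ v → |g u - g v| ≤ (|Lg| + deriv g 0) * |u - v| := by
    intro u v huv
    have hL : ∀ a b : ℝ, 0 ≤ a → 0 ≤ b → |g a - g b| ≤ |Lg| * |a - b| := fun a b ha hb =>
      (hH.lipschitz a b ha hb).trans (by gcongr; exact le_abs_self _)
    rcases le_total 0 u with hu | hu
    · refine (hL u v hu (hu.trans huv)).trans ?_
      gcongr; linarith
    · rcases le_total v 0 with hv | hv
      · rw [hH.ext_linear u hu, hH.ext_linear v hv, ← mul_sub, abs_mul,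
          abs_of_pos (by linarith : 0 < deriv g 0)]
        gcongr; linarith [abs_nonneg Lg]
      · have h1 := hL 0 v le_rfl hv
        have h2 : |g u - g 0| = deriv g 0 * (-u) := by
          rw [hH.map_zero, hH.ext_linear u hu, sub_zero, abs_mul,
            abs_of_pos (by linarith : 0 < deriv g 0), abs_of_nonpos hu]
        have h3 : |g u - g v| ≤ |g u - g 0| + |g 0 - g v| := abs_sub_le _ _ _
        rw [zero_sub, abs_neg, abs_of_nonneg hv] at h1
        rw [abs_of_nonpos (by linarith : u - v ≤ 0)]
        have h4 : 0 ≤ |Lg| * (-u) := mul_nonneg (abs_nonneg _) (by linarith)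
        have h5 : 0 ≤ deriv g 0 * v := by positivity
        nlinarith
  refine ⟨|Lg| + deriv g 0, by positivity, fun u v => ?_⟩
  rcases le_total u v with huv | huv
  · exact key u v huv
  · rw [abs_sub_comm, abs_sub_comm u v]; exact key v u huv

theorem HypH.local_contraction {g : ℝ → ℝ} {kap del0 Lg : ℝ} (hH : HypH g kap del0 Lg)
    (hmono : StrictMono g) :
    ∃ s del : ℝ, 0 < s ∧ s < 1 ∧ 0 < del ∧
      ∀ u ∈ Icc (kap - del) (kap + del), ∀ v ∈ Icc (kap - del) (kap + del),
        |g u - g v| ≤ (1 - s) * |u - v| := by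
  have hd := hH.del0_pos
  have hcd : ContDiffAt ℝ 1 g kap :=
    hH.smooth_kap.contDiffAt (isOpen_Ioo.mem_nhds ⟨by linarith, by linarith⟩)
  have hst : HasStrictDerivAt g (deriv g kap) kap := hcd.hasStrictDerivAt (by simp)
  have h0 : 0 ≤ deriv g kap := hmono.monotone.deriv_nonneg
  have h1 := hH.deriv_kap_lt
  set s := (1 - deriv g kap) / 2 with hs
  have hs0 : 0 < s := by rw [hs]; linarith
  have hst' := (hasStrictFDerivAt_iff_isLittleO.1 hst.hasStrictFDerivAt).def hs0
  rw [nhds_prod_eq] at hst'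
  obtain ⟨t, ht, htl⟩ := eventually_prod_self_iff
    (r := fun u v => ‖g u - g v - (ContinuousLinearMap.toSpanSingleton ℝ (deriv g kap)) (u - v)‖
      ≤ s * ‖u - v‖) |>.1 hst'
  obtain ⟨ε, hε, hball⟩ := Metric.nhds_basis_closedBall.mem_iff.1 ht
  rw [Real.closedBall_eq_Icc] at hball
  refine ⟨s, ε, hs0, by rw [hs]; linarith, hε, fun u hu v hv => ?_⟩
  have h2 := htl u (hball hu) v (hball hv)
  simp only [Real.norm_eq_abs, ContinuousLinearMap.toSpanSingleton_apply, smul_eq_mul] at h2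
  have h3 : |g u - g v| ≤ |g u - g v - (u - v) * deriv g kap| + |(u - v) * deriv g kap| := by
    have := abs_add_le (g u - g v - (u - v) * deriv g kap) ((u - v) * deriv g kap)
    simpa using this
  rw [abs_mul, abs_of_nonneg h0] at h3
  have : |u - v| * deriv g kap = (1 - 2 * s) * |u - v| := by rw [hs]; ring
  linarith

theorem HypH.monostable {g : ℝ → ℝ} {kap del0 Lg : ℝ} (hH : HypH g kap del0 Lg)
    (hmono : StrictMono g) : ∃ L s del : ℝ, Monostable g kap L s del := by
  obtain ⟨L, hL, hlip⟩ := hH.global_lipschitz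
  obtain ⟨s, del, hs, hs1, hdel, hnear⟩ := hH.local_contraction hmono
  refine ⟨L, s, del, hmono, hH.cont, hH.map_zero, hH.kap_pos, hH.map_kap, ?_, ?_, hL, hlip, hs,
    hs1, hdel, hnear⟩
  · intro x hx hxk
    by_contra hcon
    push Not at hcon
    have h1 : Tendsto (slope g 0) (𝓝[>] 0) (𝓝 (deriv g 0)) :=
      (hasDerivAt_iff_tendsto_slope.1 hH.hasDerivAt_zero).mono_left
        (nhdsWithin_mono _ fun y hy => ne_of_gt hy)
    have h2 := h1.eventually (lt_mem_nhds hH.deriv0_gt)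
    have h3 : ∀ᶠ y in 𝓝[>] (0:ℝ), y < x := (gt_mem_nhds hx).filter_mono nhdsWithin_le_nhds
    obtain ⟨y, ⟨hy1, hy2⟩, hy3⟩ := ((h2.and h3).and self_mem_nhdsWithin).exists
    have hy0 : 0 < y := hy3
    have hgy : y < g y := by
      rw [slope_def_field, hH.map_zero, sub_zero, sub_zero, lt_div_iff₀ hy0] at hy1
      linarith
    have hc : ContinuousOn (fun z => g z - z) (Icc y x) :=
      (hH.cont.sub continuous_id).continuousOn
    obtain ⟨z, hz, hz0⟩ := intermediate_value_Icc' hy2.le hc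
      (show (0:ℝ) ∈ Icc (g x - x) (g y - y) from ⟨by linarith, by linarith⟩)
    simp only at hz0
    rcases (hH.fixed_points z (hy0.le.trans hz.1)).1 (by linarith) with h | h
    · linarith [hz.1]
    · linarith [hz.2]
  · intro x hx
    by_contra hcon
    push Not at hcon
    set y := min x (kap + del) with hy
    have hyk : kap < y := lt_min hx (by linarith)
    have hgy : g y < y := by
      have h1 := hnear y ⟨by linarith, min_le_right _ _⟩ kap ⟨by linarith, by linarith⟩
      rw [hH.map_kap, abs_of_pos (by linarith : 0 < y - kap)] at h1
      have h2 := le_abs_self (g y - kap)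
      nlinarith
    have hc : ContinuousOn (fun z => g z - z) (Icc y x) :=
      (hH.cont.sub continuous_id).continuousOn
    obtain ⟨z, hz, hz0⟩ := intermediate_value_Icc (min_le_left _ _ : y ≤ x) hc
      (show (0:ℝ) ∈ Icc (g y - y) (g x - x) from ⟨by linarith, by linarith⟩)
    simp only at hz0
    have hk := hH.kap_pos
    rcases (hH.fixed_points z (by linarith [hz.1])).1 (by linarith) with h | h
    · linarith [hz.1]
    · linarith [hz.1]

theorem HypH.holder_remainder {g : ℝ → ℝ} {kap del0 Lg : ℝ} (hH : HypH g kap del0 Lg) :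
    ∃ θ > (0:ℝ), ∀ θ' ∈ Ioc 0 θ, ∃ C > (0:ℝ), ∀ u, 0 ≤ u →
      |g u - deriv g 0 * u| ≤ C * u ^ (1 + θ') := by
  obtain ⟨C, hC, θ, hθ, hhol⟩ := hH.holder
  obtain ⟨L, hL, hlip⟩ := hH.global_lipschitz
  have hg1 := hH.deriv0_gt
  have hd := hH.del0_pos
  refine ⟨θ, hθ.1, fun θ' hθ' => ?_⟩
  set r := min (del0 / 2) (1 / 2) with hr
  have hr0 : 0 < r := by positivity
  have hr1 : r < 1 := (min_le_right _ _).trans_lt (by norm_num)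
  have hrd : r < del0 := (min_le_left _ _).trans_lt (by linarith)
  refine ⟨C + (L + deriv g 0) / r ^ θ', by positivity, fun u hu => ?_⟩
  have hpow : u ^ (1 + θ') = u * u ^ θ' := by
    rw [Real.rpow_add_of_nonneg hu zero_le_one hθ'.1.le, Real.rpow_one]
  have hup : 0 ≤ u ^ θ' := Real.rpow_nonneg hu _
  rw [hpow]
  rcases lt_or_ge u r with hur | hur
  · have hder : ∀ x ∈ Icc 0 u, HasDerivWithinAt (fun x => g x - deriv g 0 * x)
        (deriv g x - deriv g 0) (Icc 0 u) x := by
      intro x hx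
      have h1 := hH.hasDerivAt_of_mem (x := x) ⟨by linarith [hx.1], by linarith [hx.2]⟩
      have h2 : HasDerivAt (fun x => deriv g 0 * x) (deriv g 0) x := by
        simpa using (hasDerivAt_id x).const_mul (deriv g 0)
      exact (h1.sub h2).hasDerivWithinAt
    have hbound : ∀ x ∈ Icc 0 u, ‖deriv g x - deriv g 0‖ ≤ C * u ^ θ' := by
      intro x hx
      rw [Real.norm_eq_abs]
      rcases eq_or_lt_of_le hx.1 with h0 | h0
      · rw [← h0]; simp; positivity
      · refine (hhol x ⟨h0, by linarith [hx.2]⟩).trans ?_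
        gcongr
        calc x ^ θ ≤ x ^ θ' :=
              Real.rpow_le_rpow_of_exponent_ge h0 (by linarith [hx.2]) hθ'.2
          _ ≤ u ^ θ' := Real.rpow_le_rpow h0.le hx.2 hθ'.1.le
    have := Convex.norm_image_sub_le_of_norm_hasDerivWithin_le hder hbound (convex_Icc 0 u)
      (left_mem_Icc.2 hu) (right_mem_Icc.2 hu)
    simp only [hH.map_zero, mul_zero, sub_zero, Real.norm_eq_abs, abs_of_nonneg hu] at this
    have h3 : 0 ≤ (L + deriv g 0) / r ^ θ' * (u * u ^ θ') := by positivity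
    nlinarith
  · have h1 : |g u - deriv g 0 * u| ≤ (L + deriv g 0) * u := by
      have h2 := hlip u 0
      rw [hH.map_zero, sub_zero, sub_zero, abs_of_nonneg hu] at h2
      have h3 := abs_sub (g u) (deriv g 0 * u)
      rw [abs_of_nonneg (by positivity : 0 ≤ deriv g 0 * u)] at h3
      linarith
    have h2 : r ^ θ' ≤ u ^ θ' := Real.rpow_le_rpow hr0.le hur hθ'.1.le
    have hrp : 0 < r ^ θ' := by positivity
    have h3 : (L + deriv g 0) * u ≤ (L + deriv g 0) / r ^ θ' * (u * u ^ θ') := by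
      rw [div_mul_eq_mul_div, le_div_iff₀ hrp]
      have : 0 ≤ (L + deriv g 0) * u := by positivity
      nlinarith
    have h4 : 0 ≤ C * (u * u ^ θ') := by positivity
    nlinarith

theorem chi_neg_of_mem_Ioo {g0 c h lam1 lam2 lam : ℝ} (hg0 : 0 < g0)
    (h1 : chi g0 c h lam1 = 0) (h2 : chi g0 c h lam2 = 0) (hl : lam ∈ Ioo lam1 lam2) :
    chi g0 c h lam < 0 := by
  have hl12 := hl.1.trans hl.2
  set a := (lam2 - lam) / (lam2 - lam1) with ha
  set b := (lam - lam1) / (lam2 - lam1) with hb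
  have hpos : 0 < lam2 - lam1 := by linarith
  have ha0 : 0 < a := div_pos (by linarith [hl.2]) hpos
  have hb0 : 0 < b := div_pos (by linarith [hl.1]) hpos
  have hab : a + b = 1 := by rw [ha, hb]; field_simp; ring
  have hlam : lam = a * lam1 + b * lam2 := by rw [ha, hb]; field_simp; ring
  have hexp := convexOn_exp.2 (mem_univ (-(lam1 * c * h))) (mem_univ (-(lam2 * c * h)))
    ha0.le hb0.le hab
  simp only [smul_eq_mul] at hexp
  have harg : a * -(lam1 * c * h) + b * -(lam2 * c * h) = -(lam * c * h) := by rw [hlam]; ring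
  rw [harg] at hexp
  have hsq : lam ^ 2 = a * lam1 ^ 2 + b * lam2 ^ 2 - a * b * (lam2 - lam1) ^ 2 := by
    have : b = 1 - a := by linarith
    rw [hlam, this]; ring
  have hlt : 0 < a * b * (lam2 - lam1) ^ 2 := by positivity
  unfold chi at *
  have hmul := mul_le_mul_of_nonneg_left hexp hg0.le
  have : a * (lam1 ^ 2 - c * lam1 - 1 + g0 * Real.exp (-(lam1 * c * h)))
    + b * (lam2 ^ 2 - c * lam2 - 1 + g0 * Real.exp (-(lam2 * c * h))) = 0 := by
    rw [h1, h2]; ring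
  have hcl : c * lam = a * (c * lam1) + b * (c * lam2) := by rw [hlam]; ring
  nlinarith

/-- An exponent strictly between the characteristic roots for which the remainder of `g` at `0`
is controlled. -/
theorem HypH.exists_exponent {g : ℝ → ℝ} {kap del0 Lg : ℝ} (hH : HypH g kap del0 Lg)
    {c h lam1 lam2 : ℝ} (hl1 : 0 < lam1) (hl12 : lam1 < lam2)
    (h1 : chi (deriv g 0) c h lam1 = 0) (h2 : chi (deriv g 0) c h lam2 = 0) :
    ∃ lam C : ℝ, lam1 < lam ∧ 0 < C ∧ chi (deriv g 0) c h lam < 0 ∧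
      ∀ u, 0 ≤ u → |g u - deriv g 0 * u| ≤ C * u ^ (lam / lam1) := by
  obtain ⟨θ, hθ, hrem⟩ := hH.holder_remainder
  set θ' := min θ ((lam2 - lam1) / (2 * lam1)) with hθ'
  have hpos : 0 < (lam2 - lam1) / (2 * lam1) := div_pos (by linarith) (by linarith)
  have hθ0 : 0 < θ' := lt_min hθ hpos
  obtain ⟨C, hC, hCb⟩ := hrem θ' ⟨hθ0, min_le_left _ _⟩
  refine ⟨(1 + θ') * lam1, C, by nlinarith, hC, ?_, fun u hu => ?_⟩
  · refine chi_neg_of_mem_Ioo (by linarith [hH.deriv0_gt]) h1 h2 ⟨by nlinarith, ?_⟩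
    have : θ' ≤ (lam2 - lam1) / (2 * lam1) := min_le_right _ _
    rw [le_div_iff₀ (by linarith)] at this
    linarith
  · rw [mul_div_assoc, div_self hl1.ne', mul_one]
    exact hCb u hu

/-- A wavefront profile with exponential decay rate `lam` and amplitude `A` at `-∞`, together with
its first two derivatives. -/
structure Profile (g : ℝ → ℝ) (kap c h lam A : ℝ) (φ φ1 φ2 : ℝ → ℝ) : Prop where
  c_pos : 0 < c
  h_pos : 0 < h
  lam_pos : 0 < lam
  A_pos : 0 < A
  hasDeriv : ∀ z, HasDerivAt φ (φ1 z) z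
  hasDeriv2 : ∀ z, HasDerivAt φ1 (φ2 z) z
  eqn : ∀ z, φ2 z = c * φ1 z + φ z - g (φ (z - c * h))
  pos : ∀ z, 0 < φ z
  tendsto_atBot : Tendsto φ atBot (𝓝 0)
  tendsto_atTop : Tendsto φ atTop (𝓝 kap)
  asymp : Tendsto (fun z => Real.exp (-(lam * z)) * φ z) atBot (𝓝 A)

namespace Profile

variable {g : ℝ → ℝ} {kap c h lam A L s del : ℝ} {φ φ1 φ2 : ℝ → ℝ}

theorem continuous (hφ : Profile g kap c h lam A φ φ1 φ2) : Continuous φ :=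
  continuous_iff_continuousAt.2 fun z => (hφ.hasDeriv z).continuousAt

theorem ch_pos (hφ : Profile g kap c h lam A φ φ1 φ2) : 0 < c * h := mul_pos hφ.c_pos hφ.h_pos

theorem tendsto_sub_nat_mul (hφ : Profile g kap c h lam A φ φ1 φ2) (z : ℝ) :
    Tendsto (fun n : ℕ => z - n * (c * h)) atTop atBot := by
  have h1 : Tendsto (fun n : ℕ => (n : ℝ) * (c * h)) atTop atTop :=
    tendsto_natCast_atTop_atTop.atTop_mul_const hφ.ch_pos
  have h2 := tendsto_const_nhds (x := z) (f := (atTop : Filter ℕ)) |>.add_atBot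
    (tendsto_neg_atTop_atBot.comp h1)
  exact h2.congr fun n => by simp [sub_eq_add_neg]

theorem le_kap (hφ : Profile g kap c h lam A φ φ1 φ2) (hg : Monostable g kap L s del) (z : ℝ) :
    φ z ≤ kap := by
  by_contra hcon
  push Not at hcon
  have hev : ∀ᶠ x in cocompact ℝ, φ x ≤ φ z := by
    rw [cocompact_eq_atBot_atTop]
    exact eventually_sup.2 ⟨(hφ.tendsto_atBot.eventually (gt_mem_nhds (hφ.pos z))).mono fun x hx => hx.le,
      (hφ.tendsto_atTop.eventually (gt_mem_nhds hcon)).mono fun x hx => hx.le⟩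
  obtain ⟨y, hy⟩ := hφ.continuous.exists_forall_ge' z hev
  have hmax : IsLocalMax φ y := Eventually.of_forall hy
  have h1 := hmax.hasDerivAt_eq_zero (hφ.hasDeriv y)
  have h2 := hmax.second_deriv_nonpos (Eventually.of_forall hφ.hasDeriv) (hφ.hasDeriv2 y)
  rw [hφ.eqn, h1] at h2
  have h3 := hg.strictMono.monotone (hy (y - c * h))
  have h4 := hg.lt_self (φ y) (hcon.trans_le (hy z))
  linarith

theorem lt_kap (hφ : Profile g kap c h lam A φ φ1 φ2) (hg : Monostable g kap L s del) (z : ℝ) :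
    φ z < kap := by
  refine lt_of_le_of_ne (hφ.le_kap hg z) fun heq => ?_
  have step : ∀ y, φ y = kap → φ (y - c * h) = kap := by
    intro y hy
    have hmax : IsLocalMax φ y := Eventually.of_forall fun x => by
      rw [hy]; exact hφ.le_kap hg x
    have h1 := hmax.hasDerivAt_eq_zero (hφ.hasDeriv y)
    have h2 := hmax.second_deriv_nonpos (Eventually.of_forall hφ.hasDeriv) (hφ.hasDeriv2 y)
    rw [hφ.eqn, h1, hy] at h2
    have h3 : g kap ≤ g (φ (y - c * h)) := by rw [hg.fixed]; linarith
    exact le_antisymm (hφ.le_kap hg _) (hg.strictMono.le_iff_le.1 h3)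
  have hall : ∀ n : ℕ, φ (z - n * (c * h)) = kap := by
    intro n
    induction n with
    | zero => simpa using heq
    | succ n ih =>
      have := step _ ih
      rw [← this]; congr 1; push_cast; ring
  have h1 := hφ.tendsto_atBot.comp (hφ.tendsto_sub_nat_mul z)
  have h2 : Tendsto (φ ∘ fun n : ℕ => z - n * (c * h)) atTop (𝓝 kap) := by
    refine tendsto_const_nhds.congr fun n => ?_
    exact (hall n).symm
  have := tendsto_nhds_unique h1 h2
  linarith [hg.kap_pos]

theorem eventually_near_exp (hφ : Profile g kap c h lam A φ φ1 φ2) {ε : ℝ} (hε : 0 < ε) :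
    ∃ Z, ∀ z ≤ Z, (A - ε) * Real.exp (lam * z) ≤ φ z ∧ φ z ≤ (A + ε) * Real.exp (lam * z) := by
  have h1 := hφ.asymp.eventually (Icc_mem_nhds (by linarith : A - ε < A) (by linarith : A < A + ε))
  obtain ⟨Z, hZ⟩ := eventually_atBot.1 h1
  refine ⟨Z, fun z hz => ?_⟩
  obtain ⟨h2, h3⟩ := hZ z hz
  have h4 : φ z = Real.exp (-(lam * z)) * φ z * Real.exp (lam * z) := by
    rw [mul_right_comm, ← Real.exp_add]; simp
  have h5 := Real.exp_pos (lam * z)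
  constructor
  · rw [h4]; gcongr
  · rw [h4]; gcongr

theorem exists_lower_bound (hφ : Profile g kap c h lam A φ φ1 φ2) (hk : 0 < kap) (Z : ℝ) :
    ∃ m > 0, ∀ z ≥ Z, m ≤ φ z := by
  obtain ⟨Z1, hZ1⟩ := eventually_atTop.1 (hφ.tendsto_atTop.eventually (lt_mem_nhds (half_lt_self hk)))
  obtain ⟨x, -, hx⟩ := isCompact_Icc.exists_isMinOn (s := Icc Z (max Z Z1))
    ⟨Z, left_mem_Icc.2 (le_max_left _ _)⟩ hφ.continuous.continuousOn
  refine ⟨min (φ x) (kap / 2), lt_min (hφ.pos x) (by linarith), fun z hz => ?_⟩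
  rcases le_total z (max Z Z1) with h1 | h1
  · exact (min_le_left _ _).trans (hx ⟨hz, h1⟩)
  · exact (min_le_right _ _).trans (hZ1 z ((le_max_right _ _).trans h1)).le

theorem slide_left (hφ : Profile g kap c h lam A φ φ1 φ2) (hk : 0 < kap) {τ0 : ℝ} (hτ0 : 0 < τ0) :
    ∃ r > 0, ∃ Z, ∀ τ ≥ τ0, ∀ z ≤ Z, (1 + r) * φ z ≤ φ (z + τ) := by
  have hA := hφ.A_pos
  have hl := hφ.lam_pos
  have hE : 1 < Real.exp (lam * τ0) := Real.one_lt_exp_iff.2 (by positivity)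
  set r := (Real.exp (lam * τ0) - 1) / 4 with hr
  have hr0 : 0 < r := by rw [hr]; linarith
  set ε := A * r / (2 + 5 * r) with hε
  have hε0 : 0 < ε := by positivity
  have hkey : (1 + r) * (A + ε) ≤ (A - ε) * (1 + 4 * r) := by
    have : ε * (2 + 5 * r) = A * r := by rw [hε]; field_simp
    have : 0 < A * r := by positivity
    nlinarith
  obtain ⟨Z0, hZ0⟩ := hφ.eventually_near_exp hε0
  obtain ⟨m, hm, hmb⟩ := hφ.exists_lower_bound hk Z0
  obtain ⟨Z1, hZ1⟩ := eventually_atBot.1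
    (hφ.tendsto_atBot.eventually (gt_mem_nhds (by positivity : 0 < m / (1 + r))))
  refine ⟨r, hr0, min Z0 Z1, fun τ hτ z hz => ?_⟩
  have h1 := hZ0 z (hz.trans (min_le_left _ _))
  have h2 := hZ1 z (hz.trans (min_le_right _ _))
  rw [lt_div_iff₀ (by linarith)] at h2
  rcases le_total (z + τ) Z0 with h3 | h3
  · have h4 := (hZ0 _ h3).1
    have hE2 : Real.exp (lam * τ0) * Real.exp (lam * z) ≤ Real.exp (lam * (z + τ)) := by
      rw [← Real.exp_add]; apply Real.exp_le_exp.2; nlinarith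
    have hEr : Real.exp (lam * τ0) = 1 + 4 * r := by rw [hr]; ring
    rw [hEr] at hE2
    have hAe : 0 ≤ A - ε := by
      by_contra hcon
      push Not at hcon
      nlinarith
    have h5 := mul_le_mul_of_nonneg_left hE2 hAe
    have h6 := mul_le_mul_of_nonneg_right hkey (Real.exp_pos (lam * z)).le
    have h7 := mul_le_mul_of_nonneg_left h1.2 (by linarith : 0 ≤ 1 + r)
    nlinarith
  · linarith [hmb _ h3]

theorem slide_right (hφ : Profile g kap c h lam A φ φ1 φ2) (hg : Monostable g kap L s del) :
    ∃ Z1, ∀ τ > 0, (∀ z ≤ Z1, φ z ≤ φ (z + τ)) → ∀ z, φ z ≤ φ (z + τ) := by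
  obtain ⟨Z0, hZ0⟩ := eventually_atTop.1
    (hφ.tendsto_atTop.eventually (lt_mem_nhds (by linarith [hg.del_pos] : kap - del < kap)))
  refine ⟨Z0 + c * h, fun τ hτ hle z => ?_⟩
  by_contra hcon
  push Not at hcon
  set v : ℝ → ℝ := fun z => φ (z + τ) - φ z with hv
  have hshift : Tendsto (fun z => φ (z + τ)) atTop (𝓝 kap) :=
    hφ.tendsto_atTop.comp (tendsto_atTop_add_const_right _ _ tendsto_id)
  have hshift' : Tendsto (fun z => φ (z + τ)) atBot (𝓝 0) :=
    hφ.tendsto_atBot.comp (tendsto_atBot_add_const_right _ _ tendsto_id)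
  have hvz : v z < 0 := by simp only [hv]; linarith
  have hev : ∀ᶠ x in cocompact ℝ, v z ≤ v x := by
    rw [cocompact_eq_atBot_atTop]
    have h1 := hshift'.sub hφ.tendsto_atBot
    have h2 := hshift.sub hφ.tendsto_atTop
    rw [sub_self] at h1 h2
    exact eventually_sup.2 ⟨(h1.eventually (lt_mem_nhds hvz)).mono fun x hx => hx.le,
      (h2.eventually (lt_mem_nhds hvz)).mono fun x hx => hx.le⟩
  have hcont : Continuous v := (hφ.continuous.comp (continuous_add_const τ)).sub hφ.continuous
  obtain ⟨y, hy⟩ := hcont.exists_forall_le' z hev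
  have hvy : v y < 0 := (hy z).trans_lt hvz
  have hyZ : Z0 + c * h < y := by
    by_contra hcon'
    push Not at hcon'
    have := hle y hcon'
    simp only [hv] at hvy
    linarith
  have hd1 : ∀ x, HasDerivAt (fun z => -v z) (-(φ1 (x + τ) - φ1 x)) x := fun x =>
    (((hφ.hasDeriv (x + τ)).comp_add_const x τ).sub (hφ.hasDeriv x)).neg
  have hd2 : HasDerivAt (fun x => -(φ1 (x + τ) - φ1 x)) (-(φ2 (y + τ) - φ2 y)) y :=
    (((hφ.hasDeriv2 (y + τ)).comp_add_const y τ).sub (hφ.hasDeriv2 y)).neg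
  have hmax : IsLocalMax (fun z => -v z) y :=
    Eventually.of_forall fun x => neg_le_neg (hy x)
  have h1 := hmax.hasDerivAt_eq_zero (hd1 y)
  have h2 := hmax.second_deriv_nonpos (Eventually.of_forall hd1) hd2
  rw [hφ.eqn, hφ.eqn] at h2
  set b := φ (y + τ - c * h) with hb
  set a := φ (y - c * h) with ha
  have hvd : v (y - c * h) = b - a := by
    simp only [hv, hb, ha]; congr 2; ring
  have h3 := hy (y - c * h)
  rw [hvd] at h3
  have hmem : ∀ x ≥ Z0, φ x ∈ Icc (kap - del) (kap + del) := fun x hx =>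
    ⟨(hZ0 x hx).le, by linarith [hφ.le_kap hg x, hg.del_pos]⟩
  have hgb := hg.near b (hmem _ (by linarith)) a (hmem _ (by linarith))
  have hs := hg.s_pos
  have hs1 := hg.s_lt
  have hvy' : v y = φ (y + τ) - φ y := rfl
  have h5 : c * (φ1 (y + τ) - φ1 y) = 0 := by rw [neg_eq_zero.1 h1]; ring
  rcases le_total a b with hab | hab
  · have := hg.strictMono.monotone hab
    nlinarith
  · rw [abs_of_nonpos (by linarith : b - a ≤ 0)] at hgb
    have := neg_abs_le (g b - g a)
    nlinarith

theorem monotone (hφ : Profile g kap c h lam A φ φ1 φ2) (hg : Monostable g kap L s del) :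
    Monotone φ := by
  have key : ∀ τ0 > 0, ∀ z, φ z ≤ φ (z + τ0) := by
    intro τ0 hτ0
    obtain ⟨r, hr, Z0, hZ0⟩ := hφ.slide_left hg.kap_pos hτ0
    obtain ⟨Z1, hZ1⟩ := hφ.slide_right hg
    have hlt : ∀ τ ≥ τ0, ∀ z ≤ Z0, φ z < φ (z + τ) := fun τ hτ z hz => by
      nlinarith [hZ0 τ hτ z hz, hφ.pos z]
    have hred : ∀ τ ≥ τ0, (∀ z ∈ Icc Z0 Z1, φ z ≤ φ (z + τ)) → ∀ z, φ z ≤ φ (z + τ) := by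
      intro τ hτ hK
      refine hZ1 τ (hτ0.trans_le hτ) fun z hz => ?_
      rcases le_total z Z0 with h1 | h1
      · exact (hlt τ hτ z h1).le
      · exact hK z ⟨h1, hz⟩
    set S : Set ℝ := {τ | τ0 ≤ τ ∧ ∀ z, φ z ≤ φ (z + τ)} with hS
    have hSne : S.Nonempty := by
      obtain ⟨N, hN⟩ : ∃ N, N < kap ∧ ∀ z ∈ Icc Z0 Z1, φ z ≤ N := by
        rcases (Icc Z0 Z1).eq_empty_or_nonempty with he | hne
        · exact ⟨0, hg.kap_pos, by simp [he]⟩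
        · obtain ⟨x, -, hx⟩ := isCompact_Icc.exists_isMaxOn hne hφ.continuous.continuousOn
          exact ⟨φ x, hφ.lt_kap hg x, fun z hz => hx hz⟩
      obtain ⟨Z2, hZ2⟩ := eventually_atTop.1 (hφ.tendsto_atTop.eventually (lt_mem_nhds hN.1))
      refine ⟨max τ0 (Z2 - Z0), le_max_left _ _, hred _ (le_max_left _ _) fun z hz => ?_⟩
      refine (hN.2 z hz).trans (hZ2 _ ?_).le
      have := le_max_right τ0 (Z2 - Z0)
      linarith [hz.1]
    have hScl : IsClosed S := by
      have : S = Ici τ0 ∩ ⋂ z, {τ | φ z ≤ φ (z + τ)} := by ext τ; simp [hS]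
      rw [this]
      refine isClosed_Ici.inter (isClosed_iInter fun z => ?_)
      exact isClosed_le continuous_const (hφ.continuous.comp (continuous_const_add z))
    have hSbdd : BddBelow S := ⟨τ0, fun τ hτ => hτ.1⟩
    have hmem := hScl.csInf_mem hSne hSbdd
    set τs := sInf S with hτs
    rcases eq_or_lt_of_le hmem.1 with heq | hgt
    · rw [heq]; exact hmem.2
    · exfalso
      have hpos : ∀ z, φ z < φ (z + τs) := by
        intro z
        refine lt_of_le_of_ne (hmem.2 z) fun heq => ?_
        have step : ∀ y, φ y = φ (y + τs) → φ (y - c * h) = φ (y - c * h + τs) := by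
          intro y hy
          have hd1 : ∀ x, HasDerivAt (fun z => φ z - φ (z + τs)) (φ1 x - φ1 (x + τs)) x :=
            fun x => (hφ.hasDeriv x).sub ((hφ.hasDeriv (x + τs)).comp_add_const x τs)
          have hd2 : HasDerivAt (fun x => φ1 x - φ1 (x + τs)) (φ2 y - φ2 (y + τs)) y :=
            (hφ.hasDeriv2 y).sub ((hφ.hasDeriv2 (y + τs)).comp_add_const y τs)
          have hmax : IsLocalMax (fun z => φ z - φ (z + τs)) y :=
            Eventually.of_forall fun x => by
              have := hmem.2 x
              simp only
              linarith
          have h1 := hmax.hasDerivAt_eq_zero (hd1 y)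
          have h2 := hmax.second_deriv_nonpos (Eventually.of_forall hd1) hd2
          rw [hφ.eqn, hφ.eqn] at h2
          have h5 : c * (φ1 y - φ1 (y + τs)) = 0 := by rw [h1]; ring
          have h3 : g (φ (y + τs - c * h)) ≤ g (φ (y - c * h)) := by linarith
          have h4 := hg.strictMono.le_iff_le.1 h3
          have h6 : y - c * h + τs = y + τs - c * h := by ring
          refine le_antisymm (hmem.2 _) ?_
          rw [h6]; exact h4
        have hall : ∀ n : ℕ, φ (z - n * (c * h)) = φ (z - n * (c * h) + τs) := by
          intro n
          induction n with
          | zero => simpa using heq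
          | succ n ih =>
            have := step _ ih
            have h6 : z - ((n + 1 : ℕ) : ℝ) * (c * h) = z - n * (c * h) - c * h := by
              push_cast; ring
            rw [h6]; exact this
        obtain ⟨n, hn⟩ := ((hφ.tendsto_sub_nat_mul z).eventually (eventually_le_atBot Z0)).exists
        exact absurd (hall n) (hlt τs hmem.1 _ hn).ne
      have hev : ∀ᶠ τ in 𝓝 τs, ∀ z ∈ Icc Z0 Z1, φ z < φ (z + τ) := by
        refine isCompact_Icc.eventually_forall_of_forall_eventually fun z _ => ?_
        have hc1 : Continuous fun q : ℝ × ℝ => φ q.2 := hφ.continuous.comp continuous_snd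
        have hc2 : Continuous fun q : ℝ × ℝ => φ (q.2 + q.1) :=
          hφ.continuous.comp (continuous_snd.add continuous_fst)
        exact hc1.continuousAt.eventually_lt hc2.continuousAt (hpos z)
      obtain ⟨τ, ⟨h1, h2⟩, h3⟩ := (((hev.filter_mono nhdsWithin_le_nhds).and
        ((lt_mem_nhds hgt).filter_mono nhdsWithin_le_nhds)).and
        (self_mem_nhdsWithin : Iio τs ∈ 𝓝[<] τs)).exists
      have h3' : τ < τs := h3
      have hτS : τ ∈ S := ⟨h2.le, hred τ h2.le fun z hz => (h1 z hz).le⟩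
      exact absurd (csInf_le hSbdd hτS) (not_le.2 h3')
  intro x y hxy
  rcases eq_or_lt_of_le hxy with h1 | h1
  · rw [h1]
  · have := key (y - x) (by linarith) x
    simpa using this

theorem deriv_nonneg (hφ : Profile g kap c h lam A φ φ1 φ2) (hg : Monostable g kap L s del)
    (z : ℝ) : 0 ≤ φ1 z := by
  rw [← (hφ.hasDeriv z).deriv]
  exact (hφ.monotone hg).deriv_nonneg

/-- The positive number `k` with `k² + ck = 1`. -/
theorem exists_root (c : ℝ) : ∃ k > (0 : ℝ), k ^ 2 + c * k = 1 := by
  have hlt : |c| < Real.sqrt (c ^ 2 + 4) := by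
    rw [← Real.sqrt_sq_eq_abs]
    exact Real.sqrt_lt_sqrt (sq_nonneg c) (by linarith)
  have hsq : Real.sqrt (c ^ 2 + 4) ^ 2 = c ^ 2 + 4 := Real.sq_sqrt (by positivity)
  have := le_abs_self c
  exact ⟨(Real.sqrt (c ^ 2 + 4) - c) / 2, by linarith, by nlinarith⟩

theorem second_deriv_le (hφ : Profile g kap c h lam A φ φ1 φ2) (hg : Monostable g kap L s del)
    {k : ℝ} (hk : 0 < k) (hkc : k ^ 2 + c * k = 1) (z0 : ℝ) : φ2 z0 ≤ (c + k) * φ1 z0 := by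
  set G := g (φ (z0 - c * h)) with hG
  set B : ℝ → ℝ := fun z => Real.exp (k * z) * (-k * φ1 z + φ z - G) with hB
  have hexp : ∀ z, HasDerivAt (fun z => Real.exp (k * z)) (Real.exp (k * z) * k) z := fun z => by
    simpa using ((hasDerivAt_id z).const_mul k).exp
  have hBd : ∀ z, HasDerivAt B (Real.exp (k * z) * (k * (g (φ (z - c * h)) - G))) z := by
    intro z
    have h1 := (hexp z).mul ((((hφ.hasDeriv2 z).const_mul (-k)).add (hφ.hasDeriv z)).sub_const G)
    refine HasDerivAt.congr_deriv (f := B) h1 ?_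
    simp only [Pi.add_apply]
    rw [hφ.eqn]
    have : φ1 z = (k ^ 2 + c * k) * φ1 z := by rw [hkc]; ring
    linear_combination (Real.exp (k * z)) * this
  have hanti : AntitoneOn B (Iic z0) := by
    refine antitoneOn_of_deriv_nonpos (convex_Iic z0)
      (fun z _ => (hBd z).continuousAt.continuousWithinAt)
      (fun z _ => (hBd z).differentiableAt.differentiableWithinAt) fun z hz => ?_
    rw [interior_Iic] at hz
    have hz' : z < z0 := hz
    rw [(hBd z).deriv]
    have : g (φ (z - c * h)) ≤ G := hg.strictMono.monotone (hφ.monotone hg (by linarith))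
    have h2 := Real.exp_pos (k * z)
    exact mul_nonpos_of_nonneg_of_nonpos h2.le
      (mul_nonpos_of_nonneg_of_nonpos hk.le (by linarith))
  have hB0 : B z0 ≤ 0 := by
    by_contra hcon
    push Not at hcon
    have hlim : Tendsto (fun z => Real.exp (k * z) * kap) atBot (𝓝 (0 * kap)) :=
      (Real.tendsto_exp_atBot.comp (tendsto_id.const_mul_atBot hk)).mul_const kap
    rw [zero_mul] at hlim
    obtain ⟨z, hz1, hz2⟩ := ((hlim.eventually (gt_mem_nhds hcon)).and
      (eventually_le_atBot z0)).exists
    have h1 := hanti hz2 self_mem_Iic hz2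
    have hGpos : 0 ≤ G := by
      rw [← hg.zero]; exact hg.strictMono.monotone (hφ.pos _).le
    have h2 : -k * φ1 z + φ z - G ≤ kap := by
      nlinarith [hφ.deriv_nonneg hg z, hφ.le_kap hg z]
    have h3 : B z ≤ Real.exp (k * z) * kap := by
      simp only [hB]; gcongr
    linarith
  have h1 : -k * φ1 z0 + φ z0 - G ≤ 0 := by
    by_contra hcon
    push Not at hcon
    have : 0 < B z0 := mul_pos (Real.exp_pos _) hcon
    linarith
  rw [hφ.eqn]
  linarith

theorem deriv_exp_antitone (hφ : Profile g kap c h lam A φ φ1 φ2)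
    (hg : Monostable g kap L s del) {k : ℝ} (hk : 0 < k) (hkc : k ^ 2 + c * k = 1) :
    Antitone fun z => Real.exp (-((c + k) * z)) * φ1 z := by
  have hexp : ∀ z, HasDerivAt (fun z => Real.exp (-((c + k) * z)))
      (Real.exp (-((c + k) * z)) * -(c + k)) z := fun z => by
    simpa using ((hasDerivAt_id z).const_mul (c + k)).neg.exp
  have hd : ∀ z, HasDerivAt (fun z => Real.exp (-((c + k) * z)) * φ1 z)
      (Real.exp (-((c + k) * z)) * (φ2 z - (c + k) * φ1 z)) z := fun z =>
    ((hexp z).mul (hφ.hasDeriv2 z)).congr_deriv (by ring)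
  refine antitone_of_deriv_nonpos (fun z => (hd z).differentiableAt) fun z => ?_
  rw [(hd z).deriv]
  exact mul_nonpos_of_nonneg_of_nonpos (Real.exp_pos _).le
    (by linarith [hφ.second_deriv_le hg hk hkc z])

theorem deriv_pos (hφ : Profile g kap c h lam A φ φ1 φ2) (hg : Monostable g kap L s del)
    (z : ℝ) : 0 < φ1 z := by
  obtain ⟨k, hk, hkc⟩ := exists_root c
  refine lt_of_le_of_ne (hφ.deriv_nonneg hg z) fun h0 => ?_
  have hzero : ∀ y ≥ z, φ1 y = 0 := by
    intro y hy
    have h1 := hφ.deriv_exp_antitone hg hk hkc hy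
    simp only [← h0, mul_zero] at h1
    have h2 := Real.exp_pos (-((c + k) * y))
    exact le_antisymm (by by_contra hcon; push Not at hcon; nlinarith) (hφ.deriv_nonneg hg y)
  have hconst : ∀ y ≥ z, φ y ≤ φ z := by
    intro y hy
    have hanti : AntitoneOn φ (Ici z) := by
      refine antitoneOn_of_deriv_nonpos (convex_Ici z) hφ.continuous.continuousOn
        (fun x _ => (hφ.hasDeriv x).differentiableAt.differentiableWithinAt) fun x hx => ?_
      rw [interior_Ici] at hx
      rw [(hφ.hasDeriv x).deriv, hzero x (le_of_lt hx)]
    exact hanti self_mem_Ici hy hy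
  have h1 : kap ≤ φ z := le_of_tendsto hφ.tendsto_atTop
    ((eventually_ge_atTop z).mono hconst)
  linarith [hφ.lt_kap hg z]

theorem deriv_le_mul (hφ : Profile g kap c h lam A φ φ1 φ2) (hg : Monostable g kap L s del)
    {k : ℝ} (hk : 0 < k) (hkc : k ^ 2 + c * k = 1) (z : ℝ) : φ1 z ≤ (c + k) * φ z := by
  by_contra hcon
  push Not at hcon
  set b := φ1 z - (c + k) * φ z with hb
  have hb0 : 0 < b := by rw [hb]; linarith
  have hanti : Antitone fun z => φ1 z - (c + k) * φ z := by
    have hd : ∀ z, HasDerivAt (fun z => φ1 z - (c + k) * φ z) (φ2 z - (c + k) * φ1 z) z :=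
      fun z => (hφ.hasDeriv2 z).sub ((hφ.hasDeriv z).const_mul _)
    refine antitone_of_deriv_nonpos (fun z => (hd z).differentiableAt) fun z => ?_
    rw [(hd z).deriv]
    linarith [hφ.second_deriv_le hg hk hkc z]
  have hc := hφ.c_pos
  have hmono : MonotoneOn (fun y => φ y - b * y) (Iic z) := by
    have hd : ∀ y, HasDerivAt (fun y => φ y - b * y) (φ1 y - b) y := fun y =>
      ((hφ.hasDeriv y).sub ((hasDerivAt_id' y).const_mul b)).congr_deriv (by ring)
    refine monotoneOn_of_deriv_nonneg (convex_Iic z)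
      (fun y _ => (hd y).continuousAt.continuousWithinAt)
      (fun y _ => (hd y).differentiableAt.differentiableWithinAt) fun y hy => ?_
    rw [interior_Iic] at hy
    rw [(hd y).deriv]
    have h1 := hanti (le_of_lt hy : y ≤ z)
    simp only at h1
    have : 0 < (c + k) * φ y := mul_pos (by linarith) (hφ.pos y)
    linarith
  have h1 := hmono (show z - φ z / b ∈ Iic z by
    have : 0 < φ z / b := div_pos (hφ.pos z) hb0
    change z - φ z / b ≤ z
    linarith) self_mem_Iic (by
    have : 0 < φ z / b := div_pos (hφ.pos z) hb0
    linarith)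
  simp only at h1
  have h2 : b * (z - φ z / b) = b * z - φ z := by field_simp
  have := hφ.pos (z - φ z / b)
  linarith

theorem exists_deriv_lower (hφ : Profile g kap c h lam A φ φ1 φ2)
    (hg : Monostable g kap L s del) (Z : ℝ) : ∃ b > 0, ∀ z ≤ Z, b * φ z ≤ φ1 z := by
  obtain ⟨k, hk, hkc⟩ := exists_root c
  obtain ⟨r, hr, Z0, hZ0⟩ := hφ.slide_left hg.kap_pos one_pos
  have hμ : 0 < c + k := by linarith [hφ.c_pos]
  have hkap := hg.kap_pos
  have hp := hφ.deriv_pos hg Z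
  set b1 := Real.exp (-(c + k)) * r with hb1
  set b2 := Real.exp (-((c + k) * |Z - Z0|)) * φ1 Z / kap with hb2
  have hb10 : 0 < b1 := mul_pos (Real.exp_pos _) hr
  have hb20 : 0 < b2 := div_pos (mul_pos (Real.exp_pos _) hp) hkap
  have hcmp : ∀ x y, x ≤ y → Real.exp (-((c + k) * (y - x))) * φ1 y ≤ φ1 x := by
    intro x y hxy
    have h1 := hφ.deriv_exp_antitone hg hk hkc hxy
    simp only at h1
    have h2 : Real.exp (-((c + k) * (y - x))) =
      Real.exp ((c + k) * x) * Real.exp (-((c + k) * y)) := by rw [← Real.exp_add]; ring_nf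
    have h3 : φ1 x = Real.exp ((c + k) * x) * (Real.exp (-((c + k) * x)) * φ1 x) := by
      rw [← mul_assoc, ← Real.exp_add]; simp
    rw [h2, h3, mul_assoc]
    exact mul_le_mul_of_nonneg_left h1 (Real.exp_pos _).le
  refine ⟨min b1 b2, lt_min hb10 hb20, fun z hz => ?_⟩
  have hφz := hφ.pos z
  rcases le_total z Z0 with h1 | h1
  · obtain ⟨ξ, hξ, hξe⟩ := exists_hasDerivAt_eq_slope φ φ1 (by linarith : z < z + 1)
      hφ.continuous.continuousOn fun x _ => hφ.hasDeriv x
    have h2 := hZ0 1 le_rfl z h1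
    have h3 : r * φ z ≤ φ1 ξ := by
      rw [hξe]; simp only [add_sub_cancel_left, div_one]; linarith
    have h4 := hcmp z ξ hξ.1.le
    have h5 : Real.exp (-(c + k)) ≤ Real.exp (-((c + k) * (ξ - z))) := by
      apply Real.exp_le_exp.2
      nlinarith [hξ.2]
    have h6 : b1 * φ z ≤ φ1 z := by
      calc b1 * φ z = Real.exp (-(c + k)) * (r * φ z) := by rw [hb1]; ring
        _ ≤ Real.exp (-((c + k) * (ξ - z))) * φ1 ξ := by
          apply mul_le_mul h5 h3 (by positivity) (Real.exp_pos _).le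
        _ ≤ φ1 z := h4
    exact (mul_le_mul_of_nonneg_right (min_le_left _ _) hφz.le).trans h6
  · have h4 := hcmp z Z hz
    have h5 : Real.exp (-((c + k) * |Z - Z0|)) ≤ Real.exp (-((c + k) * (Z - z))) := by
      apply Real.exp_le_exp.2
      have : Z - z ≤ |Z - Z0| := by linarith [le_abs_self (Z - Z0)]
      nlinarith
    have h6 : b2 * φ z ≤ φ1 z := by
      calc b2 * φ z ≤ b2 * kap := by gcongr; exact hφ.le_kap hg z
        _ = Real.exp (-((c + k) * |Z - Z0|)) * φ1 Z := by rw [hb2]; field_simp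
        _ ≤ Real.exp (-((c + k) * (Z - z))) * φ1 Z := by gcongr
        _ ≤ φ1 z := h4
    exact (mul_le_mul_of_nonneg_right (min_le_right _ _) hφz.le).trans h6

theorem exists_le_exp (hφ : Profile g kap c h lam A φ φ1 φ2) (hg : Monostable g kap L s del) :
    ∃ C > 0, ∀ z, φ z ≤ C * Real.exp (lam * z) := by
  obtain ⟨Z, hZ⟩ := hφ.eventually_near_exp one_pos
  have hA := hφ.A_pos
  have hk := hg.kap_pos
  refine ⟨max (A + 1) (kap * Real.exp (-(lam * Z))), lt_max_of_lt_left (by linarith), fun z => ?_⟩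
  have he := Real.exp_pos (lam * z)
  rcases le_total z Z with h1 | h1
  · exact (hZ z h1).2.trans (mul_le_mul_of_nonneg_right (le_max_left _ _) he.le)
  · refine le_trans ?_ (mul_le_mul_of_nonneg_right (le_max_right _ _) he.le)
    rw [mul_assoc, ← Real.exp_add]
    have : 1 ≤ Real.exp (-(lam * Z) + lam * z) := by
      apply Real.one_le_exp
      nlinarith [hφ.lam_pos]
    nlinarith [hφ.le_kap hg z]

theorem exists_ge_exp (hφ : Profile g kap c h lam A φ φ1 φ2) (hg : Monostable g kap L s del)
    (Y : ℝ) : ∃ b > 0, ∀ z ≤ Y, b * Real.exp (lam * z) ≤ φ z := by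
  have hA := hφ.A_pos
  obtain ⟨Z, hZ⟩ := hφ.eventually_near_exp (half_pos hA)
  have hp := hφ.pos Z
  refine ⟨min (A - A / 2) (φ Z * Real.exp (-(lam * Y))),
    lt_min (by linarith) (mul_pos hp (Real.exp_pos _)), fun z hzY => ?_⟩
  have he := Real.exp_pos (lam * z)
  rcases le_total z Z with h1 | h1
  · exact (mul_le_mul_of_nonneg_right (min_le_left _ _) he.le).trans (hZ z h1).1
  · refine (mul_le_mul_of_nonneg_right (min_le_right _ _) he.le).trans ?_
    rw [mul_assoc, ← Real.exp_add]
    have : Real.exp (-(lam * Y) + lam * z) ≤ 1 := by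
      apply Real.exp_le_one_iff.2
      nlinarith [hφ.lam_pos]
    have := hφ.monotone hg h1
    nlinarith

/-- Global Lipschitz bound for the profile. -/
theorem exists_lipschitz (hφ : Profile g kap c h lam A φ φ1 φ2) (hg : Monostable g kap L s del) :
    ∃ M > 0, (∀ z, φ1 z ≤ M) ∧ ∀ x y, x ≤ y → φ y - φ x ≤ M * (y - x) := by
  obtain ⟨k, hk, hkc⟩ := exists_root c
  have hc := hφ.c_pos
  have hkap := hg.kap_pos
  have hle : ∀ z, φ1 z ≤ (c + k) * kap := fun z => (hφ.deriv_le_mul hg hk hkc z).trans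
    (mul_le_mul_of_nonneg_left (hφ.le_kap hg z) (by linarith))
  refine ⟨(c + k) * kap, by positivity, hle, fun x y hxy => ?_⟩
  have hmono : Monotone fun z => (c + k) * kap * z - φ z := by
    have hd : ∀ z, HasDerivAt (fun z => (c + k) * kap * z - φ z) ((c + k) * kap - φ1 z) z :=
      fun z => (((hasDerivAt_id' z).const_mul ((c + k) * kap)).sub (hφ.hasDeriv z)).congr_deriv
        (by ring)
    refine monotone_of_deriv_nonneg (fun z => (hd z).differentiableAt) fun z => ?_
    rw [(hd z).deriv]
    linarith [hle z]
  have := hmono hxy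
  simp only at this
  linarith

end Profile

/-- The function `u` seen in a frame moving with speed `c`. -/
def frame (c : ℝ) (u : ℝ → ℝ → ℝ) (t z : ℝ) : ℝ := u t (z - c * t)

theorem frame_add (c : ℝ) (u : ℝ → ℝ → ℝ) (t x : ℝ) : frame c u t (x + c * t) = u t x := by
  simp [frame]

/-- Comparison with a barrier in the moving frame. -/
theorem SolvesStar.frame_le_barrier {g : ℝ → ℝ} {h t0 σ c : ℝ} {u : ℝ → ℝ → ℝ}
    (hu : SolvesStar g h u) (hh : 0 < h) (ht0 : 0 ≤ t0) {E : Set ℝ} (hE : IsClosed E)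
    {Y Yt Y1 Y2 : ℝ → ℝ → ℝ}
    (hYc : Continuous fun q : ℝ × ℝ => Y q.1 q.2)
    (hYt : ∀ t x, HasDerivAt (fun τ => Y τ (x + c * τ)) (Yt t (x + c * t) + c * Y1 t (x + c * t)) t)
    (hY1 : ∀ t z, HasDerivAt (Y t) (Y1 t z) z)
    (hY2 : ∀ t z, HasDerivAt (Y1 t) (Y2 t z) z)
    (hbdd : ∀ T : ℝ, ∃ M : ℝ, ∀ t ∈ Icc t0 T, ∀ z ∈ E, -(σ * Y t z) ≤ M)
    (hinit : ∀ t ∈ Icc (t0 - h) t0, ∀ z ∈ E, σ * (frame c u t z - Y t z) ≤ 0)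
    (hstep : ∀ t, t0 < t → ∀ z ∈ E, 0 < σ * (frame c u t z - Y t z) →
      (z - c * h ∈ E → σ * (frame c u (t - h) (z - c * h) - Y (t - h) (z - c * h)) ≤ 0) →
      E ∈ 𝓝 z ∧ σ * (-frame c u t z + g (frame c u (t - h) (z - c * h))) ≤
        σ * (Yt t z + c * Y1 t z - Y2 t z)) :
    ∀ t, t0 - h ≤ t → ∀ z ∈ E, σ * (frame c u t z - Y t z) ≤ 0 := by
  have hlin : Continuous fun q : ℝ × ℝ => q.2 + c * q.1 := by fun_prop
  have hdelay : ∀ t x : ℝ, x + c * (t - h) = x + c * t - c * h := fun t x => by ring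
  have key := hu.le_barrier (σ := σ) hh ht0 (D := {q : ℝ × ℝ | q.2 + c * q.1 ∈ E})
    (y := fun t x => Y t (x + c * t)) (yt := fun t x => Yt t (x + c * t) + c * Y1 t (x + c * t))
    (y1 := fun t x => Y1 t (x + c * t)) (yxx := fun t x => Y2 t (x + c * t))
    (hE.preimage hlin) (hYc.comp (continuous_fst.prodMk hlin)) hYt
    (fun t x => (hY1 t _).comp_add_const x (c * t)) (fun t x => (hY2 t _).comp_add_const x (c * t))
    ?_ ?_ ?_
  · intro t ht z hz
    have := key t ht (z - c * t) (by simpa using hz)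
    simpa [frame] using this
  · intro T
    obtain ⟨M, hM⟩ := hbdd T
    exact ⟨M, fun t ht x hx => hM t ht _ hx⟩
  · intro t ht x hx
    have := hinit t ht _ hx
    rwa [frame_add] at this
  · intro t ht x hx hpos hhist
    have h1 := hstep t ht (x + c * t) hx (by rwa [frame_add]) (by
      intro hx'
      rw [← hdelay] at hx' ⊢
      have := hhist x hx'
      rwa [frame_add])
    rw [← hdelay, frame_add, frame_add] at h1
    exact ⟨hlin.continuousAt.preimage_mem_nhds h1.1, h1.2.trans_eq (by ring)⟩

/-- Barriers which are the sum of a function of time and a function of the moving variable. -/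
theorem SolvesStar.frame_le_add_barrier {g : ℝ → ℝ} {h t0 σ c : ℝ} {u : ℝ → ℝ → ℝ}
    (hu : SolvesStar g h u) (hh : 0 < h) (ht0 : 0 ≤ t0) {E : Set ℝ} (hE : IsClosed E)
    {f f' F F1 F2 : ℝ → ℝ}
    (hf : ∀ t, HasDerivAt f (f' t) t) (hF : ∀ z, HasDerivAt F (F1 z) z)
    (hF1 : ∀ z, HasDerivAt F1 (F2 z) z)
    (hbdd : ∃ M : ℝ, ∀ z ∈ E, -(σ * F z) ≤ M)
    (hinit : ∀ t ∈ Icc (t0 - h) t0, ∀ z ∈ E, σ * (frame c u t z - (f t + F z)) ≤ 0)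
    (hstep : ∀ t, t0 < t → ∀ z ∈ E, 0 < σ * (frame c u t z - (f t + F z)) →
      (z - c * h ∈ E →
        σ * (frame c u (t - h) (z - c * h) - (f (t - h) + F (z - c * h))) ≤ 0) →
      E ∈ 𝓝 z ∧ σ * (-frame c u t z + g (frame c u (t - h) (z - c * h))) ≤
        σ * (f' t + c * F1 z - F2 z)) :
    ∀ t, t0 - h ≤ t → ∀ z ∈ E, σ * (frame c u t z - (f t + F z)) ≤ 0 := by
  have hfc : Continuous f := continuous_iff_continuousAt.2 fun z => (hf z).continuousAt
  have hFc : Continuous F := continuous_iff_continuousAt.2 fun z => (hF z).continuousAt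
  refine hu.frame_le_barrier (Y := fun t z => f t + F z) (Yt := fun t _ => f' t)
    (Y1 := fun _ z => F1 z) (Y2 := fun _ z => F2 z) hh ht0 hE
    ((hfc.comp continuous_fst).add (hFc.comp continuous_snd)) ?_
    (fun t z => (hF z).const_add (f t)) (fun _ z => hF1 z) ?_ hinit hstep
  · intro t x
    have h1 : HasDerivAt (fun τ : ℝ => x + c * τ) c t :=
      (((hasDerivAt_id' t).const_mul c).const_add x).congr_deriv (by ring)
    exact ((hf t).add ((hF (x + c * t)).comp t h1)).congr_deriv (by ring)
  · intro T
    obtain ⟨M, hM⟩ := hbdd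
    obtain ⟨N, hN⟩ := (isCompact_Icc (a := t0) (b := T)).bddBelow_image
      (f := fun t => σ * f t) (by fun_prop)
    refine ⟨M - N, fun t ht z hz => ?_⟩
    have h1 := hM z hz
    have h2 := hN (mem_image_of_mem _ ht)
    linarith

/-- Time-independent barriers. -/
theorem SolvesStar.frame_le_static_barrier {g : ℝ → ℝ} {h t0 σ c : ℝ} {u : ℝ → ℝ → ℝ}
    (hu : SolvesStar g h u) (hh : 0 < h) (ht0 : 0 ≤ t0) {E : Set ℝ} (hE : IsClosed E)
    {F F1 F2 : ℝ → ℝ} (hF : ∀ z, HasDerivAt F (F1 z) z) (hF1 : ∀ z, HasDerivAt F1 (F2 z) z)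
    (hbdd : ∃ M : ℝ, ∀ z ∈ E, -(σ * F z) ≤ M)
    (hinit : ∀ t ∈ Icc (t0 - h) t0, ∀ z ∈ E, σ * (frame c u t z - F z) ≤ 0)
    (hstep : ∀ t, t0 < t → ∀ z ∈ E, 0 < σ * (frame c u t z - F z) →
      (z - c * h ∈ E → σ * (frame c u (t - h) (z - c * h) - F (z - c * h)) ≤ 0) →
      E ∈ 𝓝 z ∧ σ * (-frame c u t z + g (frame c u (t - h) (z - c * h))) ≤
        σ * (c * F1 z - F2 z)) :
    ∀ t, t0 - h ≤ t → ∀ z ∈ E, σ * (frame c u t z - F z) ≤ 0 := by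
  have := hu.frame_le_add_barrier (σ := σ) (f := fun _ => 0) (f' := fun _ => 0) hh ht0 hE
    (fun t => hasDerivAt_const t 0) hF hF1 hbdd (by simpa using hinit) (by simpa using hstep)
  simpa using this

/-- Constant barriers. -/
theorem SolvesStar.frame_le_const {g : ℝ → ℝ} {h t0 σ c p : ℝ} {u : ℝ → ℝ → ℝ}
    (hu : SolvesStar g h u) (hh : 0 < h) (ht0 : 0 ≤ t0) {E : Set ℝ} (hE : IsClosed E)
    (hinit : ∀ t ∈ Icc (t0 - h) t0, ∀ z ∈ E, σ * (frame c u t z - p) ≤ 0)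
    (hstep : ∀ t, t0 < t → ∀ z ∈ E, 0 < σ * (frame c u t z - p) →
      (z - c * h ∈ E → σ * (frame c u (t - h) (z - c * h) - p) ≤ 0) →
      E ∈ 𝓝 z ∧ σ * (-frame c u t z + g (frame c u (t - h) (z - c * h))) ≤ 0) :
    ∀ t, t0 - h ≤ t → ∀ z ∈ E, σ * (frame c u t z - p) ≤ 0 :=
  hu.frame_le_static_barrier hh ht0 hE (F := fun _ => p) (F1 := fun _ => 0) (F2 := fun _ => 0)
    (fun z => hasDerivAt_const z p) (fun z => hasDerivAt_const z 0) ⟨_, fun _ _ => le_rfl⟩ hinit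
    (by simpa using hstep)

theorem hasDerivAt_const_mul_exp (a b z : ℝ) :
    HasDerivAt (fun z => a * Real.exp (b * z)) (a * b * Real.exp (b * z)) z :=
  (((hasDerivAt_id' z).const_mul b).exp.const_mul a).congr_deriv (by ring)

/-- A solution whose initial datum is bounded, nonnegative, positive at `+∞` and asymptotic to an
exponential at `-∞`. -/
structure FrontLike (g : ℝ → ℝ) (h c lam A : ℝ) (u : ℝ → ℝ → ℝ) : Prop where
  solves : SolvesStar g h u
  c_pos : 0 < c
  h_pos : 0 < h
  lam_pos : 0 < lam
  A_pos : 0 < A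
  init_nonneg : ∀ t ∈ Icc (-h) 0, ∀ z, 0 ≤ frame c u t z
  init_bdd : ∃ M, ∀ t ∈ Icc (-h) 0, ∀ z, frame c u t z ≤ M
  init_pos : ∃ m > 0, ∃ Z, ∀ t ∈ Icc (-h) 0, ∀ z ≥ Z, m ≤ frame c u t z
  init_asymp : ∀ ε > 0, ∃ Z, ∀ t ∈ Icc (-h) 0, ∀ z ≤ Z,
    (A - ε) * Real.exp (lam * z) ≤ frame c u t z ∧ frame c u t z ≤ (A + ε) * Real.exp (lam * z)

/-- The behaviour of `g` near `0`, relative to the exponents `lam < lam'`. -/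
structure Linearization (g : ℝ → ℝ) (g0 c h lam lam' C : ℝ) : Prop where
  g0_pos : 0 < g0
  lt : lam < lam'
  C_pos : 0 < C
  chi_eq : chi g0 c h lam = 0
  chi_neg : chi g0 c h lam' < 0
  rem : ∀ u, 0 ≤ u → |g u - g0 * u| ≤ C * u ^ (lam' / lam)
  ext : ∀ u, u ≤ 0 → g u = g0 * u

theorem eventually_small {F : ℝ → ℝ} {b : ℝ} (hF : Continuous F) (h0 : F 0 < b) :
    ∀ᶠ x in 𝓝[>] (0 : ℝ), F x < b :=
  (hF.continuousAt.eventually (gt_mem_nhds h0)).filter_mono nhdsWithin_le_nhds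

theorem Monostable.exists_gap_above {g : ℝ → ℝ} {kap L s del : ℝ} (hg : Monostable g kap L s del)
    {p q : ℝ} (hp : kap < p) : ∃ m > 0, ∀ y ∈ Icc p q, g y + m ≤ y := by
  rcases (Icc p q).eq_empty_or_nonempty with he | hne
  · exact ⟨1, one_pos, by simp [he]⟩
  · obtain ⟨x, hx, hmin⟩ := isCompact_Icc.exists_isMinOn hne
      (continuous_id.sub hg.cont).continuousOn
    refine ⟨x - g x, by linarith [hg.lt_self x (hp.trans_le hx.1)], fun y hy => ?_⟩
    have : x - g x ≤ y - g y := hmin hy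
    linarith

theorem Monostable.exists_gap_below {g : ℝ → ℝ} {kap L s del : ℝ} (hg : Monostable g kap L s del)
    {p q : ℝ} (hp : 0 < p) (hq : q < kap) : ∃ m > 0, ∀ y ∈ Icc p q, y + m ≤ g y := by
  rcases (Icc p q).eq_empty_or_nonempty with he | hne
  · exact ⟨1, one_pos, by simp [he]⟩
  · obtain ⟨x, hx, hmin⟩ := isCompact_Icc.exists_isMinOn hne
      (hg.cont.sub continuous_id).continuousOn
    refine ⟨g x - x, by linarith [hg.self_lt x (hp.trans_le hx.1) (hx.2.trans_lt hq)],
      fun y hy => ?_⟩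
    have : g x - x ≤ g y - y := hmin hy
    linarith

theorem Monostable.self_le {g : ℝ → ℝ} {kap L s del : ℝ} (hg : Monostable g kap L s del)
    {y : ℝ} (h0 : 0 ≤ y) (hk : y ≤ kap) : y ≤ g y := by
  rcases eq_or_lt_of_le h0 with h1 | h1
  · rw [← h1, hg.zero]
  · rcases eq_or_lt_of_le hk with h2 | h2
    · rw [h2, hg.fixed]
    · exact (hg.self_lt y h1 h2).le

theorem Monostable.le_self {g : ℝ → ℝ} {kap L s del : ℝ} (hg : Monostable g kap L s del)
    {y : ℝ} (hk : kap ≤ y) : g y ≤ y := by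
  rcases eq_or_lt_of_le hk with h2 | h2
  · rw [← h2, hg.fixed]
  · exact (hg.lt_self y h2).le

namespace FrontLike

variable {g : ℝ → ℝ} {kap c h lam A L s del g0 lam' C : ℝ} {u : ℝ → ℝ → ℝ}

theorem nonneg (hu : FrontLike g h c lam A u) (hg : Monostable g kap L s del) {t : ℝ}
    (ht : -h ≤ t) (z : ℝ) : 0 ≤ frame c u t z := by
  have := hu.solves.frame_le_const (σ := -1) (c := c) (p := 0) hu.h_pos le_rfl isClosed_univ
    (fun t ht z _ => by
      have := hu.init_nonneg t ⟨by linarith [ht.1], ht.2⟩ z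
      linarith)
    (fun t _ z _ hpos hd => by
      have h1 := hd (mem_univ _)
      have h2 : g 0 ≤ g (frame c u (t - h) (z - c * h)) := hg.strictMono.monotone (by linarith)
      rw [hg.zero] at h2
      exact ⟨univ_mem, by linarith⟩) t (by linarith) z (mem_univ _)
  linarith

theorem exists_bound (hu : FrontLike g h c lam A u) (hg : Monostable g kap L s del) :
    ∃ N > kap, ∀ t, -h ≤ t → ∀ z, frame c u t z ≤ N := by
  obtain ⟨M, hM⟩ := hu.init_bdd
  refine ⟨max M (kap + 1), lt_max_of_lt_right (by linarith), fun t ht z => ?_⟩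
  have := hu.solves.frame_le_const (σ := 1) (c := c) (p := max M (kap + 1)) hu.h_pos le_rfl
    isClosed_univ
    (fun t ht z _ => by
      have := hM t ⟨by linarith [ht.1], ht.2⟩ z
      linarith [le_max_left M (kap + 1)])
    (fun t _ z _ hpos hd => by
      have h1 := hd (mem_univ _)
      have h2 : g (frame c u (t - h) (z - c * h)) ≤ g (max M (kap + 1)) :=
        hg.strictMono.monotone (by linarith)
      have h3 := hg.le_self (y := max M (kap + 1)) (by linarith [le_max_right M (kap + 1)])
      exact ⟨univ_mem, by linarith⟩) t (by linarith) z (mem_univ _)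
  linarith

theorem eventually_le_kap_add (hu : FrontLike g h c lam A u) (hg : Monostable g kap L s del)
    {q : ℝ} (hq : 0 < q) : ∃ T ≥ 0, ∀ t ≥ T, ∀ z, frame c u t z ≤ kap + q := by
  obtain ⟨N, hNk, hN⟩ := hu.exists_bound hg
  obtain ⟨m, hm, hgap⟩ := hg.exists_gap_above (p := kap + q / 2) (q := N + q / 2) (by linarith)
  have hev := eventually_small (F := fun γ => L * (N - kap) * (Real.exp (γ * h) - 1)
    + γ * (N - kap)) (b := m) (by fun_prop) (by simpa using hm)
  obtain ⟨γ, hγ, hγ0⟩ := (hev.and self_mem_nhdsWithin).exists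
  have hγ0 : 0 < γ := hγ0
  have hh := hu.h_pos
  have hLp := hg.L_pos
  have key := hu.solves.frame_le_add_barrier (σ := 1) (c := c) hh le_rfl isClosed_univ
    (f := fun t => (N - kap) * Real.exp (-γ * t))
    (f' := fun t => (N - kap) * (-γ) * Real.exp (-γ * t)) (F := fun _ => kap + q / 2)
    (F1 := fun _ => 0) (F2 := fun _ => 0) (fun t => hasDerivAt_const_mul_exp _ _ t)
    (fun z => hasDerivAt_const z _) (fun z => hasDerivAt_const z _) ⟨_, fun _ _ => le_rfl⟩
    (fun t ht z _ => by
      have h1 := hN t (by linarith [ht.1]) z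
      have h2 : 1 ≤ Real.exp (-γ * t) := Real.one_le_exp (by nlinarith [ht.2])
      nlinarith)
    (fun t ht z _ hpos hd => by
      have h1 := hd (mem_univ _)
      refine ⟨univ_mem, ?_⟩
      set e := Real.exp (-γ * t) with he
      have he0 : 0 < e := Real.exp_pos _
      have he1 : e ≤ 1 := Real.exp_le_one_iff.2 (by nlinarith)
      have hed : Real.exp (-γ * (t - h)) = e * Real.exp (γ * h) := by
        rw [he, ← Real.exp_add]; ring_nf
      have hx1 : 1 ≤ Real.exp (γ * h) := Real.one_le_exp (by positivity)
      rw [hed] at h1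
      set Y := (N - kap) * e + (kap + q / 2) with hY
      set Yd := (N - kap) * (e * Real.exp (γ * h)) + (kap + q / 2) with hYd
      have h2 : g (frame c u (t - h) (z - c * h)) ≤ g Yd := hg.strictMono.monotone (by linarith)
      have hdiff : Yd - Y = (N - kap) * e * (Real.exp (γ * h) - 1) := by rw [hYd, hY]; ring
      have hdiff0 : 0 ≤ Yd - Y := by
        rw [hdiff]
        exact mul_nonneg (mul_nonneg (by linarith) he0.le) (by linarith)
      have hdiff1 : Yd - Y ≤ (N - kap) * (Real.exp (γ * h) - 1) := by
        rw [hdiff]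
        exact mul_le_mul_of_nonneg_right (by nlinarith) (by linarith)
      have h3 := (le_abs_self _).trans (hg.lip Yd Y)
      rw [abs_of_nonneg hdiff0] at h3
      have h4 := hgap Y ⟨by rw [hY]; nlinarith, by rw [hY]; nlinarith⟩
      have h5 : γ * (N - kap) * e ≤ γ * (N - kap) := by
        have : 0 ≤ γ * (N - kap) := mul_nonneg hγ0.le (by linarith)
        nlinarith
      nlinarith)
  have hlim : Tendsto (fun t => (N - kap) * Real.exp (-γ * t)) atTop (𝓝 ((N - kap) * 0)) :=
    (Real.tendsto_exp_atBot.comp (tendsto_id.const_mul_atTop_of_neg (by linarith))).const_mul _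
  rw [mul_zero] at hlim
  obtain ⟨T, hT⟩ := eventually_atTop.1 (hlim.eventually (gt_mem_nhds (half_pos hq)))
  refine ⟨max T 0, le_max_right _ _, fun t ht z => ?_⟩
  have h1 := hT t ((le_max_left _ _).trans ht)
  have h2 := key t (by linarith [(le_max_right T 0).trans ht]) z (mem_univ _)
  linarith

theorem le_growing_exp (hu : FrontLike g h c lam A u) (hg : Monostable g kap L s del) :
    ∃ C > 0, ∃ B > 0, ∀ t, -h ≤ t → ∀ z,
      frame c u t z ≤ C * Real.exp (B * t) * Real.exp (lam * z) := by
  obtain ⟨M, hM⟩ := hu.init_bdd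
  obtain ⟨Z, hZ⟩ := hu.init_asymp 1 one_pos
  have hA := hu.A_pos
  have hlam := hu.lam_pos
  have hc := hu.c_pos
  have hh := hu.h_pos
  have hLp := hg.L_pos
  set B := lam ^ 2 + L with hB
  have hB0 : 0 < B := by positivity
  set C0 := (A + 1) + |M| * Real.exp (-(lam * Z)) with hC0
  have hC0p : 0 < C0 := by positivity
  have hinit : ∀ t ∈ Icc (-h) 0, ∀ z, frame c u t z ≤ C0 * Real.exp (lam * z) := by
    intro t ht z
    have he := Real.exp_pos (lam * z)
    rcases le_total z Z with h1 | h1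
    · refine ((hZ t ht z h1).2).trans ?_
      apply mul_le_mul_of_nonneg_right _ he.le
      rw [hC0]; linarith [mul_nonneg (abs_nonneg M) (Real.exp_pos (-(lam * Z))).le]
    · have h2 : 1 ≤ Real.exp (-(lam * Z)) * Real.exp (lam * z) := by
        rw [← Real.exp_add]; apply Real.one_le_exp; nlinarith
      have h3 : |M| ≤ |M| * (Real.exp (-(lam * Z)) * Real.exp (lam * z)) :=
        le_mul_of_one_le_right (abs_nonneg M) h2
      have h4 : 0 ≤ (A + 1) * Real.exp (lam * z) := by positivity
      rw [hC0]
      linarith [hM t ht z, le_abs_self M]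
  set C := C0 * Real.exp (B * h) with hC
  have hCp : 0 < C := by positivity
  have hexpand : ∀ t z : ℝ, C * Real.exp (B * t) * Real.exp (lam * z)
      = C * Real.exp (B * t + lam * z) := fun t z => by rw [mul_assoc, ← Real.exp_add]
  have key := hu.solves.frame_le_barrier (σ := 1) (c := c) hh le_rfl isClosed_univ
    (Y := fun t z => C * Real.exp (B * t) * Real.exp (lam * z))
    (Yt := fun t z => B * (C * Real.exp (B * t) * Real.exp (lam * z)))
    (Y1 := fun t z => C * Real.exp (B * t) * lam * Real.exp (lam * z))
    (Y2 := fun t z => C * Real.exp (B * t) * lam * lam * Real.exp (lam * z))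
    (by fun_prop)
    (fun t x => by
      have h1 : HasDerivAt (fun τ : ℝ => B * τ + lam * (x + c * τ)) (B + lam * c) t :=
        (((hasDerivAt_id' t).const_mul B).add
          ((((hasDerivAt_id' t).const_mul c).const_add x).const_mul lam)).congr_deriv (by ring)
      have h2 := h1.exp.const_mul C
      simp only [hexpand]
      refine h2.congr_deriv ?_
      rw [Real.exp_add]; ring)
    (fun t z => hasDerivAt_const_mul_exp _ _ z) (fun t z => hasDerivAt_const_mul_exp _ _ z)
    (fun T => ⟨0, fun t ht z _ => by
      have : 0 < C * Real.exp (B * t) * Real.exp (lam * z) := by positivity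
      linarith⟩)
    (fun t ht z _ => by
      have h1 := hinit t ⟨by linarith [ht.1], ht.2⟩ z
      have h2 : C0 ≤ C * Real.exp (B * t) := by
        rw [hC, mul_assoc, ← Real.exp_add]
        have : 1 ≤ Real.exp (B * h + B * t) := Real.one_le_exp (by nlinarith [ht.1])
        nlinarith
      have := mul_le_mul_of_nonneg_right h2 (Real.exp_pos (lam * z)).le
      linarith)
    (fun t ht z _ hpos hd => by
      have h1 := hd (mem_univ _)
      refine ⟨univ_mem, ?_⟩
      set Y := C * Real.exp (B * t) * Real.exp (lam * z) with hY
      have hY0 : 0 < Y := by positivity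
      have h2 : C * Real.exp (B * (t - h)) * Real.exp (lam * (z - c * h)) ≤ Y := by
        rw [hexpand, hY, hexpand]
        have h9 := mul_pos hB0 hh
        have h10 := mul_pos hlam (mul_pos hc hh)
        exact mul_le_mul_of_nonneg_left (Real.exp_le_exp.2 (by linarith)) hCp.le
      have h3 := hu.nonneg hg (t := t - h) (by linarith) (z - c * h)
      have h4 := (le_abs_self _).trans (hg.lip (frame c u (t - h) (z - c * h)) 0)
      rw [hg.zero, sub_zero, sub_zero, abs_of_nonneg h3] at h4
      have h5 : L * frame c u (t - h) (z - c * h) ≤ L * Y := by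
        gcongr; linarith
      have h6 : c * (C * Real.exp (B * t) * lam * Real.exp (lam * z)) = c * lam * Y := by
        rw [hY]; ring
      have h7 : C * Real.exp (B * t) * lam * lam * Real.exp (lam * z) = lam ^ 2 * Y := by
        rw [hY]; ring
      rw [h6, h7]
      have h8 : 0 < c * lam * Y := by positivity
      have h9 : B * Y = lam ^ 2 * Y + L * Y := by rw [hB]; ring
      linarith)
  refine ⟨C, hCp, B, hB0, fun t ht z => ?_⟩
  have := key t (by linarith) z (mem_univ _)
  linarith

end FrontLike

theorem hasDerivAt_two_exp (a l b l' z : ℝ) :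
    HasDerivAt (fun z => a * Real.exp (l * z) + b * Real.exp (l' * z))
      (a * l * Real.exp (l * z) + b * l' * Real.exp (l' * z)) z :=
  (hasDerivAt_const_mul_exp a l z).add (hasDerivAt_const_mul_exp b l' z)

/-- The linearized operator applied to a combination of two exponentials. -/
theorem Linearization.two_exp {g : ℝ → ℝ} {g0 c h lam lam' C : ℝ}
    (hl : Linearization g g0 c h lam lam' C) (a b z : ℝ) :
    c * (a * lam * Real.exp (lam * z) + b * lam' * Real.exp (lam' * z))
      - (a * lam * lam * Real.exp (lam * z) + b * lam' * lam' * Real.exp (lam' * z))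
    = -(a * Real.exp (lam * z) + b * Real.exp (lam' * z))
      + g0 * (a * Real.exp (lam * (z - c * h)) + b * Real.exp (lam' * (z - c * h)))
      - chi g0 c h lam' * b * Real.exp (lam' * z) := by
  have h1 := hl.chi_eq
  have e1 : Real.exp (lam * (z - c * h)) = Real.exp (-(lam * c * h)) * Real.exp (lam * z) := by
    rw [← Real.exp_add]; ring_nf
  have e2 : Real.exp (lam' * (z - c * h)) = Real.exp (-(lam' * c * h)) * Real.exp (lam' * z) := by
    rw [← Real.exp_add]; ring_nf
  rw [e1, e2]
  unfold chi at *
  linear_combination (-a * Real.exp (lam * z)) * h1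

theorem Linearization.rpow_le {g : ℝ → ℝ} {g0 c h lam lam' C : ℝ}
    (hl : Linearization g g0 c h lam lam' C) (hlam : 0 < lam) (hch : 0 < c * h) {a y z : ℝ}
    (ha : 0 ≤ a) (hy : 0 ≤ y) (hya : y ≤ a * Real.exp (lam * (z - c * h))) :
    y ^ (lam' / lam) ≤ a ^ (lam' / lam) * Real.exp (lam' * z) := by
  have hl' : 0 < lam' := hlam.trans hl.lt
  calc y ^ (lam' / lam) ≤ (a * Real.exp (lam * (z - c * h))) ^ (lam' / lam) :=
        Real.rpow_le_rpow hy hya (by positivity)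
    _ = a ^ (lam' / lam) * Real.exp (lam' * (z - c * h)) := by
        rw [Real.mul_rpow ha (Real.exp_pos _).le, ← Real.exp_mul]
        congr 2; field_simp
    _ ≤ a ^ (lam' / lam) * Real.exp (lam' * z) := by
        apply mul_le_mul_of_nonneg_left _ (Real.rpow_nonneg ha _)
        exact Real.exp_le_exp.2 (by nlinarith)

theorem exp_le_of_le {lam lam' Z z : ℝ} (hl : lam < lam') (hz : Z ≤ z) :
    Real.exp (lam * z) ≤ Real.exp (-((lam' - lam) * Z)) * Real.exp (lam' * z) := by
  rw [← Real.exp_add]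
  exact Real.exp_le_exp.2 (by nlinarith)

namespace FrontLike

variable {g : ℝ → ℝ} {kap c h lam A L s del g0 lam' C : ℝ} {u : ℝ → ℝ → ℝ}

theorem exists_lower_exp (hu : FrontLike g h c lam A u) (hg : Monostable g kap L s del)
    (hl : Linearization g g0 c h lam lam' C) {ε : ℝ} (hε : 0 < ε) (hεA : ε < A) :
    ∃ K > 0, ∀ t, -h ≤ t → ∀ z,
      (A - ε) * Real.exp (lam * z) - K * Real.exp (lam' * z) ≤ frame c u t z := by
  obtain ⟨Z, hZ⟩ := hu.init_asymp ε hε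
  have hlam := hu.lam_pos
  have hh := hu.h_pos
  have hch : 0 < c * h := mul_pos hu.c_pos hh
  set a := A - ε with ha
  have ha0 : 0 < a := by rw [ha]; linarith
  have hC := hl.C_pos
  have hchi := hl.chi_neg
  set K1 := a * Real.exp (-((lam' - lam) * Z)) with hK1
  set K2 := C * a ^ (lam' / lam) / -chi g0 c h lam' with hK2
  have hK1p : 0 < K1 := by positivity
  have hK2p : 0 < K2 := div_pos (by positivity) (by linarith)
  have hK2e : K2 * -chi g0 c h lam' = C * a ^ (lam' / lam) := by
    rw [hK2]; field_simp [hchi.ne]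
  set K := K1 + K2 with hK
  have hKp : 0 < K := by linarith
  have hright : ∀ z ≥ Z, a * Real.exp (lam * z) + -K * Real.exp (lam' * z) ≤ 0 := by
    intro z hz
    have h1 := mul_le_mul_of_nonneg_left (exp_le_of_le hl.lt hz) ha0.le
    have h2 : 0 < K2 * Real.exp (lam' * z) := by positivity
    rw [hK, hK1]
    linarith
  have key := hu.solves.frame_le_static_barrier (σ := -1) (c := c) hh le_rfl isClosed_univ
    (F := fun z => a * Real.exp (lam * z) + -K * Real.exp (lam' * z))
    (fun z => hasDerivAt_two_exp _ _ _ _ z) (fun z => hasDerivAt_two_exp _ _ _ _ z)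
    ⟨a * Real.exp (lam * Z), fun z _ => by
      rcases le_total z Z with h1 | h1
      · have h2 : Real.exp (lam * z) ≤ Real.exp (lam * Z) := Real.exp_le_exp.2 (by nlinarith)
        have h3 : 0 < K * Real.exp (lam' * z) := by positivity
        have h4 := mul_le_mul_of_nonneg_left h2 ha0.le
        linarith
      · have h3 : 0 < a * Real.exp (lam * Z) := by positivity
        linarith [hright z h1]⟩
    (fun t ht z _ => by
      have ht' : t ∈ Icc (-h) 0 := ⟨by linarith [ht.1], ht.2⟩
      rcases le_total z Z with h1 | h1
      · have h2 := (hZ t ht' z h1).1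
        have h3 : 0 < K * Real.exp (lam' * z) := by positivity
        linarith
      · linarith [hright z h1, hu.init_nonneg t ht' z])
    (fun t ht z _ hpos hd => by
      refine ⟨univ_mem, ?_⟩
      have h1 := hd (mem_univ _)
      rw [hl.two_exp]
      set Yd := a * Real.exp (lam * (z - c * h)) + -K * Real.exp (lam' * (z - c * h)) with hYd
      have h2 : g Yd ≤ g (frame c u (t - h) (z - c * h)) := hg.strictMono.monotone (by linarith)
      have h3 : g0 * Yd + chi g0 c h lam' * K * Real.exp (lam' * z) ≤ g Yd := by
        have he := Real.exp_pos (lam' * z)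
        rcases le_total Yd 0 with h4 | h4
        · rw [hl.ext _ h4]
          have : 0 ≤ -chi g0 c h lam' * (K * Real.exp (lam' * z)) :=
            mul_nonneg (by linarith) (by positivity)
          linarith
        · have h5 := neg_le_of_abs_le (hl.rem Yd h4)
          have h6 : Yd ≤ a * Real.exp (lam * (z - c * h)) := by
            have : 0 < K * Real.exp (lam' * (z - c * h)) := by positivity
            rw [hYd]; linarith
          have h7 := mul_le_mul_of_nonneg_left (hl.rpow_le hlam hch ha0.le h4 h6) hC.le
          have h8 : 0 ≤ K1 * -chi g0 c h lam' * Real.exp (lam' * z) :=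
            mul_nonneg (mul_nonneg hK1p.le (by linarith)) he.le
          have h9 : C * (a ^ (lam' / lam) * Real.exp (lam' * z))
            = K2 * -chi g0 c h lam' * Real.exp (lam' * z) := by rw [hK2e]; ring
          rw [hK]
          linarith
      linarith)
  refine ⟨K, hKp, fun t ht z => ?_⟩
  have := key t (by linarith) z (mem_univ _)
  linarith

theorem exists_upper_exp (hu : FrontLike g h c lam A u) (hg : Monostable g kap L s del)
    (hl : Linearization g g0 c h lam lam' C) {C1 : ℝ} (hC1 : 0 < C1)
    (hC1u : ∀ t, -h ≤ t → ∀ z, frame c u t z ≤ C1 * Real.exp (lam * z)) {ε : ℝ} (hε : 0 < ε) :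
    ∃ K > 0, ∀ t, -h ≤ t → ∀ z,
      frame c u t z ≤ (A + ε) * Real.exp (lam * z) + K * Real.exp (lam' * z) := by
  obtain ⟨Z, hZ⟩ := hu.init_asymp ε hε
  have hlam := hu.lam_pos
  have hh := hu.h_pos
  have hA := hu.A_pos
  have hch : 0 < c * h := mul_pos hu.c_pos hh
  set a := A + ε with ha
  have ha0 : 0 < a := by rw [ha]; linarith
  have hC := hl.C_pos
  have hchi := hl.chi_neg
  set K1 := C1 * Real.exp (-((lam' - lam) * Z)) with hK1
  set K2 := C * C1 ^ (lam' / lam) / -chi g0 c h lam' with hK2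
  have hK1p : 0 < K1 := by positivity
  have hK2p : 0 < K2 := div_pos (by positivity) (by linarith)
  have hK2e : K2 * -chi g0 c h lam' = C * C1 ^ (lam' / lam) := by
    rw [hK2]; field_simp [hchi.ne]
  set K := K1 + K2 with hK
  have hKp : 0 < K := by linarith
  have key := hu.solves.frame_le_static_barrier (σ := 1) (c := c) hh le_rfl isClosed_univ
    (F := fun z => a * Real.exp (lam * z) + K * Real.exp (lam' * z))
    (fun z => hasDerivAt_two_exp _ _ _ _ z) (fun z => hasDerivAt_two_exp _ _ _ _ z)
    ⟨0, fun z _ => by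
      have h3 : 0 < a * Real.exp (lam * z) + K * Real.exp (lam' * z) := by positivity
      linarith⟩
    (fun t ht z _ => by
      have ht' : t ∈ Icc (-h) 0 := ⟨by linarith [ht.1], ht.2⟩
      rcases le_total z Z with h1 | h1
      · have h2 := (hZ t ht' z h1).2
        have h3 : 0 < K * Real.exp (lam' * z) := by positivity
        linarith
      · have h2 := mul_le_mul_of_nonneg_left (exp_le_of_le hl.lt h1) hC1.le
        have h3 : 0 < K2 * Real.exp (lam' * z) := by positivity
        have h4 : 0 < a * Real.exp (lam * z) := by positivity
        have h5 := hC1u t ht'.1 z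
        have h6 : K * Real.exp (lam' * z) = C1 * (Real.exp (-((lam' - lam) * Z))
          * Real.exp (lam' * z)) + K2 * Real.exp (lam' * z) := by rw [hK, hK1]; ring
        linarith)
    (fun t ht z _ hpos hd => by
      refine ⟨univ_mem, ?_⟩
      have h1 := hd (mem_univ _)
      rw [hl.two_exp]
      set Yd := a * Real.exp (lam * (z - c * h)) + K * Real.exp (lam' * (z - c * h)) with hYd
      set v := frame c u (t - h) (z - c * h) with hv
      have hv0 : 0 ≤ v := hu.nonneg hg (by linarith) _
      have h2 := le_of_abs_le (hl.rem v hv0)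
      have h3 : v ≤ C1 * Real.exp (lam * (z - c * h)) := hC1u _ (by linarith) _
      have h7 := mul_le_mul_of_nonneg_left (hl.rpow_le hlam hch hC1.le hv0 h3) hC.le
      have h8 : 0 ≤ K1 * -chi g0 c h lam' * Real.exp (lam' * z) :=
        mul_nonneg (mul_nonneg hK1p.le (by linarith)) (Real.exp_pos _).le
      have h9 : C * (C1 ^ (lam' / lam) * Real.exp (lam' * z))
        = K2 * -chi g0 c h lam' * Real.exp (lam' * z) := by rw [hK2e]; ring
      have h10 : g0 * v ≤ g0 * Yd := mul_le_mul_of_nonneg_left (by linarith) hl.g0_pos.le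
      rw [hK]
      rw [hK] at hpos
      linarith)
  refine ⟨K, hKp, fun t ht z => ?_⟩
  have := key t (by linarith) z (mem_univ _)
  linarith

/-- Lower bound near `-∞`, for all times. -/
theorem exists_lower_near (hu : FrontLike g h c lam A u) (hg : Monostable g kap L s del)
    (hl : Linearization g g0 c h lam lam' C) {ε : ℝ} (hε : 0 < ε) :
    ∃ Z, ∀ t, -h ≤ t → ∀ z ≤ Z, (A - ε) * Real.exp (lam * z) ≤ frame c u t z := by
  have hA := hu.A_pos
  obtain ⟨K, hK, hKb⟩ := hu.exists_lower_exp hg hl (ε := min (ε / 2) (A / 2)) (by positivity)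
    ((min_le_right _ _).trans_lt (by linarith))
  have hlim : Tendsto (fun z => K * Real.exp ((lam' - lam) * z)) atBot (𝓝 (K * 0)) :=
    (Real.tendsto_exp_atBot.comp (tendsto_id.const_mul_atBot (by linarith [hl.lt]))).const_mul K
  rw [mul_zero] at hlim
  obtain ⟨Z, hZ⟩ := eventually_atBot.1 (hlim.eventually (gt_mem_nhds (half_pos hε)))
  refine ⟨Z, fun t ht z hz => le_trans ?_ (hKb t ht z)⟩
  have h1 := hZ z hz
  have h2 : Real.exp (lam' * z) = Real.exp ((lam' - lam) * z) * Real.exp (lam * z) := by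
    rw [← Real.exp_add]; ring_nf
  rw [h2]
  have h3 := min_le_left (ε / 2) (A / 2)
  have h4 : (A - ε) ≤ (A - min (ε / 2) (A / 2)) - K * Real.exp ((lam' - lam) * z) := by linarith
  have := mul_le_mul_of_nonneg_right h4 (Real.exp_pos (lam * z)).le
  linarith

theorem exists_upper_near (hu : FrontLike g h c lam A u) (hg : Monostable g kap L s del)
    (hl : Linearization g g0 c h lam lam' C) {C1 : ℝ} (hC1 : 0 < C1)
    (hC1u : ∀ t, -h ≤ t → ∀ z, frame c u t z ≤ C1 * Real.exp (lam * z)) {ε : ℝ} (hε : 0 < ε) :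
    ∃ Z, ∀ t, -h ≤ t → ∀ z ≤ Z, frame c u t z ≤ (A + ε) * Real.exp (lam * z) := by
  obtain ⟨K, hK, hKb⟩ := hu.exists_upper_exp hg hl hC1 hC1u (half_pos hε)
  have hlim : Tendsto (fun z => K * Real.exp ((lam' - lam) * z)) atBot (𝓝 (K * 0)) :=
    (Real.tendsto_exp_atBot.comp (tendsto_id.const_mul_atBot (by linarith [hl.lt]))).const_mul K
  rw [mul_zero] at hlim
  obtain ⟨Z, hZ⟩ := eventually_atBot.1 (hlim.eventually (gt_mem_nhds (half_pos hε)))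
  refine ⟨Z, fun t ht z hz => (hKb t ht z).trans ?_⟩
  have h1 := hZ z hz
  have h2 : Real.exp (lam' * z) = Real.exp ((lam' - lam) * z) * Real.exp (lam * z) := by
    rw [← Real.exp_add]; ring_nf
  rw [h2]
  have h4 : (A + ε / 2) + K * Real.exp ((lam' - lam) * z) ≤ A + ε := by linarith
  have := mul_le_mul_of_nonneg_right h4 (Real.exp_pos (lam * z)).le
  linarith

/-- The positive part of the initial datum at `+∞` persists behind a moving cut-off. -/
theorem exists_lower_right (hu : FrontLike g h c lam A u) (hg : Monostable g kap L s del)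
    {k : ℝ} (hk : 0 < k) : ∃ p > 0, p ≤ kap ∧ ∃ X, ∀ t, -h ≤ t → ∀ z,
      p * (1 - Real.exp (k * ((c + k) * t - (z - X)))) ≤ frame c u t z := by
  obtain ⟨m, hm, X0, hX0⟩ := hu.init_pos
  have hc := hu.c_pos
  have hh := hu.h_pos
  set X := X0 + (c + k) * h with hX
  have hp : 0 < min m kap := lt_min hm hg.kap_pos
  set p := min m kap with hpdef
  have hpk : p ≤ kap := min_le_right _ _
  have hpm : p ≤ m := min_le_left _ _
  have hYd : ∀ t z, HasDerivAt (fun z => p * (1 - Real.exp (k * ((c + k) * t - (z - X)))))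
      (p * k * Real.exp (k * ((c + k) * t - (z - X)))) z := fun t z =>
    (((((hasDerivAt_id' z).sub_const X).const_sub ((c + k) * t)).const_mul
      k).exp.const_sub 1 |>.const_mul p).congr_deriv (by ring)
  refine ⟨p, hp, hpk, X, fun t ht z => ?_⟩
  have key := hu.solves.frame_le_barrier (σ := -1) (c := c) hh le_rfl isClosed_univ
    (Y := fun t z => p * (1 - Real.exp (k * ((c + k) * t - (z - X)))))
    (Yt := fun t z => -(p * k * (c + k) * Real.exp (k * ((c + k) * t - (z - X)))))
    (Y1 := fun t z => p * k * Real.exp (k * ((c + k) * t - (z - X))))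
    (Y2 := fun t z => -(p * k * k * Real.exp (k * ((c + k) * t - (z - X)))))
    (by fun_prop)
    (fun t x => by
      have h1 : HasDerivAt (fun τ : ℝ => k * ((c + k) * τ - (x + c * τ - X))) (k * k) t :=
        ((((hasDerivAt_id' t).const_mul (c + k)).sub
          ((((hasDerivAt_id' t).const_mul c).const_add x).sub_const X)).const_mul k).congr_deriv
          (by ring)
      exact ((h1.exp.const_sub 1).const_mul p).congr_deriv (by ring))
    hYd
    (fun t z => (((((hasDerivAt_id' z).sub_const X).const_sub ((c + k) * t)).const_mul
      k).exp.const_mul (p * k)).congr_deriv (by ring))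
    (fun T => ⟨p, fun t ht z _ => by
      have : 0 < p * Real.exp (k * ((c + k) * t - (z - X))) := by positivity
      linarith⟩)
    (fun t ht z _ => by
      have ht' : t ∈ Icc (-h) 0 := ⟨by linarith [ht.1], ht.2⟩
      rcases le_total X0 z with h1 | h1
      · have h2 := hX0 t ht' z h1
        have : 0 < p * Real.exp (k * ((c + k) * t - (z - X))) := by positivity
        linarith
      · have h2 : 1 ≤ Real.exp (k * ((c + k) * t - (z - X))) := by
          apply Real.one_le_exp
          have : 0 ≤ (c + k) * (t + h) := mul_nonneg (by linarith) (by linarith [ht'.1])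
          apply mul_nonneg hk.le
          rw [hX]; linarith
        have h3 := hu.init_nonneg t ht' z
        nlinarith)
    (fun t ht z _ hpos hd => by
      refine ⟨univ_mem, ?_⟩
      have h1 := hd (mem_univ _)
      set e := Real.exp (k * ((c + k) * t - (z - X))) with he
      have he0 : 0 < e := Real.exp_pos _
      have h2 : Real.exp (k * ((c + k) * (t - h) - (z - c * h - X))) ≤ e := by
        apply Real.exp_le_exp.2
        have : 0 < k * (k * h) := by positivity
        linarith
      have h3 := hu.nonneg hg (t := t) (by linarith) z
      have h4 : p * (1 - e) ≤ frame c u (t - h) (z - c * h) := by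
        have := mul_le_mul_of_nonneg_left h2 hp.le
        linarith
      have h5 := hg.strictMono.monotone h4
      have h6 := hg.self_le (y := p * (1 - e)) (by linarith) (by nlinarith)
      linarith) t (by linarith) z (mem_univ _)
  linarith

end FrontLike

theorem hasDerivAt_mul_exp_decay (a r b z : ℝ) :
    HasDerivAt (fun z => a * Real.exp (-(r * (z - b)))) (-(r * (a * Real.exp (-(r * (z - b)))))) z := by
  have h : HasDerivAt (fun z => -(r * (z - b))) (-(r * 1)) z :=
    (((hasDerivAt_id' z).sub_const b).const_mul r).neg
  exact (h.exp.const_mul a).congr_deriv (by ring)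

theorem exists_mul_exp_neg_le {r b : ℝ} (a : ℝ) (hr : 0 < r) (hb : 0 < b) :
    ∃ T > 0, ∀ t ≥ T, a * Real.exp (-(r * t)) ≤ b := by
  have hlim : Tendsto (fun t => a * Real.exp (-(r * t))) atTop (𝓝 (a * 0)) :=
    (Real.tendsto_exp_neg_atTop_nhds_zero.comp (tendsto_id.const_mul_atTop hr)).const_mul a
  rw [mul_zero] at hlim
  obtain ⟨T, hT⟩ := eventually_atTop.1 (hlim.eventually (ge_mem_nhds hb))
  exact ⟨max T 1, by positivity, fun t ht => hT t ((le_max_left _ _).trans ht)⟩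

namespace FrontLike

variable {g : ℝ → ℝ} {kap c h lam A L s del g0 lam' C : ℝ} {u : ℝ → ℝ → ℝ}

theorem exists_strip_bound (hu : FrontLike g h c lam A u) (hg : Monostable g kap L s del)
    (hl : Linearization g g0 c h lam lam' C) :
    ∃ zp, (∀ t, -h ≤ t → ∀ z ≤ zp, A / 2 * Real.exp (lam * z) ≤ frame c u t z) ∧
      ∃ p > 0, p ≤ kap ∧ ∀ t, -h ≤ t → ∀ z ∈ Icc (zp - c * h) zp, p ≤ frame c u t z := by
  have hA := hu.A_pos
  obtain ⟨Z, hZ⟩ := hu.exists_lower_near hg hl (half_pos hA)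
  rw [sub_half] at hZ
  refine ⟨Z, hZ, min (A / 2 * Real.exp (lam * (Z - c * h))) kap, lt_min (by positivity) hg.kap_pos,
    min_le_right _ _, fun t ht z hz => (min_le_left _ _).trans ?_⟩
  refine le_trans ?_ (hZ t ht z hz.2)
  have h1 : Real.exp (lam * (Z - c * h)) ≤ Real.exp (lam * z) :=
    Real.exp_le_exp.2 (mul_le_mul_of_nonneg_left hz.1 hu.lam_pos.le)
  have := mul_le_mul_of_nonneg_left h1 (half_pos hA).le
  linarith

theorem lower_decay (hu : FrontLike g h c lam A u) (hg : Monostable g kap L s del)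
    {p zp k : ℝ} (hp : 0 < p) (hk : 0 < k) (hkc : k ^ 2 + c * k = 1)
    (hstrip : ∀ t, -h ≤ t → ∀ z ∈ Icc (zp - c * h) zp, p ≤ frame c u t z) :
    ∀ t, -h ≤ t → ∀ z ≥ zp,
      p * (Real.exp (-(k * (z - zp))) - Real.exp (-t)) ≤ frame c u t z := by
  intro t ht z hz
  have hh := hu.h_pos
  have hch : 0 < c * h := mul_pos hu.c_pos hh
  have hF : ∀ z, HasDerivAt (fun z => p * Real.exp (-(k * (z - zp))))
      (-(k * (p * Real.exp (-(k * (z - zp)))))) z := hasDerivAt_mul_exp_decay p k zp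
  have key := hu.solves.frame_le_add_barrier (σ := -1) (c := c) hh le_rfl (isClosed_Ici (a := zp))
    (f := fun t => -(p * Real.exp (-t))) (f' := fun t => p * Real.exp (-t))
    (F := fun z => p * Real.exp (-(k * (z - zp))))
    (F1 := fun z => -(k * (p * Real.exp (-(k * (z - zp))))))
    (F2 := fun z => -(k * (-(k * (p * Real.exp (-(k * (z - zp))))))))
    (fun t => (((hasDerivAt_neg t).exp.const_mul p).neg).congr_deriv (by ring))
    hF (fun z => ((hF z).const_mul k).neg)
    ⟨p, fun z hz => by
      have h1 : Real.exp (-(k * (z - zp))) ≤ 1 :=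
        Real.exp_le_one_iff.2 (neg_nonpos.2 (mul_nonneg hk.le (sub_nonneg.2 hz)))
      have := mul_le_mul_of_nonneg_left h1 hp.le
      linarith⟩
    (fun t ht z hz => by
      have h1 : Real.exp (-(k * (z - zp))) ≤ 1 :=
        Real.exp_le_one_iff.2 (neg_nonpos.2 (mul_nonneg hk.le (sub_nonneg.2 hz)))
      have h2 : 1 ≤ Real.exp (-t) := Real.one_le_exp (by linarith [ht.2])
      have h3 := mul_le_mul_of_nonneg_left (h1.trans h2) hp.le
      have h4 := hu.nonneg hg (t := t) (by linarith [ht.1]) z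
      linarith)
    (fun t ht z hz hpos _ => by
      have hpt : 0 < p * Real.exp (-t) := by positivity
      constructor
      · apply Ici_mem_nhds
        rcases eq_or_lt_of_le (show zp ≤ z from hz) with h1 | h1
        · exfalso
          have h2 := hstrip t (by linarith) z ⟨by linarith, by linarith⟩
          rw [← h1] at hpos h2
          simp only [sub_self, mul_zero, neg_zero, Real.exp_zero] at hpos
          linarith
        · exact h1
      · have h4 := hu.nonneg hg (t := t - h) (by linarith) (z - c * h)
        have h5 := hg.strictMono.monotone h4
        rw [hg.zero] at h5
        have h6 : c * (-(k * (p * Real.exp (-(k * (z - zp)))))) -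
            (-(k * (-(k * (p * Real.exp (-(k * (z - zp)))))))) =
            -((k ^ 2 + c * k) * (p * Real.exp (-(k * (z - zp))))) := by ring
        rw [hkc, one_mul] at h6
        linarith) t (by linarith) z hz
  linarith

/-- Persistence: the solution stays away from `0` on a half-line. -/
theorem exists_persistence (hu : FrontLike g h c lam A u) (hg : Monostable g kap L s del)
    (hl : Linearization g g0 c h lam lam' C) :
    ∃ zp, (∀ t, -h ≤ t → ∀ z ≤ zp, A / 2 * Real.exp (lam * z) ≤ frame c u t z) ∧
      ∃ T ≥ 0, ∃ p > 0, ∀ t ≥ T, ∀ z ≥ zp, p ≤ frame c u t z := by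
  have hh := hu.h_pos
  obtain ⟨zp, hlow, p, hp, hpk, hstrip⟩ := hu.exists_strip_bound hg hl
  obtain ⟨k, hk, hkc⟩ := Profile.exists_root c
  obtain ⟨p0, hp0, -, X, hX⟩ := hu.exists_lower_right hg (half_pos hk)
  have hdec := hu.lower_decay hg hp hk hkc hstrip
  set D := k * (X + 2 / k - zp) with hD
  set T := (2 / k ^ 2) * (|D| + 1) with hT
  have hT0 : 0 ≤ T := by positivity
  have hTD : k ^ 2 / 2 * T = |D| + 1 := by rw [hT]; field_simp
  set q := min (p0 / 2) (p * Real.exp (-(T + h))) with hq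
  have hq0 : 0 < q := by positivity
  have hqp : q ≤ p := by
    refine (min_le_right _ _).trans ?_
    have : Real.exp (-(T + h)) ≤ 1 := Real.exp_le_one_iff.2 (by linarith)
    nlinarith
  have hwin : ∀ t ∈ Icc T (T + h), ∀ z ≥ zp, q ≤ frame c u t z := by
    intro t ht z hz
    rcases le_total (X + (c + k / 2) * t + 2 / k) z with h1 | h1
    · refine le_trans ((min_le_left _ _).trans ?_) (hX t (by linarith [ht.1]) z)
      have h2 : k / 2 * ((c + k / 2) * t - (z - X)) ≤ -1 := by
        have : k / 2 * ((c + k / 2) * t - (z - X)) ≤ k / 2 * (-(2 / k)) :=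
          mul_le_mul_of_nonneg_left (by linarith) (by positivity)
        refine this.trans (le_of_eq ?_)
        field_simp
      have h3 : Real.exp (k / 2 * ((c + k / 2) * t - (z - X))) ≤ 1 / 2 := by
        refine (Real.exp_le_exp.2 h2).trans ?_
        rw [Real.exp_neg, one_div]
        exact inv_anti₀ two_pos (by linarith [Real.add_one_le_exp (1 : ℝ)])
      have := mul_le_mul_of_nonneg_left h3 hp0.le
      linarith
    · refine le_trans ((min_le_right _ _).trans ?_) (hdec t (by linarith [ht.1]) z hz)
      apply mul_le_mul_of_nonneg_left _ hp.le
      have h2 : 1 - t ≤ -(k * (z - zp)) := by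
        have h3 := mul_le_mul_of_nonneg_left h1 hk.le
        have h4 : k * (X + (c + k / 2) * t + 2 / k) =
          D + k * zp + (k ^ 2 + c * k) * t - k ^ 2 / 2 * t := by rw [hD]; ring
        rw [hkc] at h4
        have h5 : k ^ 2 / 2 * T ≤ k ^ 2 / 2 * t :=
          mul_le_mul_of_nonneg_left ht.1 (by positivity)
        linarith [le_abs_self D]
      have h3 := Real.exp_le_exp.2 h2
      have h4 : Real.exp (1 - t) = Real.exp 1 * Real.exp (-t) := by
        rw [← Real.exp_add]; ring_nf
      have h5 : Real.exp (-(T + h)) ≤ Real.exp (-t) := Real.exp_le_exp.2 (by linarith [ht.2])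
      have h6 : 2 * Real.exp (-t) ≤ Real.exp 1 * Real.exp (-t) :=
        mul_le_mul_of_nonneg_right (by linarith [Real.add_one_le_exp (1 : ℝ)]) (Real.exp_pos _).le
      linarith
  refine ⟨zp, hlow, T, hT0, q, hq0, fun t ht z hz => ?_⟩
  have key := hu.solves.frame_le_const (σ := -1) (c := c) (p := q) (t0 := T + h) hh
    (by linarith) (isClosed_Ici (a := zp))
    (fun t ht z hz => by
      have := hwin t ⟨by linarith [ht.1], ht.2⟩ z hz
      linarith)
    (fun t ht z hz hpos hd => by
      have hz : zp ≤ z := hz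
      constructor
      · apply Ici_mem_nhds
        rcases eq_or_lt_of_le hz with h1 | h1
        · exfalso
          have h2 := hstrip t (by linarith) z ⟨by nlinarith [hu.c_pos], h1.ge⟩
          linarith
        · exact h1
      · have h1 : q ≤ frame c u (t - h) (z - c * h) := by
          rcases le_total zp (z - c * h) with h2 | h2
          · linarith [hd h2]
          · exact hqp.trans (hstrip _ (by linarith) _ ⟨by linarith, h2⟩)
        have h2 := hg.strictMono.monotone h1
        have h3 := hg.self_le hq0.le (hqp.trans hpk)
        linarith) t (by linarith) z hz
  linarith

/-- The solution approaches the positive equilibrium from below near `+∞`. -/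
theorem eventually_kap_sub_le (hu : FrontLike g h c lam A u) (hg : Monostable g kap L s del)
    (hl : Linearization g g0 c h lam lam' C) {d : ℝ} (hd : 0 < d) :
    ∃ T ≥ 0, ∃ Z, ∀ t ≥ T, ∀ z ≥ Z, kap - d ≤ frame c u t z := by
  obtain ⟨zp, -, T, hT, p, hp, hper⟩ := hu.exists_persistence hg hl
  obtain ⟨m, hm, hgap⟩ := hg.exists_gap_below (p := p) (q := kap - d / 2) hp (by linarith)
  have hk := hg.kap_pos
  have hL := hg.L_pos
  have hh := hu.h_pos
  have hc := hu.c_pos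
  have hch : 0 < c * h := mul_pos hc hh
  have hev := eventually_small (F := fun r => L * (kap * (Real.exp (r * h) - 1)
    + kap * (Real.exp (r * (c * h)) - 1)) + r * kap * (1 + c + r)) (b := m) (by fun_prop)
    (by simpa using hm)
  obtain ⟨r, hr, hr0⟩ := (hev.and self_mem_nhdsWithin).exists
  have hr0 : 0 < r := hr0
  have hder : ∀ a z, HasDerivAt (fun z => kap * Real.exp (-(r * (z - a))))
      (-(r * (kap * Real.exp (-(r * (z - a)))))) z := hasDerivAt_mul_exp_decay kap r
  have hle : ∀ a z, a ≤ z → kap * Real.exp (-(r * (z - a))) ≤ kap := fun a z hz => by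
    have : Real.exp (-(r * (z - a))) ≤ 1 :=
      Real.exp_le_one_iff.2 (neg_nonpos.2 (mul_nonneg hr0.le (sub_nonneg.2 hz)))
    nlinarith
  have hge : ∀ a z, z ≤ a → kap ≤ kap * Real.exp (-(r * (z - a))) := fun a z hz => by
    have : 1 ≤ Real.exp (-(r * (z - a))) := Real.one_le_exp (by nlinarith)
    nlinarith
  have hpos' : ∀ a z, 0 < kap * Real.exp (-(r * (z - a))) := fun a z => by positivity
  have key := hu.solves.frame_le_add_barrier (σ := -1) (c := c) hh hT (isClosed_Ici (a := zp))
    (f := fun t => (kap - d / 2) - kap * Real.exp (-(r * (t - T))))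
    (f' := fun t => -(-(r * (kap * Real.exp (-(r * (t - T)))))))
    (F := fun z => -(kap * Real.exp (-(r * (z - zp)))))
    (F1 := fun z => -(-(r * (kap * Real.exp (-(r * (z - zp)))))))
    (F2 := fun z => -(-(r * (-(r * (kap * Real.exp (-(r * (z - zp)))))))))
    (fun t => (hder T t).const_sub _) (fun z => (hder zp z).neg)
    (fun z => ((hder zp z).const_mul r).neg.neg)
    ⟨0, fun z _ => by linarith [hpos' zp z]⟩
    (fun t ht z _ => by
      have h1 := hge T t ht.2
      have h2 := hpos' zp z
      have h4 := hu.nonneg hg (t := t) (by linarith [ht.1]) z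
      linarith)
    (fun t ht z hz hpos hdel => by
      have hz : zp ≤ z := hz
      have hv := hper t ht.le z hz
      set x := kap * Real.exp (-(r * (t - T))) with hx
      set y := kap * Real.exp (-(r * (z - zp))) with hy
      have hx0 : 0 < x := hpos' T t
      have hy0 : 0 < y := hpos' zp z
      have hxk : x ≤ kap := hle T t ht.le
      have hyk : y ≤ kap := hle zp z hz
      constructor
      · apply Ici_mem_nhds
        rcases eq_or_lt_of_le hz with h1 | h1
        · exfalso
          have := hge zp z h1.ge
          linarith
        · exact h1
      · have hxd : kap * Real.exp (-(r * (t - h - T))) = x * Real.exp (r * h) := by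
          rw [hx, mul_assoc, ← Real.exp_add]; ring_nf
        have hyd : kap * Real.exp (-(r * (z - c * h - zp))) = y * Real.exp (r * (c * h)) := by
          rw [hy, mul_assoc, ← Real.exp_add]; ring_nf
        have he1 : 1 ≤ Real.exp (r * h) := Real.one_le_exp (by positivity)
        have he2 : 1 ≤ Real.exp (r * (c * h)) := Real.one_le_exp (by positivity)
        have h1 : kap - d / 2 - x * Real.exp (r * h) - y * Real.exp (r * (c * h))
            ≤ frame c u (t - h) (z - c * h) := by
          rcases le_or_gt zp (z - c * h) with h2 | h2
          · have := hdel h2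
            rw [hxd, hyd] at this
            linarith
          · have h3 := hu.nonneg hg (t := t - h) (by linarith) (z - c * h)
            have h4 := hge zp (z - c * h) h2.le
            rw [hyd] at h4
            have : 0 < x * Real.exp (r * h) := by positivity
            linarith
        have h2 := hg.strictMono.monotone h1
        have h3 := hgap (kap - d / 2 - x - y) ⟨by linarith, by linarith⟩
        have h4 := le_of_abs_le (hg.lip (kap - d / 2 - x - y)
          (kap - d / 2 - x * Real.exp (r * h) - y * Real.exp (r * (c * h))))
        have h5 : |kap - d / 2 - x - y - (kap - d / 2 - x * Real.exp (r * h)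
            - y * Real.exp (r * (c * h)))| ≤ kap * (Real.exp (r * h) - 1)
            + kap * (Real.exp (r * (c * h)) - 1) := by
          have h6 : kap - d / 2 - x - y - (kap - d / 2 - x * Real.exp (r * h)
            - y * Real.exp (r * (c * h))) = x * (Real.exp (r * h) - 1)
            + y * (Real.exp (r * (c * h)) - 1) := by ring
          have h7 : 0 ≤ x * (Real.exp (r * h) - 1) := mul_nonneg hx0.le (by linarith)
          have h8 : 0 ≤ y * (Real.exp (r * (c * h)) - 1) := mul_nonneg hy0.le (by linarith)
          rw [h6, abs_of_nonneg (by linarith)]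
          have h9 := mul_le_mul_of_nonneg_right hxk (show 0 ≤ Real.exp (r * h) - 1 by linarith)
          have h10 := mul_le_mul_of_nonneg_right hyk
            (show 0 ≤ Real.exp (r * (c * h)) - 1 by linarith)
          linarith
        have h6 := mul_le_mul_of_nonneg_left h5 hL.le
        have h7 : r * x + c * (r * y) + r * (r * y) ≤ r * kap * (1 + c + r) := by
          have e1 := mul_le_mul_of_nonneg_left hxk hr0.le
          have e2 := mul_le_mul_of_nonneg_left hyk (show 0 ≤ c * r by positivity)
          have e3 := mul_le_mul_of_nonneg_left hyk (show 0 ≤ r * r by positivity)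
          linarith
        linarith)
  obtain ⟨τ, hτ, hτb⟩ := exists_mul_exp_neg_le kap hr0 (b := d / 4) (by positivity)
  refine ⟨T + τ, by linarith, zp + τ, fun t ht z hz => ?_⟩
  have h1 := key t (by linarith) z (show zp ≤ z by linarith)
  have h2 := hτb (t - T) (by linarith)
  have h3 := hτb (z - zp) (by linarith)
  linarith

end FrontLike

/-- The decaying exponential normalized to be `1` at time `t0`. -/
def decay (γ t0 t : ℝ) : ℝ := Real.exp (-(γ * (t - t0)))

theorem decay_pos (γ t0 t : ℝ) : 0 < decay γ t0 t := Real.exp_pos _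

theorem hasDerivAt_decay (γ t0 t : ℝ) : HasDerivAt (decay γ t0) (-(γ * decay γ t0 t)) t := by
  have := hasDerivAt_mul_exp_decay 1 γ t0 t
  simp only [one_mul] at this
  exact this

theorem continuous_decay (γ t0 : ℝ) : Continuous (decay γ t0) :=
  continuous_iff_continuousAt.2 fun t => (hasDerivAt_decay γ t0 t).continuousAt

theorem decay_sub (γ t0 t h : ℝ) : decay γ t0 (t - h) = decay γ t0 t * Real.exp (γ * h) := by
  rw [decay, decay, ← Real.exp_add]; ring_nf

theorem decay_le_one {γ t0 t : ℝ} (hγ : 0 ≤ γ) (ht : t0 ≤ t) : decay γ t0 t ≤ 1 :=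
  Real.exp_le_one_iff.2 (neg_nonpos.2 (mul_nonneg hγ (sub_nonneg.2 ht)))

theorem one_le_decay {γ t0 t : ℝ} (hγ : 0 ≤ γ) (ht : t ≤ t0) : 1 ≤ decay γ t0 t :=
  Real.one_le_exp (neg_nonneg.2 (mul_nonpos_of_nonneg_of_nonpos hγ (sub_nonpos.2 ht)))

theorem decay_le_exp {γ t0 t h : ℝ} (hγ : 0 ≤ γ) (ht : t0 - h ≤ t) :
    decay γ t0 t ≤ Real.exp (γ * h) := by
  apply Real.exp_le_exp.2
  have := mul_le_mul_of_nonneg_left ht hγ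
  linarith

theorem exists_mul_decay_le {γ b : ℝ} (a t0 : ℝ) (hγ : 0 < γ) (hb : 0 < b) :
    ∃ T, ∀ t ≥ T, a * decay γ t0 t ≤ b := by
  obtain ⟨T, -, hT⟩ := exists_mul_exp_neg_le a hγ hb
  exact ⟨T + t0, fun t ht => hT (t - t0) (by linarith)⟩

namespace Profile

variable {g φ φ1 φ2 : ℝ → ℝ} {kap c h lam A L s del : ℝ}

theorem signed_mono (hφ : Profile g kap c h lam A φ φ1 φ2) (hg : Monostable g kap L s del)
    {σ : ℝ} (hσ : |σ| = 1) {x y : ℝ} (hxy : x ≤ y) (z : ℝ) :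
    σ * φ (z + σ * x) ≤ σ * φ (z + σ * y) := by
  rcases eq_or_eq_neg_of_abs_eq hσ with h1 | h1
  · rw [h1]; linarith [hφ.monotone hg (show z + 1 * x ≤ z + 1 * y by linarith)]
  · rw [h1]; linarith [hφ.monotone hg (show z + -1 * y ≤ z + -1 * x by linarith)]

/-- The differential inequality behind multiplicative barriers. -/
theorem exists_squeeze_constants (hφ : Profile g kap c h lam A φ φ1 φ2)
    (hg : Monostable g kap L s del) {σ : ℝ} (hσ : |σ| = 1) :
    ∃ γ > 0, ∃ δ > 0, δ * Real.exp (γ * h) ≤ 1 / 2 ∧ ∃ T > 0, ∀ E ∈ Ioc (0 : ℝ) 1, ∀ ζ,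
      σ * (g ((1 + σ * (δ * (E * Real.exp (γ * h)))) * φ (ζ - c * h))
        - (1 + σ * (δ * E)) * g (φ (ζ - c * h))) ≤
      -(δ * γ * E * φ ζ) + (1 + σ * (δ * E)) * (T * γ * E * φ1 ζ) := by
  have hk := hg.kap_pos
  have hd := hg.del_pos
  have hL := hg.L_pos
  have hs := hg.s_pos
  have hσ2 : σ * σ = 1 := by rw [← abs_mul_abs_self, hσ, one_mul]
  have hch := hφ.ch_pos
  have hev := eventually_small (F := fun r => (1 - s) * Real.exp (r * h) + 2 * r) (b := 1)
    (by fun_prop) (by simpa using hs)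
  obtain ⟨γ, hγ, hγ0⟩ := (hev.and self_mem_nhdsWithin).exists
  have hγ0 : 0 < γ := hγ0
  set e := Real.exp (γ * h) with he
  have he0 : 0 < e := Real.exp_pos _
  set δ := min (1 / 2) (del / 2 / kap) / e with hδ
  have hδ0 : 0 < δ := by positivity
  have hδe : δ * e = min (1 / 2) (del / 2 / kap) := div_mul_cancel₀ _ he0.ne'
  have hδe1 : δ * e ≤ 1 / 2 := hδe ▸ min_le_left _ _
  have hδe2 : δ * e * kap ≤ del / 2 := by
    rw [← le_div_iff₀ hk, hδe]; exact min_le_right _ _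
  obtain ⟨Zf, hZf⟩ := eventually_atTop.1 (hφ.tendsto_atTop.eventually
    (lt_mem_nhds (show kap - min (del / 2) (kap / 2) < kap by
      have : 0 < min (del / 2) (kap / 2) := by positivity
      linarith)))
  obtain ⟨b, hb, hbl⟩ := hφ.exists_deriv_lower hg (Zf + c * h)
  set T := 2 * δ * (L * e + γ) / (γ * b) with hT
  have hT0 : 0 < T := by positivity
  have hTe : T * γ * b = 2 * δ * (L * e + γ) := by rw [hT]; field_simp
  refine ⟨γ, hγ0, δ, hδ0, hδe1, T, hT0, fun E hE ζ => ?_⟩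
  set ψ := φ (ζ - c * h) with hψ
  have hψ0 : 0 < ψ := hφ.pos _
  have hψk : ψ ≤ kap := hφ.le_kap hg _
  have hφ0 : 0 < φ ζ := hφ.pos _
  have hφk : φ ζ ≤ kap := hφ.le_kap hg _
  have hφ1 : 0 ≤ φ1 ζ := hφ.deriv_nonneg hg ζ
  have hψφ : ψ ≤ φ ζ := hφ.monotone hg (by linarith)
  have hE0 : 0 < E := hE.1
  have hgψ : ψ ≤ g ψ := hg.self_le hψ0.le hψk
  have he1 : 1 ≤ e := Real.one_le_exp (mul_nonneg hγ0.le hφ.h_pos.le)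
  have hδE : δ * E ≤ 1 / 2 := by
    refine le_trans ?_ hδe1
    exact mul_le_mul_of_nonneg_left (hE.2.trans he1) hδ0.le
  have hσl : -1 ≤ σ := (abs_le.1 hσ.le).1
  have hhalf : 1 / 2 ≤ 1 + σ * (δ * E) := by
    have := mul_le_mul_of_nonneg_right hσl (show 0 ≤ δ * E by positivity)
    linarith
  have hdiff : |(1 + σ * (δ * (E * e))) * ψ - ψ| = δ * e * E * ψ := by
    rw [show (1 + σ * (δ * (E * e))) * ψ - ψ = σ * (δ * e * E * ψ) by ring, abs_mul, hσ, one_mul,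
      abs_of_pos (by positivity)]
  have hsplit : σ * (g ((1 + σ * (δ * (E * e))) * ψ) - (1 + σ * (δ * E)) * g ψ) =
      σ * (g ((1 + σ * (δ * (E * e))) * ψ) - g ψ) - σ * σ * (δ * E * g ψ) := by ring
  have hσx : ∀ x : ℝ, σ * x ≤ |x| := fun x => by
    have := le_abs_self (σ * x)
    rwa [abs_mul, hσ, one_mul] at this
  rw [hsplit, hσ2, one_mul]
  refine (sub_le_sub_right (hσx _) _).trans ?_
  rcases le_total ζ (Zf + c * h) with h1 | h1
  · have h2 := hg.lip ((1 + σ * (δ * (E * e))) * ψ) ψ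
    rw [hdiff] at h2
    have h3 : 0 ≤ δ * E * g ψ := mul_nonneg (by positivity) (by linarith)
    have h4 : L * (δ * e * E * ψ) ≤ L * (δ * e * E * φ ζ) := by gcongr
    have h5 : 1 / 2 * (T * γ * E * (b * φ ζ)) ≤ (1 + σ * (δ * E)) * (T * γ * E * φ1 ζ) := by
      apply mul_le_mul hhalf _ (by positivity) (by linarith)
      exact mul_le_mul_of_nonneg_left (hbl ζ h1) (by positivity)
    have h6 : 1 / 2 * (T * γ * E * (b * φ ζ)) = δ * (L * e + γ) * E * φ ζ := by
      rw [show T * γ * E * (b * φ ζ) = T * γ * b * (E * φ ζ) by ring, hTe]; ring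
    linarith
  · have h2 := hZf (ζ - c * h) (by linarith)
    have h2a := min_le_left (del / 2) (kap / 2)
    have h2b := min_le_right (del / 2) (kap / 2)
    have h7 : δ * e * E * ψ ≤ del / 2 := by
      refine le_trans ?_ hδe2
      have h8 : E * ψ ≤ 1 * kap := mul_le_mul hE.2 hψk hψ0.le zero_le_one
      have := mul_le_mul_of_nonneg_left h8 (show 0 ≤ δ * e by positivity)
      linarith
    have h8 := abs_le.1 (hdiff.le.trans h7)
    have h9 := hg.near ((1 + σ * (δ * (E * e))) * ψ) ⟨by linarith, by linarith⟩ ψ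
      ⟨by linarith, by linarith⟩
    rw [hdiff] at h9
    have h10 : 0 ≤ (1 + σ * (δ * E)) * (T * γ * E * φ1 ζ) :=
      mul_nonneg (by linarith) (by positivity)
    have h11 : δ * E * ψ * ((1 - s) * e + 2 * γ) ≤ δ * E * ψ * 1 :=
      mul_le_mul_of_nonneg_left hγ.le (by positivity)
    have h12 : δ * E * ψ ≤ δ * E * g ψ := mul_le_mul_of_nonneg_left hgψ (by positivity)
    have h13 : δ * γ * E * φ ζ ≤ δ * γ * E * (2 * ψ) :=
      mul_le_mul_of_nonneg_left (by linarith) (by positivity)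
    linarith

end Profile

namespace FrontLike

variable {g φ φ1 φ2 : ℝ → ℝ} {kap c h lam A L s del g0 lam' C : ℝ} {u : ℝ → ℝ → ℝ}

/-- A one-sided multiplicative comparison with a shifted front improves to a bound that is
exponentially close to a front. -/
theorem exists_squeeze (hu : FrontLike g h c lam A u) (hg : Monostable g kap L s del)
    (hφ : Profile g kap c h lam A φ φ1 φ2) {σ : ℝ} (hσ : |σ| = 1) :
    ∃ γ > 0, ∃ δ > 0, δ * Real.exp (γ * h) ≤ 1 / 2 ∧ ∃ D > 0, ∀ t0 ≥ 0, ∀ T,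
      (∀ t ∈ Icc (t0 - h) t0, ∀ z,
        σ * (frame c u t z - (1 + σ * δ) * φ (z + σ * T)) ≤ 0) →
      ∀ t, t0 - h ≤ t → ∀ z, σ * (frame c u t z - φ (z + σ * (T + D))) ≤
        δ * decay γ t0 t * φ (z + σ * (T + D)) := by
  obtain ⟨γ, hγ, δ, hδ, hδe, D, hD, hineq⟩ := hφ.exists_squeeze_constants hg hσ
  have hσ2 : σ * σ = 1 := by rw [← abs_mul_abs_self, hσ, one_mul]
  have hσl := abs_le.1 hσ.le
  have hh := hu.h_pos
  set e := Real.exp (γ * h) with he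
  have he1 : 1 ≤ e := Real.one_le_exp (by positivity)
  refine ⟨γ, hγ, δ, hδ, hδe, D * e, by positivity, fun t0 ht0 T hinit => ?_⟩
  set T1 := T + D * e with hT1
  have hEd : ∀ t, HasDerivAt (decay γ t0) (-(γ * decay γ t0 t)) t := hasDerivAt_decay γ t0
  have hEc := continuous_decay γ t0
  have hφc := hφ.continuous
  have hinner : ∀ t x : ℝ, HasDerivAt (fun τ => x + c * τ + σ * (T1 - D * decay γ t0 τ))
      (c + σ * (D * (γ * decay γ t0 t))) t := fun t x => by
    have h1 : HasDerivAt (fun τ => x + c * τ) c t :=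
      (((hasDerivAt_id' t).const_mul c).const_add x).congr_deriv (by ring)
    exact (h1.add ((((hEd t).const_mul D).const_sub T1).const_mul σ)).congr_deriv (by ring)
  have key := hu.solves.frame_le_barrier (σ := σ) (c := c) hh ht0 isClosed_univ
    (Y := fun t z => (1 + σ * (δ * decay γ t0 t)) * φ (z + σ * (T1 - D * decay γ t0 t)))
    (Yt := fun t z => -(σ * (δ * (γ * decay γ t0 t)) * φ (z + σ * (T1 - D * decay γ t0 t))) +
      (1 + σ * (δ * decay γ t0 t)) *
        (σ * (D * (γ * decay γ t0 t)) * φ1 (z + σ * (T1 - D * decay γ t0 t))))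
    (Y1 := fun t z => (1 + σ * (δ * decay γ t0 t)) * φ1 (z + σ * (T1 - D * decay γ t0 t)))
    (Y2 := fun t z => (1 + σ * (δ * decay γ t0 t)) * φ2 (z + σ * (T1 - D * decay γ t0 t)))
    (by fun_prop)
    (fun t x => by
      have h1 : HasDerivAt (fun τ => 1 + σ * (δ * decay γ t0 τ))
          (σ * (δ * (-(γ * decay γ t0 t)))) t := (((hEd t).const_mul δ).const_mul σ).const_add 1
      exact (h1.mul ((hφ.hasDeriv _).comp t (hinner t x))).congr_deriv
        (by simp only [Function.comp_apply]; ring))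
    (fun t z => ((hφ.hasDeriv _).comp_add_const z _).const_mul _)
    (fun t z => ((hφ.hasDeriv2 _).comp_add_const z _).const_mul _)
    (fun _ => ⟨kap, fun t ht z _ => by
      have h1 := hφ.pos (z + σ * (T1 - D * decay γ t0 t))
      have h2 := hφ.le_kap hg (z + σ * (T1 - D * decay γ t0 t))
      have h3 := decay_pos γ t0 t
      have h4 : -(σ * ((1 + σ * (δ * decay γ t0 t)) * φ (z + σ * (T1 - D * decay γ t0 t)))) =
          -σ * φ (z + σ * (T1 - D * decay γ t0 t)) - σ * σ * (δ * decay γ t0 t *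
            φ (z + σ * (T1 - D * decay γ t0 t))) := by ring
      rw [h4, hσ2]
      have h5 : 0 < δ * decay γ t0 t * φ (z + σ * (T1 - D * decay γ t0 t)) := by positivity
      have h6 := mul_le_mul_of_nonneg_right (show -σ ≤ 1 by linarith) h1.le
      linarith⟩)
    (fun t ht z _ => by
      refine le_trans ?_ (hinit t ht z)
      have h1 := one_le_decay hγ.le ht.2
      have h2 := decay_le_exp hγ.le ht.1
      have h3 := hφ.signed_mono hg hσ (show T ≤ T1 - D * decay γ t0 t by
        have := mul_le_mul_of_nonneg_left h2 hD.le
        linarith) z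
      have h4 := hφ.pos (z + σ * (T1 - D * decay γ t0 t))
      have h5 : 0 ≤ 1 + σ * δ := by
        have := mul_le_mul_of_nonneg_right hσl.1 hδ.le
        have : δ * 1 ≤ δ * e := mul_le_mul_of_nonneg_left he1 hδ.le
        linarith
      have h6 := mul_le_mul_of_nonneg_left h3 h5
      have h7 : δ * 1 * φ (z + σ * (T1 - D * decay γ t0 t)) ≤
          δ * decay γ t0 t * φ (z + σ * (T1 - D * decay γ t0 t)) :=
        mul_le_mul_of_nonneg_right (mul_le_mul_of_nonneg_left h1 hδ.le) h4.le
      have h8 : σ * ((1 + σ * (δ * decay γ t0 t)) * φ (z + σ * (T1 - D * decay γ t0 t))) =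
          (1 + σ * δ) * (σ * φ (z + σ * (T1 - D * decay γ t0 t))) + σ * σ *
          (δ * decay γ t0 t * φ (z + σ * (T1 - D * decay γ t0 t)) -
            δ * 1 * φ (z + σ * (T1 - D * decay γ t0 t))) := by ring
      rw [hσ2] at h8
      linarith)
    (fun t ht z _ hpos hdel => by
      refine ⟨univ_mem, ?_⟩
      have h1 := hdel (mem_univ _)
      simp only [decay_sub] at h1
      set E := decay γ t0 t with hE
      have hE0 : 0 < E := decay_pos γ t0 t
      have hE1 : E ≤ 1 := decay_le_one hγ.le ht.le
      set ζ := z + σ * (T1 - D * E) with hζ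
      have h2 := hineq E ⟨hE0, hE1⟩ ζ
      rw [hφ.eqn ζ]
      set ψ := φ (ζ - c * h) with hψ
      have h3 : σ * φ (z - c * h + σ * (T1 - D * (E * e))) ≤ σ * ψ := by
        have h4 := hφ.signed_mono hg hσ (show T1 - D * (E * e) ≤ T1 - D * E by
          have : E * 1 ≤ E * e := mul_le_mul_of_nonneg_left he1 hE0.le
          have := mul_le_mul_of_nonneg_left this hD.le
          linarith) (z - c * h)
        rwa [show z - c * h + σ * (T1 - D * E) = ζ - c * h by rw [hζ]; ring] at h4
      have h5 : 0 ≤ 1 + σ * (δ * (E * e)) := by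
        have e1 : δ * (E * e) ≤ δ * e := by
          have := mul_le_mul_of_nonneg_right hE1 (show 0 ≤ δ * e by positivity)
          linarith
        have := mul_le_mul_of_nonneg_right hσl.1 (show 0 ≤ δ * (E * e) by positivity)
        linarith
      have h6 := mul_le_mul_of_nonneg_left h3 h5
      have h7 : σ * g (frame c u (t - h) (z - c * h)) ≤ σ * g ((1 + σ * (δ * (E * e))) * ψ) := by
        have h8 : σ * frame c u (t - h) (z - c * h) ≤ σ * ((1 + σ * (δ * (E * e))) * ψ) := by
          linarith
        rcases eq_or_eq_neg_of_abs_eq hσ with h9 | h9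
        · rw [h9] at h8 ⊢
          linarith [hg.strictMono.monotone (by linarith : frame c u (t - h) (z - c * h) ≤
            (1 + 1 * (δ * (E * e))) * ψ)]
        · rw [h9] at h8 ⊢
          linarith [hg.strictMono.monotone (by linarith : (1 + -1 * (δ * (E * e))) * ψ ≤
            frame c u (t - h) (z - c * h))]
      have h8 : σ * (-(σ * (δ * (γ * E)) * φ ζ) + (1 + σ * (δ * E)) * (σ * (D * (γ * E)) * φ1 ζ) +
          c * ((1 + σ * (δ * E)) * φ1 ζ) - (1 + σ * (δ * E)) * (c * φ1 ζ + φ ζ - g ψ)) =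
          σ * σ * (-(δ * γ * E * φ ζ) + (1 + σ * (δ * E)) * (D * γ * E * φ1 ζ)) -
          σ * ((1 + σ * (δ * E)) * φ ζ) + σ * ((1 + σ * (δ * E)) * g ψ) := by ring
      rw [hσ2] at h8
      linarith)
  intro t ht z
  have h1 := key t ht z (mem_univ _)
  have h2 := hφ.signed_mono hg hσ (show T1 - D * decay γ t0 t ≤ T1 by
    have := mul_pos hD (decay_pos γ t0 t)
    linarith) z
  have h3 : 0 ≤ 1 + σ * (δ * decay γ t0 t) := by
    have e1 : δ * decay γ t0 t ≤ δ * e :=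
      mul_le_mul_of_nonneg_left (decay_le_exp hγ.le ht) hδ.le
    have := mul_le_mul_of_nonneg_right hσl.1 (mul_pos hδ (decay_pos γ t0 t)).le
    linarith
  have h4 := mul_le_mul_of_nonneg_left h2 h3
  have h5 : (1 + σ * (δ * decay γ t0 t)) * (σ * φ (z + σ * T1)) = σ * φ (z + σ * T1) +
      σ * σ * (δ * decay γ t0 t * φ (z + σ * T1)) := by ring
  rw [hσ2] at h5
  linarith

theorem exists_squeeze_init_above (hu : FrontLike g h c lam A u) (hg : Monostable g kap L s del)
    (hφ : Profile g kap c h lam A φ φ1 φ2) {δ : ℝ} (hδ : 0 < δ) :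
    ∃ t0 ≥ 0, ∃ T > 0, ∀ t ∈ Icc (t0 - h) t0, ∀ z, frame c u t z ≤ (1 + δ) * φ (z + T) := by
  have hk := hg.kap_pos
  have hh := hu.h_pos
  have hlam := hu.lam_pos
  obtain ⟨t1, ht1, hup⟩ := hu.eventually_le_kap_add hg (q := δ / 2 * kap) (by positivity)
  obtain ⟨C, hC, B, hB, hgrow⟩ := hu.le_growing_exp hg
  obtain ⟨Zd, hZd⟩ := eventually_atTop.1 (hφ.tendsto_atTop.eventually
    (lt_mem_nhds (show (1 + δ / 2) / (1 + δ) * kap < kap by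
      have : (1 + δ / 2) / (1 + δ) < 1 := (div_lt_one (by positivity)).2 (by linarith)
      nlinarith)))
  obtain ⟨b, hb, hbl⟩ := hφ.exists_ge_exp hg Zd
  obtain ⟨T, hT, hTb⟩ := exists_mul_exp_neg_le (C * Real.exp (B * (t1 + h))) hlam hb
  refine ⟨t1 + h, by linarith, T, hT, fun t ht z => ?_⟩
  have hφp := hφ.pos (z + T)
  rcases le_total (z + T) Zd with h1 | h1
  · have h2 := hgrow t (by linarith [ht.1]) z
    have h3 := hbl _ h1
    have h4 : Real.exp (B * t) ≤ Real.exp (B * (t1 + h)) :=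
      Real.exp_le_exp.2 (mul_le_mul_of_nonneg_left ht.2 hB.le)
    have h5 := mul_le_mul_of_nonneg_right (mul_le_mul_of_nonneg_left h4 hC.le)
      (Real.exp_pos (lam * z)).le
    have h6 : Real.exp (lam * z) = Real.exp (-(lam * T)) * Real.exp (lam * (z + T)) := by
      rw [← Real.exp_add]; ring_nf
    have h7 := mul_le_mul_of_nonneg_right (hTb T le_rfl) (Real.exp_pos (lam * (z + T))).le
    have h8 : C * Real.exp (B * (t1 + h)) * Real.exp (lam * z) =
        C * Real.exp (B * (t1 + h)) * Real.exp (-(lam * T)) * Real.exp (lam * (z + T)) := by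
      rw [h6]; ring
    have h9 : 0 < δ * φ (z + T) := by positivity
    linarith
  · have h2 := hup t (by linarith [ht.1]) z
    have h3 := mul_le_mul_of_nonneg_left (hZd _ h1).le (show 0 ≤ 1 + δ by positivity)
    have h4 : (1 + δ) * ((1 + δ / 2) / (1 + δ) * kap) = (1 + δ / 2) * kap := by field_simp
    linarith

theorem exists_squeeze_init_below (hu : FrontLike g h c lam A u) (hg : Monostable g kap L s del)
    (hl : Linearization g g0 c h lam lam' C) (hφ : Profile g kap c h lam A φ φ1 φ2)
    {δ : ℝ} (hδ : 0 < δ) (hδ1 : δ ≤ 1) :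
    ∃ t0 ≥ 0, ∃ T > 0, ∀ t ∈ Icc (t0 - h) t0, ∀ z, (1 - δ) * φ (z - T) ≤ frame c u t z := by
  have hk := hg.kap_pos
  have hh := hu.h_pos
  have hlam := hu.lam_pos
  have hA := hu.A_pos
  obtain ⟨t1, ht1, Z1, hright⟩ := hu.eventually_kap_sub_le hg hl (d := δ * kap) (by positivity)
  obtain ⟨Z2, hleft, t2, ht2, p, hp, hmid⟩ := hu.exists_persistence hg hl
  obtain ⟨K, hK, hKe⟩ := hφ.exists_le_exp hg
  obtain ⟨T3, hT3, hT3b⟩ := exists_mul_exp_neg_le K hlam (half_pos hA)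
  obtain ⟨T4, hT4, hT4b⟩ := exists_mul_exp_neg_le (K * Real.exp (lam * Z1)) hlam hp
  have hshift : ∀ x y, Real.exp (lam * (x - y)) = Real.exp (-(lam * y)) * Real.exp (lam * x) :=
    fun x y => by rw [← Real.exp_add]; ring_nf
  refine ⟨t1 + t2 + h, by linarith, max T3 T4, lt_max_of_lt_left hT3, fun t ht z => ?_⟩
  have hφp := hφ.pos (z - max T3 T4)
  have hφδ : (1 - δ) * φ (z - max T3 T4) ≤ φ (z - max T3 T4) := by nlinarith
  rcases le_total z Z2 with h1 | h1
  · refine le_trans ?_ (hleft t (by linarith [ht.1]) z h1)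
    refine hφδ.trans ((hKe _).trans ?_)
    have h2 := mul_le_mul_of_nonneg_right (hT3b _ (le_max_left T3 T4)) (Real.exp_pos (lam * z)).le
    rw [hshift]
    linarith
  rcases le_total z Z1 with h3 | h3
  · refine le_trans ?_ (hmid t (by linarith [ht.1]) z h1)
    refine hφδ.trans ((hKe _).trans ?_)
    refine le_trans ?_ (hT4b _ (le_max_right T3 T4))
    have h4 : Real.exp (lam * z) ≤ Real.exp (lam * Z1) :=
      Real.exp_le_exp.2 (mul_le_mul_of_nonneg_left h3 hlam.le)
    have h5 := mul_le_mul_of_nonneg_left h4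
      (show 0 ≤ K * Real.exp (-(lam * max T3 T4)) by positivity)
    rw [hshift]
    linarith
  · have h2 := hright t (by linarith [ht.1]) z h3
    have h4 := mul_le_mul_of_nonneg_left (hφ.le_kap hg (z - max T3 T4)) (show 0 ≤ 1 - δ by linarith)
    linarith

end FrontLike

theorem Monostable.signed_sub_le {g : ℝ → ℝ} {kap L s del σ w y r : ℝ}
    (hg : Monostable g kap L s del) (hσ : |σ| = 1) (hw : σ * (w - y) ≤ r) :
    σ * (g w - g y) ≤ |g (y + σ * r) - g y| := by
  rcases eq_or_eq_neg_of_abs_eq hσ with h9 | h9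
  · rw [h9] at hw ⊢
    have := hg.strictMono.monotone (show w ≤ y + 1 * r by linarith)
    linarith [le_abs_self (g (y + 1 * r) - g y)]
  · rw [h9] at hw ⊢
    have := hg.strictMono.monotone (show y + -1 * r ≤ w by linarith)
    linarith [neg_le_abs (g (y + -1 * r) - g y)]

theorem Monostable.signed_sub_le_lip {g : ℝ → ℝ} {kap L s del σ w y r : ℝ}
    (hg : Monostable g kap L s del) (hσ : |σ| = 1) (hr : 0 ≤ r) (hw : σ * (w - y) ≤ r) :
    σ * (g w - g y) ≤ L * r := by
  refine (hg.signed_sub_le hσ hw).trans ((hg.lip _ _).trans (le_of_eq ?_))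
  rw [add_sub_cancel_left, abs_mul, hσ, one_mul, abs_of_nonneg hr]

theorem Monostable.signed_sub_le_near {g : ℝ → ℝ} {kap L s del σ w y r : ℝ}
    (hg : Monostable g kap L s del) (hσ : |σ| = 1) (hr : 0 ≤ r) (hr1 : r ≤ del / 2)
    (hy : kap - del / 2 ≤ y) (hyk : y ≤ kap) (hw : σ * (w - y) ≤ r) :
    σ * (g w - g y) ≤ (1 - s) * r := by
  have hdiff : |y + σ * r - y| = r := by
    rw [add_sub_cancel_left, abs_mul, hσ, one_mul, abs_of_nonneg hr]
  have h8 := abs_le.1 (hdiff.le.trans hr1)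
  have h9 := hg.near (y + σ * r) ⟨by linarith, by linarith⟩ y ⟨by linarith, by linarith [hg.del_pos]⟩
  rw [hdiff] at h9
  exact (hg.signed_sub_le hσ hw).trans h9

namespace Profile

variable {g φ φ1 φ2 : ℝ → ℝ} {kap c h lam A L s del : ℝ}

theorem signed_lipschitz {φ : ℝ → ℝ} {M : ℝ} (hM : ∀ x y, x ≤ y → φ y - φ x ≤ M * (y - x))
    {σ : ℝ} (hσ : |σ| = 1) {x y : ℝ} (hxy : x ≤ y) (z : ℝ) :
    σ * φ (z + σ * y) ≤ σ * φ (z + σ * x) + M * (y - x) := by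
  rcases eq_or_eq_neg_of_abs_eq hσ with h1 | h1
  · rw [h1]; linarith [hM (z + 1 * x) (z + 1 * y) (by linarith)]
  · rw [h1]; linarith [hM (z + -1 * y) (z + -1 * x) (by linarith)]

theorem deriv_le_combination (hφ : Profile g kap c h lam A φ φ1 φ2)
    (hg : Monostable g kap L s del) {σ p k : ℝ} (hσ : |σ| = 1) (hk : 0 < k)
    (hkc : k ^ 2 + c * k = 1) (hp : 0 ≤ p) (hp1 : p ≤ 1) (ζ : ℝ) :
    φ1 ζ ≤ (c + (3 * (c + k) + 1)) * φ1 ζ - (2 + σ * p) * φ2 ζ := by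
  have hc := hφ.c_pos
  have hφ1 : 0 ≤ φ1 ζ := hφ.deriv_nonneg hg ζ
  have h1 : -1 ≤ σ * p ∧ σ * p ≤ 1 := by
    rw [← abs_le, abs_mul, hσ, one_mul, abs_of_nonneg hp]; exact hp1
  have h2 := mul_le_mul_of_nonneg_left (hφ.second_deriv_le hg hk hkc ζ)
    (show 0 ≤ 2 + σ * p by linarith)
  have h3 := mul_le_mul_of_nonneg_right (show 2 + σ * p ≤ 3 by linarith)
    (show 0 ≤ (c + k) * φ1 ζ by positivity)
  have h4 : 0 ≤ c * φ1 ζ := by positivity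
  linarith

/-- The differential inequality behind additive barriers with a position-dependent shift. -/
theorem exists_shift_constants (hφ : Profile g kap c h lam A φ φ1 φ2)
    (hg : Monostable g kap L s del) {σ M a : ℝ} (hσ : |σ| = 1) (hM : 0 < M)
    (hM1 : ∀ z, φ1 z ≤ M) (ha : 0 < a) (T Z : ℝ) :
    ∃ K > 0, ∃ β > 0, β ≤ 1 / 2 ∧ ∃ q > 0, ∃ γ > 0, ∀ E ∈ Ioc (0 : ℝ) 1, ∀ z ≥ Z, ∀ w,
      ∀ x ∈ Ioc (0 : ℝ) 1, x = Real.exp (-(K * (z - Z))) → ∀ ζ,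
      ζ = z + σ * (T + a * (E * (1 - β * x))) →
      σ * (w - φ (ζ - c * h)) ≤ E * (q + (M * a + q) * (Real.exp (γ * h) - 1)) →
      σ * (g w - g (φ (ζ - c * h))) - q * E ≤
        -(γ * E * (a * (1 - β * x) * φ1 ζ + q)) +
          a * E * (K * β * x) * ((c + K) * φ1 ζ - (2 + σ * (a * E * (K * β * x))) * φ2 ζ) := by
  have hk := hg.kap_pos
  have hd := hg.del_pos
  have hL := hg.L_pos
  have hs := hg.s_pos
  have hs1 := hg.s_lt
  have hc := hφ.c_pos
  have hch := hφ.ch_pos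
  have hσl := abs_le.1 hσ.le
  obtain ⟨k, hk0, hkc⟩ := Profile.exists_root c
  set K := 3 * (c + k) + 1 with hK
  have hK0 : 0 < K := by positivity
  set β := min (1 / 2) (1 / (a * K)) with hβ
  have hβ0 : 0 < β := by positivity
  have hβ1 : β ≤ 1 / 2 := min_le_left _ _
  have hβK : a * K * β ≤ 1 := by
    have := mul_le_mul_of_nonneg_left (min_le_right (1 / 2) (1 / (a * K)))
      (show 0 ≤ a * K by positivity)
    rwa [mul_one_div_cancel (by positivity)] at this
  obtain ⟨Zf, hZf⟩ := eventually_atTop.1 (hφ.tendsto_atTop.eventually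
    (lt_mem_nhds (show kap - del / 2 < kap by linarith)))
  obtain ⟨b, hb, hbl⟩ := hφ.exists_deriv_lower hg (Zf + c * h)
  set m := a * (K * β * Real.exp (-(K * (Zf + c * h + |T| + a - Z)))) *
    (b * φ (Z - |T| - a)) with hm
  have hm0 : 0 < m := by
    have := hφ.pos (Z - |T| - a)
    positivity
  set q := min (del / 4) (m / (2 * L)) with hq
  have hq0 : 0 < q := by positivity
  have hqd : q ≤ del / 4 := min_le_left _ _
  have hqm : 2 * L * q ≤ m := by
    have := mul_le_mul_of_nonneg_left (min_le_right (del / 4) (m / (2 * L)))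
      (show 0 ≤ 2 * L by positivity)
    rwa [mul_div_cancel₀ _ (by positivity)] at this
  have hev1 := eventually_small (F := fun r => (M * a + q) * (Real.exp (r * h) - 1))
    (b := s / 2 * q) (by fun_prop) (by simp only [zero_mul, Real.exp_zero, sub_self, mul_zero]; positivity)
  have hev2 := eventually_small (F := fun r => r * (a * M + q)) (b := s / 2 * q) (by fun_prop)
    (by simp only [zero_mul]; positivity)
  obtain ⟨γ, ⟨hγ1, hγ2⟩, hγ0⟩ := ((hev1.and hev2).and self_mem_nhdsWithin).exists
  have hγ0 : 0 < γ := hγ0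
  refine ⟨K, hK0, β, hβ0, hβ1, q, hq0, γ, hγ0, ?_⟩
  intro E hE z hz w x hx hxe ζ hζ hw
  have hE0 := hE.1
  have hx0 := hx.1
  set p := a * E * (K * β * x) with hp
  have hp0 : 0 < p := by positivity
  have hp1 : p ≤ 1 := by
    refine le_trans ?_ hβK
    have h1 : E * x ≤ 1 * 1 := mul_le_mul hE.2 hx.2 hx0.le zero_le_one
    have h2 := mul_le_mul_of_nonneg_left h1 (show 0 ≤ a * K * β by positivity)
    rw [hp]; linarith
  have hφ1 : 0 ≤ φ1 ζ := hφ.deriv_nonneg hg ζ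
  have hbr := hφ.deriv_le_combination hg hσ hk0 hkc hp0.le hp1 ζ
  rw [← hK] at hbr
  have hbr' := mul_le_mul_of_nonneg_left hbr hp0.le
  have hβx0 : 0 < β * x := mul_pos hβ0 hx0
  have hβx : β * x ≤ 1 := by
    have := mul_le_mul hβ1 hx.2 hx0.le (by norm_num)
    linarith only [this]
  have hρ : γ * E * (a * (1 - β * x) * φ1 ζ + q) ≤ E * (s / 2 * q) := by
    have h1 : (1 - β * x) * φ1 ζ ≤ 1 * M :=
      mul_le_mul (by linarith only [hβx0]) (hM1 ζ) hφ1 zero_le_one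
    have h2 := mul_le_mul_of_nonneg_left h1 (show 0 ≤ γ * E * a by positivity)
    have h3 := mul_le_mul_of_nonneg_left hγ2.le hE0.le
    linarith only [h2, h3]
  suffices hsuff : σ * (g w - g (φ (ζ - c * h))) ≤ E * (q * (1 - s / 2)) + p * φ1 ζ by
    linarith only [hsuff, hρ, hbr']
  set ψ := φ (ζ - c * h) with hψ
  have hψ0 : 0 < ψ := hφ.pos _
  have hψk : ψ ≤ kap := hφ.le_kap hg _
  set Δ := E * (q * (1 + s / 2)) with hΔ
  have hΔ0 : 0 < Δ := by positivity
  have hwΔ : σ * (w - ψ) ≤ Δ := by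
    refine hw.trans (mul_le_mul_of_nonneg_left ?_ hE0.le)
    linarith only [hγ1]
  rcases le_total ζ (Zf + c * h) with h1 | h1
  · refine (hg.signed_sub_le_lip hσ hΔ0.le hwΔ).trans ?_
    have hsh : |σ * (T + a * (E * (1 - β * x)))| ≤ |T| + a := by
      rw [abs_mul, hσ, one_mul]
      refine (abs_add_le _ _).trans ?_
      have e0 : 0 ≤ 1 - β * x := sub_nonneg.2 hβx
      have e1 : E * (1 - β * x) ≤ 1 * 1 :=
        mul_le_mul hE.2 (by linarith only [hβx0]) e0 zero_le_one
      rw [abs_of_nonneg (show 0 ≤ a * (E * (1 - β * x)) by positivity)]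
      have := mul_le_mul_of_nonneg_left e1 ha.le
      linarith only [this]
    have hsh' := abs_le.1 hsh
    have h3 : b * φ (Z - |T| - a) ≤ φ1 ζ := by
      refine le_trans ?_ (hbl ζ h1)
      exact mul_le_mul_of_nonneg_left (hφ.monotone hg (by linarith only [hζ, hz, hsh'.1])) hb.le
    have h4 : Real.exp (-(K * (Zf + c * h + |T| + a - Z))) ≤ x := by
      rw [hxe]
      apply Real.exp_le_exp.2
      apply neg_le_neg
      exact mul_le_mul_of_nonneg_left (by linarith only [hζ, h1, hsh'.1]) hK0.le
    have h5 : E * m ≤ p * φ1 ζ := by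
      have h6 : a * (K * β * Real.exp (-(K * (Zf + c * h + |T| + a - Z)))) ≤ a * (K * β * x) := by
        gcongr
      have h7 := mul_le_mul h6 h3 (by have := hφ.pos (Z - |T| - a); positivity) (by positivity)
      have h8 := mul_le_mul_of_nonneg_left h7 hE0.le
      rw [hm, hp]
      linarith only [h8]
    have h6 : L * Δ ≤ E * (2 * L * q) := by
      have e1 : q * (1 + s / 2) ≤ q * 2 := mul_le_mul_of_nonneg_left (by linarith only [hs1]) hq0.le
      have := mul_le_mul_of_nonneg_left e1 (show 0 ≤ L * E by positivity)
      rw [hΔ]; linarith only [this]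
    have h7 := mul_le_mul_of_nonneg_left hqm hE0.le
    have h8 : 0 ≤ E * (q * (1 - s / 2)) :=
      mul_nonneg hE0.le (mul_nonneg hq0.le (by linarith only [hs1]))
    linarith only [h5, h6, h7, h8]
  · have h2 := hZf (ζ - c * h) (by linarith only [h1])
    have hΔd : Δ ≤ del / 2 := by
      have e1 : q * (1 + s / 2) ≤ q * 2 := mul_le_mul_of_nonneg_left (by linarith only [hs1]) hq0.le
      have e2 := mul_le_mul_of_nonneg_right hE.2 (show 0 ≤ q * (1 + s / 2) by positivity)
      rw [hΔ]; linarith only [e1, e2, hqd]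
    refine (hg.signed_sub_le_near hσ hΔ0.le hΔd h2.le hψk hwΔ).trans ?_
    have h10 : 0 ≤ p * φ1 ζ := by positivity
    have h11 : (1 - s) * Δ ≤ E * (q * (1 - s / 2)) := by
      have hΔs : E * (q * (1 - s / 2)) - (1 - s) * Δ = E * q * (s ^ 2 / 2) := by rw [hΔ]; ring
      have : 0 < E * q * (s ^ 2 / 2) := by positivity
      linarith only [this, hΔs]
    linarith only [h10, h11]

end Profile

namespace FrontLike

variable {g φ φ1 φ2 : ℝ → ℝ} {kap c h lam A L s del g0 lam' C : ℝ} {u : ℝ → ℝ → ℝ}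

/-- A one-sided asymptotic bound by a shifted front, valid up to the shift `T`, improves to any
smaller shift `T'` for which it holds near `-∞`. -/
theorem improve_shift (hu : FrontLike g h c lam A u) (hg : Monostable g kap L s del)
    (hφ : Profile g kap c h lam A φ φ1 φ2) {σ : ℝ} (hσ : |σ| = 1) {T T' : ℝ} (hTT : T' < T)
    (hnear : ∃ Z, ∀ t, -h ≤ t → ∀ z ≤ Z, σ * (frame c u t z - φ (z + σ * T')) ≤ 0)
    (hfar : ∀ q > 0, ∃ t1, ∀ t ≥ t1, ∀ z, σ * (frame c u t z - φ (z + σ * T)) ≤ q) :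
    ∀ q > 0, ∃ t1, ∀ t ≥ t1, ∀ z, σ * (frame c u t z - φ (z + σ * T')) ≤ q := by
  obtain ⟨Z, hZ⟩ := hnear
  obtain ⟨M, hM, hM1, hlip⟩ := hφ.exists_lipschitz hg
  set a := 2 * (T - T') with ha
  have ha0 : 0 < a := by rw [ha]; linarith
  obtain ⟨K, hK, β, hβ, hβ1, q, hq, γ, hγ, hineq⟩ :=
    hφ.exists_shift_constants hg hσ hM hM1 ha0 T' Z
  obtain ⟨t1, ht1⟩ := hfar q hq
  have hσ2 : σ * σ = 1 := by rw [← abs_mul_abs_self, hσ, one_mul]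
  have hσl := abs_le.1 hσ.le
  have hh := hu.h_pos
  have hch := hφ.ch_pos
  set e := Real.exp (γ * h) with he
  have he1 : 1 ≤ e := Real.one_le_exp (by positivity)
  set t0 := max t1 0 + h with ht0
  have ht00 : 0 ≤ t0 := by linarith [le_max_right t1 0]
  have hEd : ∀ t, HasDerivAt (decay γ t0) (-(γ * decay γ t0 t)) t := hasDerivAt_decay γ t0
  have hEc := continuous_decay γ t0
  have hXd : ∀ z, HasDerivAt (decay K Z) (-(K * decay K Z z)) z := hasDerivAt_decay K Z
  have hXc := continuous_decay K Z
  have hφc := hφ.continuous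
  have hρd : ∀ z, HasDerivAt (fun z => 1 - β * decay K Z z) (β * (K * decay K Z z)) z := fun z =>
    (((hXd z).const_mul β).const_sub 1).congr_deriv (by ring)
  have hζz : ∀ t z, HasDerivAt (fun z => z + σ * (T' + a * (decay γ t0 t * (1 - β * decay K Z z))))
      (1 + σ * (a * (decay γ t0 t * (β * (K * decay K Z z))))) z := fun t z =>
    (hasDerivAt_id' z).add
      (((((hρd z).const_mul (decay γ t0 t)).const_mul a).const_add T').const_mul σ)
  have hζt : ∀ t x, HasDerivAt (fun τ => x + c * τ + σ * (T' + a * (decay γ t0 τ *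
      (1 - β * decay K Z (x + c * τ))))) (c + σ * (a * (-(γ * decay γ t0 t) *
        (1 - β * decay K Z (x + c * t)) + decay γ t0 t *
        (β * (K * decay K Z (x + c * t)) * c)))) t := fun t x => by
    have h1 : HasDerivAt (fun τ => x + c * τ) c t :=
      (((hasDerivAt_id' t).const_mul c).const_add x).congr_deriv (by ring)
    have h2 : HasDerivAt (fun τ => 1 - β * decay K Z (x + c * τ))
        (β * (K * decay K Z (x + c * t)) * c) t :=
      HasDerivAt.comp (h₂ := fun z => 1 - β * decay K Z z) t (hρd (x + c * t)) h1
    exact h1.add (((((hEd t).mul h2).const_mul a).const_add T').const_mul σ)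
  have hshape : ∀ t z, Z ≤ z → 0 ≤ a * (decay γ t0 t * (1 - β * decay K Z z)) ∧
      a / 2 * decay γ t0 t ≤ a * (decay γ t0 t * (1 - β * decay K Z z)) ∧
      a * (decay γ t0 t * (1 - β * decay K Z z)) ≤ a * decay γ t0 t := by
    intro t z hz
    have h1 := decay_pos γ t0 t
    have h2 := decay_pos K Z z
    have h3 : β * decay K Z z ≤ 1 / 2 * 1 :=
      mul_le_mul hβ1 (decay_le_one hK.le hz) h2.le (by norm_num)
    have h4 : 0 < β * decay K Z z := by positivity
    have h5 : 0 < a * decay γ t0 t := by positivity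
    refine ⟨mul_nonneg ha0.le (mul_nonneg h1.le (by linarith)), ?_, ?_⟩
    · have := mul_le_mul_of_nonneg_left (show 1 / 2 ≤ 1 - β * decay K Z z by linarith) h5.le
      linarith
    · have := mul_le_mul_of_nonneg_left (show 1 - β * decay K Z z ≤ 1 by linarith) h5.le
      linarith
  have key := hu.solves.frame_le_barrier (σ := σ) (c := c) hh ht00 (isClosed_Ici (a := Z))
    (Y := fun t z => φ (z + σ * (T' + a * (decay γ t0 t * (1 - β * decay K Z z)))) +
      σ * (q * decay γ t0 t))
    (Yt := fun t z => φ1 (z + σ * (T' + a * (decay γ t0 t * (1 - β * decay K Z z)))) *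
      (σ * (a * (-(γ * decay γ t0 t) * (1 - β * decay K Z z)))) + σ * (q * (-(γ * decay γ t0 t))))
    (Y1 := fun t z => φ1 (z + σ * (T' + a * (decay γ t0 t * (1 - β * decay K Z z)))) *
      (1 + σ * (a * (decay γ t0 t * (β * (K * decay K Z z))))))
    (Y2 := fun t z => φ2 (z + σ * (T' + a * (decay γ t0 t * (1 - β * decay K Z z)))) *
        (1 + σ * (a * (decay γ t0 t * (β * (K * decay K Z z))))) *
        (1 + σ * (a * (decay γ t0 t * (β * (K * decay K Z z))))) +
      φ1 (z + σ * (T' + a * (decay γ t0 t * (1 - β * decay K Z z)))) *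
        (σ * (a * (decay γ t0 t * (β * (K * (-(K * decay K Z z))))))))
    (by fun_prop)
    (fun t x => (((hφ.hasDeriv _).comp t (hζt t x)).add
        (((hEd t).const_mul q).const_mul σ)).congr_deriv (by ring))
    (fun t z => ((hφ.hasDeriv _).comp z (hζz t z)).add_const _)
    (fun t z => (((hφ.hasDeriv2 _).comp z (hζz t z)).mul
      (((((((hXd z).const_mul K).const_mul β).const_mul (decay γ t0 t)).const_mul a).const_mul
        σ).const_add 1)).congr_deriv (by simp only [Function.comp_apply]))
    (fun _ => ⟨kap, fun t ht z _ => by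
      have h1 := hφ.pos (z + σ * (T' + a * (decay γ t0 t * (1 - β * decay K Z z))))
      have h2 := hφ.le_kap hg (z + σ * (T' + a * (decay γ t0 t * (1 - β * decay K Z z))))
      have h3 := mul_pos hq (decay_pos γ t0 t)
      have h6 := mul_le_mul_of_nonneg_right (show -σ ≤ 1 by linarith) h1.le
      have h7 : σ * (σ * (q * decay γ t0 t)) = σ * σ * (q * decay γ t0 t) := by ring
      rw [mul_add, h7, hσ2]
      linarith⟩)
    (fun t ht z hz => by
      have h1 := one_le_decay hγ.le ht.2
      have h2 := ht1 t (by linarith [ht.1, le_max_left t1 0]) z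
      obtain ⟨-, h3, -⟩ := hshape t z hz
      have h4 := hφ.signed_mono hg hσ (show T ≤ T' + a * (decay γ t0 t * (1 - β * decay K Z z)) by
        have h5 := mul_le_mul_of_nonneg_left h1 (half_pos ha0).le
        linarith) z
      have h5 : σ * (σ * (q * decay γ t0 t)) = σ * σ * (q * decay γ t0 t) := by ring
      have h6 := mul_le_mul_of_nonneg_left h1 hq.le
      rw [hσ2] at h5
      linarith)
    (fun t ht z hz hpos hdel => by
      have hz : Z ≤ z := hz
      obtain ⟨hs0, -, -⟩ := hshape t z hz
      simp only [decay_sub γ t0 t h] at hdel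
      have hXdel : decay K Z z ≤ decay K Z (z - c * h) := by
        rw [decay_sub]
        exact le_mul_of_one_le_right (decay_pos _ _ _).le (Real.one_le_exp (by positivity))
      set E := decay γ t0 t with hE
      set X := decay K Z z with hX
      have hE0 : 0 < E := decay_pos γ t0 t
      have hE1 : E ≤ 1 := decay_le_one hγ.le ht.le
      have hX0 : 0 < X := decay_pos K Z z
      have hX1 : X ≤ 1 := decay_le_one hK.le hz
      have hqE := mul_pos hq hE0
      have hσq : σ * (σ * (q * E)) = σ * σ * (q * E) := by ring
      rw [hσ2, one_mul] at hσq
      rw [mul_sub, mul_add, hσq] at hpos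
      constructor
      · apply Ici_mem_nhds
        rcases eq_or_lt_of_le hz with h1 | h1
        · exfalso
          have h2 := hZ t (by linarith) z h1.ge
          have h3 := hφ.signed_mono hg hσ (show T' ≤ T' + a * (E * (1 - β * X)) by linarith) z
          linarith
        · exact h1
      · set w := frame c u (t - h) (z - c * h) with hw
        set ζ := z + σ * (T' + a * (E * (1 - β * X))) with hζ
        have hζd : z - c * h + σ * (T' + a * (E * (1 - β * X))) = ζ - c * h := by rw [hζ]; ring
        have hwb : σ * (w - φ (ζ - c * h)) ≤ E * (q + (M * a + q) * (e - 1)) := by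
          have hb0 : 0 ≤ E * ((M * a + q) * (e - 1)) :=
            mul_nonneg hE0.le (mul_nonneg (by positivity) (by linarith))
          rcases le_or_gt Z (z - c * h) with h1 | h1
          · have h2 := hdel h1
            set Xd := decay K Z (z - c * h) with hXd
            have hd : a * (E * e * (1 - β * Xd)) ≤ a * (E * (1 - β * X)) + a * E * (e - 1) := by
              have e1 := mul_le_mul_of_nonneg_left hXdel (show 0 ≤ a * E * e * β by positivity)
              have e2 : 0 ≤ a * E * (e - 1) * (β * X) :=
                mul_nonneg (mul_nonneg (by positivity) (by linarith)) (by positivity)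
              linarith
            have h3 := hφ.signed_mono hg hσ (show T' + a * (E * e * (1 - β * Xd)) ≤
              T' + a * (E * (1 - β * X)) + a * E * (e - 1) by linarith) (z - c * h)
            have h4 := Profile.signed_lipschitz hlip hσ (show T' + a * (E * (1 - β * X)) ≤
              T' + a * (E * (1 - β * X)) + a * E * (e - 1) by
                have : 0 ≤ a * E * (e - 1) := mul_nonneg (by positivity) (by linarith)
                linarith) (z - c * h)
            rw [hζd] at h4
            have hσq2 : σ * (σ * (q * (E * e))) = σ * σ * (q * (E * e)) := by ring
            rw [hσ2, one_mul] at hσq2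
            rw [mul_sub, mul_add, hσq2] at h2
            linarith
          · have h2 := hZ (t - h) (by linarith) (z - c * h) h1.le
            have h3 := hφ.signed_mono hg hσ (show T' ≤ T' + a * (E * (1 - β * X)) by linarith)
              (z - c * h)
            rw [hζd] at h3
            have : 0 < E * q := by positivity
            linarith
        have h2 := hineq E ⟨hE0, hE1⟩ z hz w X ⟨hX0, hX1⟩ rfl ζ hζ hwb
        have hid : σ * (φ1 ζ * (σ * (a * (-(γ * E) * (1 - β * X)))) + σ * (q * (-(γ * E))) +
            c * (φ1 ζ * (1 + σ * (a * (E * (β * (K * X)))))) -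
            (φ2 ζ * (1 + σ * (a * (E * (β * (K * X))))) * (1 + σ * (a * (E * (β * (K * X))))) +
            φ1 ζ * (σ * (a * (E * (β * (K * (-(K * X))))))))) =
            σ * (c * φ1 ζ - φ2 ζ) + σ * σ * (-(γ * E * (a * (1 - β * X) * φ1 ζ + q)) +
            a * E * (K * β * X) * ((c + K) * φ1 ζ -
              (2 + σ * (a * E * (K * β * X))) * φ2 ζ)) := by ring
        rw [hid, hσ2, one_mul]
        have h3 : c * φ1 ζ - φ2 ζ = g (φ (ζ - c * h)) - φ ζ := by rw [hφ.eqn ζ]; ring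
        rw [h3]
        linarith only [h2, hpos])
  intro r hr
  obtain ⟨t2, ht2⟩ := exists_mul_decay_le (q + M * a) t0 hγ hr
  refine ⟨max t2 t0, fun t ht z => ?_⟩
  have htt : t0 ≤ t := (le_max_right _ _).trans ht
  rcases le_total z Z with h1 | h1
  · exact (hZ t (by linarith) z h1).trans hr.le
  · have h2 := key t (by linarith) z h1
    have h3 := ht2 t ((le_max_left _ _).trans ht)
    obtain ⟨h4, -, h5⟩ := hshape t z h1
    have h6 := Profile.signed_lipschitz hlip hσ
      (show T' ≤ T' + a * (decay γ t0 t * (1 - β * decay K Z z)) by linarith) z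
    have h7 : σ * (σ * (q * decay γ t0 t)) = σ * σ * (q * decay γ t0 t) := by ring
    rw [hσ2, one_mul] at h7
    have h8 := mul_le_mul_of_nonneg_left h5 hM.le
    rw [mul_sub, mul_add, h7] at h2
    linarith

theorem exists_far_bound (hu : FrontLike g h c lam A u) (hg : Monostable g kap L s del)
    (hl : Linearization g g0 c h lam lam' C) (hφ : Profile g kap c h lam A φ φ1 φ2)
    {σ : ℝ} (hσ : |σ| = 1) :
    ∃ T, ∀ q > 0, ∃ t1, ∀ t ≥ t1, ∀ z, σ * (frame c u t z - φ (z + σ * T)) ≤ q := by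
  obtain ⟨γ, hγ, δ, hδ, hδe, D, -, hsq⟩ := hu.exists_squeeze hg hφ hσ
  have hδ1 : δ ≤ 1 := by
    have := Real.one_le_exp (show 0 ≤ γ * h from mul_nonneg hγ.le hu.h_pos.le)
    nlinarith
  obtain ⟨t0, ht0, T, hT⟩ : ∃ t0 ≥ 0, ∃ T, ∀ t ∈ Icc (t0 - h) t0, ∀ z,
      σ * (frame c u t z - (1 + σ * δ) * φ (z + σ * T)) ≤ 0 := by
    rcases eq_or_eq_neg_of_abs_eq hσ with h1 | h1
    · obtain ⟨t0, ht0, T, -, hT⟩ := hu.exists_squeeze_init_above hg hφ hδ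
      refine ⟨t0, ht0, T, fun t ht z => ?_⟩
      rw [h1, one_mul, one_mul, one_mul]
      linarith [hT t ht z]
    · obtain ⟨t0, ht0, T, -, hT⟩ := hu.exists_squeeze_init_below hg hl hφ hδ hδ1
      refine ⟨t0, ht0, T, fun t ht z => ?_⟩
      rw [h1, neg_one_mul, neg_one_mul, neg_one_mul, ← sub_eq_add_neg, ← sub_eq_add_neg]
      linarith [hT t ht z]
  refine ⟨T + D, fun q hq => ?_⟩
  obtain ⟨t1, ht1⟩ := exists_mul_decay_le (δ * kap) t0 hγ hq
  refine ⟨max t1 t0, fun t ht z => ?_⟩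
  have h1 := hsq t0 ht0 T hT t
    (by linarith [hu.h_pos, (le_max_right t1 t0).trans ht]) z
  have h2 := ht1 t ((le_max_left _ _).trans ht)
  have h3 := mul_le_mul_of_nonneg_left (hφ.le_kap hg (z + σ * (T + D)))
    (mul_nonneg hδ.le (decay_pos γ t0 t).le)
  linarith

theorem exists_le_exp (hu : FrontLike g h c lam A u) (hg : Monostable g kap L s del)
    (hφ : Profile g kap c h lam A φ φ1 φ2) :
    ∃ C1 > 0, ∀ t, -h ≤ t → ∀ z, frame c u t z ≤ C1 * Real.exp (lam * z) := by
  obtain ⟨γ, hγ, δ, hδ, hδe, D, -, hsq⟩ := hu.exists_squeeze hg hφ (σ := 1) abs_one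
  obtain ⟨t0, ht0, T, -, hT⟩ := hu.exists_squeeze_init_above hg hφ hδ
  obtain ⟨K, hK, hKe⟩ := hφ.exists_le_exp hg
  obtain ⟨G, hG, B, hB, hgrow⟩ := hu.le_growing_exp hg
  refine ⟨max (3 / 2 * (K * Real.exp (lam * (T + D)))) (G * Real.exp (B * t0)),
    lt_max_of_lt_left (by positivity), fun t ht z => ?_⟩
  have he := Real.exp_pos (lam * z)
  rcases le_total t t0 with h1 | h1
  · have h2 : Real.exp (B * t) ≤ Real.exp (B * t0) :=
      Real.exp_le_exp.2 (mul_le_mul_of_nonneg_left h1 hB.le)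
    calc frame c u t z ≤ G * Real.exp (B * t) * Real.exp (lam * z) := hgrow t ht z
      _ ≤ G * Real.exp (B * t0) * Real.exp (lam * z) :=
        mul_le_mul_of_nonneg_right (mul_le_mul_of_nonneg_left h2 hG.le) he.le
      _ ≤ _ := mul_le_mul_of_nonneg_right (le_max_right _ _) he.le
  · have h2 := hsq t0 ht0 T (fun t ht z => by
      rw [one_mul, one_mul, one_mul]; linarith [hT t ht z]) t (by linarith [hu.h_pos]) z
    rw [one_mul, one_mul] at h2
    have h3 := mul_le_mul_of_nonneg_left (decay_le_exp hγ.le (show t0 - h ≤ t by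
      linarith [hu.h_pos])) hδ.le
    have h4 := mul_le_mul_of_nonneg_right (h3.trans hδe) (hφ.pos (z + (T + D))).le
    have h5 := hKe (z + (T + D))
    rw [mul_add, Real.exp_add] at h5
    calc frame c u t z ≤ 3 / 2 * (K * Real.exp (lam * (T + D))) * Real.exp (lam * z) := by
          linarith
      _ ≤ _ := mul_le_mul_of_nonneg_right (le_max_left _ _) he.le

theorem exists_near (hu : FrontLike g h c lam A u) (hg : Monostable g kap L s del)
    (hl : Linearization g g0 c h lam lam' C) (hφ : Profile g kap c h lam A φ φ1 φ2)
    {ε : ℝ} (hε : 0 < ε) : ∃ Z, ∀ t, -h ≤ t → ∀ z ≤ Z,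
      (A - ε) * Real.exp (lam * z) ≤ frame c u t z ∧
      frame c u t z ≤ (A + ε) * Real.exp (lam * z) := by
  obtain ⟨C1, hC1, hC1u⟩ := hu.exists_le_exp hg hφ
  obtain ⟨Z1, h1⟩ := hu.exists_lower_near hg hl hε
  obtain ⟨Z2, h2⟩ := hu.exists_upper_near hg hl hC1 hC1u hε
  exact ⟨min Z1 Z2, fun t ht z hz =>
    ⟨h1 t ht z (hz.trans (min_le_left _ _)), h2 t ht z (hz.trans (min_le_right _ _))⟩⟩

theorem exists_near_shift (hu : FrontLike g h c lam A u) (hg : Monostable g kap L s del)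
    (hl : Linearization g g0 c h lam lam' C) (hφ : Profile g kap c h lam A φ φ1 φ2)
    {σ T : ℝ} (hσ : |σ| = 1) (hT : 0 < T) :
    ∃ Z, ∀ t, -h ≤ t → ∀ z ≤ Z, σ * (frame c u t z - φ (z + σ * T)) ≤ 0 := by
  have hA := hu.A_pos
  set r := Real.exp (lam * T) with hr
  have hr1 : 1 < r := Real.one_lt_exp_iff.2 (mul_pos hu.lam_pos hT)
  set ε := A * (r - 1) / (r + 1) with hε
  have hε0 : 0 < ε := div_pos (mul_pos hA (by linarith)) (by linarith)
  have hεr : A + ε = (A - ε) * r := by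
    rw [hε]
    field_simp
    ring
  obtain ⟨Z1, h1⟩ := hu.exists_near hg hl hφ hε0
  obtain ⟨Z2, h2⟩ := hφ.eventually_near_exp hε0
  refine ⟨min Z1 (Z2 - T), fun t ht z hz => ?_⟩
  obtain ⟨h3, h4⟩ := h1 t ht z (hz.trans (min_le_left _ _))
  have hz2 : z ≤ Z2 - T := hz.trans (min_le_right _ _)
  rcases eq_or_eq_neg_of_abs_eq hσ with h5 | h5
  · have h6 := (h2 (z + T) (by linarith)).1
    rw [mul_add, Real.exp_add, ← hr, mul_comm (Real.exp _), ← mul_assoc, ← hεr] at h6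
    rw [h5, one_mul, one_mul]
    linarith
  · have h6 := (h2 (z - T) (by linarith)).2
    have h7 : Real.exp (lam * z) = r * Real.exp (lam * (z - T)) := by
      rw [hr, ← Real.exp_add]; ring_nf
    rw [h7, ← mul_assoc, ← hεr] at h3
    rw [h5, neg_one_mul, neg_one_mul, ← sub_eq_add_neg]
    linarith

/-- A front-like solution is eventually bounded by every slightly shifted front. -/
theorem eventually_le_shift (hu : FrontLike g h c lam A u) (hg : Monostable g kap L s del)
    (hl : Linearization g g0 c h lam lam' C) (hφ : Profile g kap c h lam A φ φ1 φ2)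
    {σ T : ℝ} (hσ : |σ| = 1) (hT : 0 < T) :
    ∀ q > 0, ∃ t1, ∀ t ≥ t1, ∀ z, σ * (frame c u t z - φ (z + σ * T)) ≤ q := by
  obtain ⟨T1, hT1⟩ := hu.exists_far_bound hg hl hφ hσ
  rcases lt_or_ge T T1 with h1 | h1
  · exact hu.improve_shift hg hφ hσ h1 (hu.exists_near_shift hg hl hφ hσ hT) hT1
  · intro q hq
    obtain ⟨t1, ht1⟩ := hT1 q hq
    exact ⟨t1, fun t ht z => by linarith [ht1 t ht z, hφ.signed_mono hg hσ h1 z]⟩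

/-- Convergence to the front with the same asymptotics at `-∞`, in the weighted uniform norm. -/
theorem tendsto_profile (hu : FrontLike g h c lam A u) (hg : Monostable g kap L s del)
    (hl : Linearization g g0 c h lam lam' C) (hφ : Profile g kap c h lam A φ φ1 φ2)
    {ε : ℝ} (hε : 0 < ε) :
    ∃ T, ∀ t ≥ T, ∀ z, |φ z - frame c u t z| ≤ ε * eta lam z := by
  have hlam := hu.lam_pos
  obtain ⟨Z1, h1⟩ := hu.exists_near hg hl hφ (half_pos hε)
  obtain ⟨Z2, h2⟩ := hφ.eventually_near_exp (half_pos hε)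
  obtain ⟨M, hM, -, hlip⟩ := hφ.exists_lipschitz hg
  set Z := min (min Z1 Z2) 0 with hZ
  have hZ0 : Z ≤ 0 := min_le_right _ _
  set b := ε * Real.exp (lam * Z) with hb
  have hb0 : 0 < b := by positivity
  have hs : 0 < b / (2 * M) := by positivity
  have hMs : M * (b / (2 * M)) = b / 2 := by field_simp
  obtain ⟨t1, ht1⟩ := hu.eventually_le_shift hg hl hφ (σ := 1) abs_one hs (b / 2) (half_pos hb0)
  obtain ⟨t2, ht2⟩ := hu.eventually_le_shift hg hl hφ (σ := -1) (by simp) hs (b / 2) (half_pos hb0)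
  refine ⟨max (max t1 t2) 0, fun t ht z => ?_⟩
  rcases le_total z Z with hz | hz
  · have hz1 : z ≤ Z1 := hz.trans ((min_le_left _ _).trans (min_le_left _ _))
    have hz2 : z ≤ Z2 := hz.trans ((min_le_left _ _).trans (min_le_right _ _))
    have hexp : Real.exp (lam * z) ≤ 1 :=
      Real.exp_le_one_iff.2 (mul_nonpos_of_nonneg_of_nonpos hlam.le (hz.trans hZ0))
    obtain ⟨h3, h4⟩ := h1 t (by linarith [hu.h_pos, (le_max_right _ _).trans ht]) z hz1
    obtain ⟨h5, h6⟩ := h2 z hz2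
    rw [eta, min_eq_left hexp, abs_le]
    constructor <;> linarith
  · have h3 := ht1 t (((le_max_left _ _).trans (le_max_left _ _)).trans ht) z
    have h4 := ht2 t (((le_max_right _ _).trans (le_max_left _ _)).trans ht) z
    have h5 := hlip z (z + b / (2 * M)) (by linarith)
    have h6 := hlip (z - b / (2 * M)) z (by linarith)
    rw [add_sub_cancel_left, hMs] at h5
    rw [sub_sub_cancel, hMs] at h6
    rw [one_mul, one_mul] at h3
    rw [neg_one_mul, neg_one_mul, ← sub_eq_add_neg] at h4
    have h7 : Real.exp (lam * Z) ≤ eta lam z :=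
      le_min (Real.exp_le_exp.2 (mul_le_mul_of_nonneg_left hz hlam.le))
        (Real.exp_le_one_iff.2 (mul_nonpos_of_nonneg_of_nonpos hlam.le hZ0))
    have h8 : b ≤ ε * eta lam z := mul_le_mul_of_nonneg_left h7 hε.le
    rw [abs_le]
    constructor <;> linarith

end FrontLike

theorem IsWavefront.profile_shift {g φ : ℝ → ℝ} {kap c h lam A a : ℝ}
    (hφ : IsWavefront g h c kap φ) (hc : 0 < c) (hh : 0 < h) (hlam : 0 < lam) (hA : 0 < A)
    (hnorm : Tendsto (fun z => Real.exp (-(lam * z)) * φ z) atBot (𝓝 1))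
    (ha : a = lam⁻¹ * Real.log A) :
    Profile g kap c h lam A (fun z => φ (z + a)) (fun z => deriv φ (z + a))
      (fun z => deriv (deriv φ) (z + a)) := by
  obtain ⟨hpos, -, hC2, heqn, hbot, htop⟩ := hφ
  have hd1 : ∀ z, HasDerivAt φ (deriv φ z) z := fun z =>
    (hC2.differentiable (by norm_num) z).hasDerivAt
  have hd2 : ∀ z, HasDerivAt (deriv φ) (deriv (deriv φ) z) z := fun z =>
    ((hC2.iterate_deriv' 1 1).differentiable (by norm_num) z).hasDerivAt
  refine ⟨hc, hh, hlam, hA, fun z => (hd1 (z + a)).comp_add_const z a,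
    fun z => (hd2 (z + a)).comp_add_const z a, fun z => ?_, fun z => hpos _,
    hbot.comp (tendsto_atBot_add_const_right _ _ tendsto_id),
    htop.comp (tendsto_atTop_add_const_right _ _ tendsto_id), ?_⟩
  · have h1 := heqn (z + a)
    rw [show z + a - c * h = z - c * h + a by ring] at h1
    linarith
  · have h1 := (hnorm.comp (tendsto_atBot_add_const_right atBot a tendsto_id)).const_mul A
    rw [mul_one] at h1
    refine h1.congr fun z => ?_
    have hea : Real.exp (lam * a) = A := by
      rw [ha, mul_inv_cancel_left₀ hlam.ne', Real.exp_log hA]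
    have h2 : Real.exp (-(lam * z)) = A * Real.exp (-(lam * (z + a))) := by
      rw [← hea, ← Real.exp_add]; ring_nf
    rw [h2, mul_assoc]
    rfl

theorem SolvesStar.frontLike {g : ℝ → ℝ} {c h lam A : ℝ} {u w0 : ℝ → ℝ → ℝ}
    (hu : SolvesStar g h u) (hc : 0 < c) (hh : 0 < h) (hlam : 0 < lam) (hA : 0 < A)
    (hIC1 : IC1 h w0) (hIC2 : IC2 h w0)
    (hlim : ∀ ε > (0 : ℝ), ∃ X : ℝ, ∀ x ≤ X, ∀ s ∈ Icc (-h) 0,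
      |w0 s x * Real.exp (-(lam * (x + c * s))) - A| ≤ ε)
    (hinit : ∀ s ∈ Icc (-h) 0, ∀ x : ℝ, u s x = w0 s x) : FrontLike g h c lam A u := by
  obtain ⟨M, hM⟩ := hIC1
  obtain ⟨m, hm, X, hX⟩ := hIC2
  refine ⟨hu, hc, hh, hlam, hA, fun t ht z => ?_, ⟨M, fun t ht z => ?_⟩,
    ⟨m, hm, X, fun t ht z hz => ?_⟩, fun ε hε => ?_⟩
  · rw [frame, hinit t ht]
    exact (hM t ht _).1
  · rw [frame, hinit t ht]
    exact (hM t ht _).2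
  · rw [frame, hinit t ht]
    have := mul_nonpos_of_nonneg_of_nonpos hc.le ht.2
    exact hX _ (by linarith) t ht
  · obtain ⟨Y, hY⟩ := hlim ε hε
    refine ⟨Y - c * h, fun t ht z hz => ?_⟩
    have h1 := mul_le_mul_of_nonneg_left ht.1 hc.le
    have h2 := abs_le.1 (hY (z - c * t) (by linarith) t ht)
    rw [sub_add_cancel] at h2
    rw [frame, hinit t ht]
    set w := w0 t (z - c * t)
    have he := Real.exp_pos (lam * z)
    have h3 : w = w * Real.exp (-(lam * z)) * Real.exp (lam * z) := by
      rw [mul_assoc, ← Real.exp_add, neg_add_cancel, Real.exp_zero, mul_one]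
    rw [h3]
    exact ⟨mul_le_mul_of_nonneg_right (by linarith) he.le,
      mul_le_mul_of_nonneg_right (by linarith) he.le⟩

/-- **Theorem 1 (speed selection / stability with asymptotic phase).**
For strictly increasing `g` satisfying (H) and a non-critical speed `c > c_*`,
every solution whose initial datum satisfies (IC1), (IC2) and behaves like
`A·e^{λ₁(c)(x+cs)}` at `x = −∞` converges, in the weighted uniform norm, to the
wavefront `φ(x+ct+a)` with `a = λ₁(c)⁻¹ ln A`. -/
theorem speed_selection_and_stability
    (g : ℝ → ℝ) (kap del0 Lg h c : ℝ)
    (hH : HypH g kap del0 Lg) (hmono : StrictMono g)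
    (hh : 0 < h) (hc : 0 < c)
    -- `c > c_*`, encoded: χ₀(·;c) has two distinct positive real zeros λ₁ < λ₂ …
    (lam1 lam2 : ℝ) (hlam1_pos : 0 < lam1) (hlam_lt : lam1 < lam2)
    (hchi1 : chi (deriv g 0) c h lam1 = 0) (hchi2 : chi (deriv g 0) c h lam2 = 0)
    -- … and (*) admits wavefronts with speed c and with some speed c' < c
    (φ : ℝ → ℝ) (hφ : IsWavefront g h c kap φ)
    (hlower : ∃ c' < c, ∃ φ' : ℝ → ℝ, IsWavefront g h c' kap φ')
    -- normalization of φ: lim_{z→−∞} e^{−λ₁(c) z} φ(z) = 1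
    (hnorm : Filter.Tendsto (fun z => Real.exp (-(lam1 * z)) * φ z)
      Filter.atBot (nhds 1))
    -- the initial datum
    (w0 : ℝ → ℝ → ℝ) (hIC1 : IC1 h w0) (hIC2 : IC2 h w0) (hHol : LocHolder h w0)
    (A : ℝ) (hA : 0 < A)
    -- lim_{x→−∞} w₀(s,x) e^{−λ₁(c)(x+cs)} = A uniformly in s ∈ [−h,0]
    (hlim : ∀ ε > (0:ℝ), ∃ X : ℝ, ∀ x ≤ X, ∀ s ∈ Set.Icc (-h) 0,
        |w0 s x * Real.exp (-(lam1 * (x + c * s))) - A| ≤ ε)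
    -- u : a classical solution of (*) with initial datum w₀
    (u : ℝ → ℝ → ℝ) (hu : SolvesStar g h u)
    (hinit : ∀ s ∈ Set.Icc (-h) 0, ∀ x : ℝ, u s x = w0 s x)
    (a : ℝ) (ha : a = lam1⁻¹ * Real.log A) :
    -- lim_{t→∞} sup_{x∈ℝ} |φ(x+ct+a) − u(t,x)| / η_{λ₁(c)}(x+ct) = 0
    ∀ ε > (0:ℝ), ∃ T : ℝ, ∀ t ≥ T, ∀ x : ℝ,
      |φ (x + c * t + a) - u t x| ≤ ε * eta lam1 (x + c * t) := by
  obtain ⟨L, s, del, hg⟩ := hH.monostable hmono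
  obtain ⟨lam', C, hlt, hC, hneg, hrem⟩ := hH.exists_exponent hlam1_pos hlam_lt hchi1 hchi2
  have hl : Linearization g (deriv g 0) c h lam1 lam' C :=
    ⟨one_pos.trans hH.deriv0_gt, hlt, hC, hchi1, hneg, hrem, hH.ext_linear⟩
  have hP := hφ.profile_shift hc hh hlam1_pos hA hnorm ha
  have hF := hu.frontLike hc hh hlam1_pos hA hIC1 hIC2 hlim hinit
  intro ε hε
  obtain ⟨T, hT⟩ := hF.tendsto_profile hg hl hP hε
  refine ⟨T, fun t ht x => ?_⟩
  have h1 := hT t ht (x + c * t)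
  rwa [frame_add] at h1
end
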